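/- Let F = (X_n, K_n, π_n)_{n≥1} be a family of irreducible birth and death chains on X_n = {0,1,...,n} and F_c the family of associated continuous-time chains. Let M_n ∈ X_n satisfy inf_n π_n([0,M_n]) > 0 and inf_n π_n([M_n,n]) > 0, and let S = (x_n)_{n≥1} with x_n ∈ {0,n} chosen so that max{E_0 τ̃^{(n)}_{M_n}, E_n τ̃^{(n)}_{M_n}} = E_{x_n} τ̃^{(n)}_{M_n}. If F_c has a maximum total variation cutoff with cutoff time t_n, then the family F_c^S of chains started at x_n has a total variation cutoff with cutoff time t_n; in particular, F_c^S has a (E_{x_n} τ̃^{(n)}_{M_n}, b_n) total variation cutoff where b_n² = max{Var_0 τ̃^{(n)}_{M_n}, Var_n τ̃^{(n)}_{M_n}}. The same statement holds for the discrete-time families under the assumption inf_{n,i} K_n(i,i) > 0. -/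

import Mathlib

open scoped BigOperators
open Filter Matrix Polynomial MeasureTheory

noncomputable section

/-- An irreducible birth and death chain on `{0,1,...,n}`, together with its
(unique) stationary distribution. -/
structure BDChain (n : ℕ) where
  K : Matrix (Fin (n + 1)) (Fin (n + 1)) ℝ
  pi : Fin (n + 1) → ℝ
  K_nonneg : ∀ i j, 0 ≤ K i j
  K_rowSum : ∀ i, ∑ j, K i j = 1
  K_tridiag : ∀ i j : Fin (n + 1), 1 < |(i : ℤ) - (j : ℤ)| → K i j = 0
  K_irred : ∀ i : ℕ, ∀ h : i < n,
    0 < K ⟨i, by omega⟩ ⟨i + 1, by omega⟩ ∧ 0 < K ⟨i + 1, by omega⟩ ⟨i, by omega⟩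
  pi_pos : ∀ i, 0 < pi i
  pi_sum : ∑ i, pi i = 1
  pi_stat : ∀ j, ∑ i, pi i * K i j = pi j

namespace BDChain

variable {n : ℕ}

/-- `π([0,M])` -/
def piLow (c : BDChain n) (M : Fin (n + 1)) : ℝ :=
  ∑ ℓ : Fin (n + 1), if ℓ ≤ M then c.pi ℓ else 0

/-- `π([M,n])` -/
def piHigh (c : BDChain n) (M : Fin (n + 1)) : ℝ :=
  ∑ ℓ : Fin (n + 1), if M ≤ ℓ then c.pi ℓ else 0

/-- `π([a,b])` -/
def piInt (c : BDChain n) (a b : Fin (n + 1)) : ℝ :=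
  ∑ ℓ : Fin (n + 1), if a ≤ ℓ ∧ ℓ ≤ b then c.pi ℓ else 0

/-- The substochastic matrix of the chain killed at state `i`. -/
def killed (c : BDChain n) (i : Fin (n + 1)) : Matrix (Fin (n + 1)) (Fin (n + 1)) ℝ :=
  Matrix.of fun x y => if x = i ∨ y = i then 0 else c.K x y

/-- `P_j(τ_i > m)`, where `τ_i` is the discrete-time hitting time of state `i`. -/
def hitSurv (c : BDChain n) (i j : Fin (n + 1)) (m : ℕ) : ℝ :=
  if j = i then 0 else ∑ y, (c.killed i ^ m) j y

/-- `P_j(τ̃_i > t)`, where `τ̃_i` is the continuous-time hitting time of state `i`. -/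
def hitSurvC (c : BDChain n) (i j : Fin (n + 1)) (t : ℝ) : ℝ :=
  ∑' m : ℕ, (Real.exp (-t) * t ^ m / m.factorial) * c.hitSurv i j m

/-- `E_j τ_i` -/
def hitMean (c : BDChain n) (i j : Fin (n + 1)) : ℝ :=
  ∑' m : ℕ, c.hitSurv i j m

/-- `Var_j τ_i` -/
def hitVar (c : BDChain n) (i j : Fin (n + 1)) : ℝ :=
  (∑' m : ℕ, (2 * (m : ℝ) + 1) * c.hitSurv i j m) - (c.hitMean i j) ^ 2

/-- `E_j τ̃_i` -/
def hitMeanC (c : BDChain n) (i j : Fin (n + 1)) : ℝ :=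
  ∫ t in Set.Ioi (0 : ℝ), c.hitSurvC i j t

/-- `Var_j τ̃_i` -/
def hitVarC (c : BDChain n) (i j : Fin (n + 1)) : ℝ :=
  (∫ t in Set.Ioi (0 : ℝ), 2 * t * c.hitSurvC i j t) - (c.hitMeanC i j) ^ 2

/-- The substochastic matrix of the chain killed at states `i` and `k`. -/
def killed2 (c : BDChain n) (i k : Fin (n + 1)) : Matrix (Fin (n + 1)) (Fin (n + 1)) ℝ :=
  Matrix.of fun x y => if x = i ∨ x = k ∨ y = i ∨ y = k then 0 else c.K x y

/-- `P_j(min{τ_i, τ_k} > m)` -/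
def hitSurv2 (c : BDChain n) (i k j : Fin (n + 1)) (m : ℕ) : ℝ :=
  if j = i ∨ j = k then 0 else ∑ y, (c.killed2 i k ^ m) j y

/-- `E_j min{τ_i, τ_k}` -/
def hitMean2 (c : BDChain n) (i k j : Fin (n + 1)) : ℝ :=
  ∑' m : ℕ, c.hitSurv2 i k j m

/-- `E_j min{τ̃_i, τ̃_k}` -/
def hitMean2C (c : BDChain n) (i k j : Fin (n + 1)) : ℝ :=
  ∫ t in Set.Ioi (0 : ℝ),
    ∑' m : ℕ, (Real.exp (-t) * t ^ m / m.factorial) * c.hitSurv2 i k j m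

/-- The continuous-time kernel `H_t(x,y) = e^{-t(I-K)}(x,y)`. -/
def Ht (c : BDChain n) (t : ℝ) (x y : Fin (n + 1)) : ℝ :=
  ∑' m : ℕ, (Real.exp (-t) * t ^ m / m.factorial) * (c.K ^ m) x y

/-- Discrete-time total variation distance from starting state `x` at time `m`. -/
def dTV (c : BDChain n) (x : Fin (n + 1)) (m : ℕ) : ℝ :=
  ⨆ A : Finset (Fin (n + 1)), (∑ y ∈ A, (c.K ^ m) x y - ∑ y ∈ A, c.pi y)

/-- Continuous-time total variation distance from starting state `x` at time `t`. -/
def dTVC (c : BDChain n) (x : Fin (n + 1)) (t : ℝ) : ℝ :=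
  ⨆ A : Finset (Fin (n + 1)), (∑ y ∈ A, c.Ht t x y - ∑ y ∈ A, c.pi y)

/-- Maximum (over starting states) discrete-time total variation distance. -/
def dTVMax (c : BDChain n) (m : ℕ) : ℝ := ⨆ x, c.dTV x m

/-- Maximum (over starting states) continuous-time total variation distance. -/
def dTVMaxC (c : BDChain n) (t : ℝ) : ℝ := ⨆ x, c.dTVC x t

/-- Discrete-time separation from starting state `x` at time `m`. -/
def sep (c : BDChain n) (x : Fin (n + 1)) (m : ℕ) : ℝ :=
  ⨆ y, (1 - (c.K ^ m) x y / c.pi y)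

/-- Continuous-time separation from starting state `x` at time `t`. -/
def sepC (c : BDChain n) (x : Fin (n + 1)) (t : ℝ) : ℝ :=
  ⨆ y, (1 - c.Ht t x y / c.pi y)

end BDChain

/-- Discrete-time `ε`-mixing time for a distance profile `d`. -/
def mixD (d : ℕ → ℝ) (ε : ℝ) : ℕ := sInf {m : ℕ | d m ≤ ε}

/-- Continuous-time `ε`-mixing time for a distance profile `d`. -/
def mixC (d : ℝ → ℝ) (ε : ℝ) : ℝ := sInf {t : ℝ | 0 ≤ t ∧ d t ≤ ε}

/-- The set of (real) eigenvalues of a square matrix. -/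
def eigSet {ι : Type*} [Fintype ι] (M : Matrix ι ι ℝ) : Set ℝ :=
  {x | ∃ v : ι → ℝ, v ≠ 0 ∧ M.mulVec v = x • v}

/-- `l` is the smallest non-zero eigenvalue of `M`. -/
def IsSmallestNonzeroEig {ι : Type*} [Fintype ι] (M : Matrix ι ι ℝ) (l : ℝ) : Prop :=
  l ∈ eigSet M ∧ l ≠ 0 ∧ ∀ x ∈ eigSet M, x ≠ 0 → l ≤ x

/-- `l` is the smallest eigenvalue of `M`. -/
def IsSmallestEig {ι : Type*} [Fintype ι] (M : Matrix ι ι ℝ) (l : ℝ) : Prop :=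
  l ∈ eigSet M ∧ ∀ x ∈ eigSet M, l ≤ x

/-- The principal submatrix of `I - K` indexed by the states `0, 1, ..., M-1`. -/
def BDChain.subIK {n : ℕ} (c : BDChain n) (M : Fin (n + 1)) :
    Matrix (Fin (M : ℕ)) (Fin (M : ℕ)) ℝ :=
  Matrix.of fun a b =>
    (1 - c.K) (Fin.castLE M.isLt.le a) (Fin.castLE M.isLt.le b)

/-- A family of chains, with `ε ↦ n ↦ T ε n` the mixing time profile, presents a cutoff
with cutoff time `t`. -/
def cutoffWith (T : ℝ → ℕ → ℝ) (t : ℕ → ℝ) : Prop :=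
  ∀ ε ∈ Set.Ioo (0 : ℝ) 1, Filter.Tendsto (fun n => T ε n / t n) Filter.atTop (nhds 1)

/-- A family of chains presents a cutoff. -/
def hasCutoff (T : ℝ → ℕ → ℝ) : Prop :=
  ∃ t : ℕ → ℝ, (∀ n, 0 < t n) ∧ cutoffWith T t

/-- A family of chains presents a `(t_n, b_n)` cutoff. -/
def cutoffWindow (T : ℝ → ℕ → ℝ) (t b : ℕ → ℝ) : Prop :=
  (∀ᶠ n in Filter.atTop, 0 < t n) ∧ (∀ᶠ n in Filter.atTop, 0 < b n) ∧
  Filter.Tendsto (fun n => b n / t n) Filter.atTop (nhds 0) ∧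
  ∀ ε ∈ Set.Ioo (0 : ℝ) 1, ∃ C : ℝ, ∀ᶠ n in Filter.atTop, |T ε n - t n| ≤ C * b n

namespace BDChain

variable {n : ℕ}

/-- The stationary mass of a state, indexed by `ℕ`. -/
def mass (c : BDChain n) (k : ℕ) : ℝ := if h : k < n + 1 then c.pi ⟨k, h⟩ else 0

/-- The transition probabilities, indexed by `ℕ`. -/
def kern (c : BDChain n) (a b : ℕ) : ℝ :=
  if h : a < n + 1 ∧ b < n + 1 then c.K ⟨a, h.1⟩ ⟨b, h.2⟩ else 0

/-- `π([0,k])` -/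
def cum (c : BDChain n) (k : ℕ) : ℝ := ∑ i ∈ Finset.range (k + 1), c.mass i

/-- The conductance of the edge `{k, k+1}`. -/
def flux (c : BDChain n) (k : ℕ) : ℝ := c.mass k * c.kern k (k + 1)

/-- The resistance of the edge `{k, k+1}`. -/
def res (c : BDChain n) (k : ℕ) : ℝ := (c.flux k)⁻¹

/-- The transition operator on functions on `ℕ`. -/
def act (c : BDChain n) (F : ℕ → ℝ) (a : ℕ) : ℝ :=
  ∑ b ∈ Finset.range (n + 1), c.kern a b * F b

theorem mass_coe (c : BDChain n) (i : Fin (n + 1)) : c.mass i = c.pi i := by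
  rw [mass, dif_pos i.isLt]

theorem kern_coe (c : BDChain n) (i j : Fin (n + 1)) : c.kern i j = c.K i j := by
  rw [kern, dif_pos ⟨i.isLt, j.isLt⟩]

theorem act_coe (c : BDChain n) (F : ℕ → ℝ) (i : Fin (n + 1)) :
    c.act F i = ∑ j : Fin (n + 1), c.K i j * F j := by
  rw [act, ← Fin.sum_univ_eq_sum_range (fun b => c.kern i b * F b)]
  simp [kern_coe]

theorem mass_nonneg (c : BDChain n) (k : ℕ) : 0 ≤ c.mass k := by
  unfold mass; split_ifs with h
  · exact (c.pi_pos _).le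
  · exact le_rfl

theorem mass_pos (c : BDChain n) {k : ℕ} (h : k ≤ n) : 0 < c.mass k := by
  unfold mass; rw [dif_pos (by omega)]; exact c.pi_pos _

theorem kern_nonneg (c : BDChain n) (a b : ℕ) : 0 ≤ c.kern a b := by
  unfold kern; split_ifs with h
  · exact c.K_nonneg _ _
  · exact le_rfl

theorem kern_row (c : BDChain n) {a : ℕ} (h : a ≤ n) :
    ∑ b ∈ Finset.range (n + 1), c.kern a b = 1 := by
  rw [← Fin.sum_univ_eq_sum_range (fun b => c.kern a b), ← c.K_rowSum ⟨a, by omega⟩]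
  exact Finset.sum_congr rfl fun b _ => c.kern_coe ⟨a, by omega⟩ b

theorem kern_far (c : BDChain n) {a b : ℕ} (h : a + 1 < b ∨ b + 1 < a) : c.kern a b = 0 := by
  unfold kern; split_ifs with h'
  · apply c.K_tridiag
    rw [lt_abs]
    simp only
    omega
  · rfl

theorem kern_le_one (c : BDChain n) (a b : ℕ) : c.kern a b ≤ 1 := by
  by_cases h : a < n + 1 ∧ b < n + 1
  · rw [← c.kern_row (a := a) (by omega)]
    exact Finset.single_le_sum (f := fun b => c.kern a b) (fun i _ => c.kern_nonneg a i)
      (Finset.mem_range.2 h.2)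
  · rw [kern, dif_neg h]; norm_num

theorem mass_stat (c : BDChain n) {b : ℕ} (h : b ≤ n) :
    ∑ a ∈ Finset.range (n + 1), c.mass a * c.kern a b = c.mass b := by
  rw [← Fin.sum_univ_eq_sum_range (fun a => c.mass a * c.kern a b)]
  have := c.pi_stat ⟨b, by omega⟩
  rw [← c.mass_coe ⟨b, by omega⟩] at this
  rw [← this]
  exact Finset.sum_congr rfl fun a _ => by
    rw [c.mass_coe, ← c.kern_coe a ⟨b, by omega⟩]

theorem mass_sum (c : BDChain n) : c.cum n = 1 := by
  rw [cum, ← Fin.sum_univ_eq_sum_range (fun a => c.mass a), ← c.pi_sum]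
  exact Finset.sum_congr rfl fun a _ => c.mass_coe a

theorem flux_pos (c : BDChain n) {k : ℕ} (h : k < n) : 0 < c.flux k := by
  refine mul_pos (c.mass_pos h.le) ?_
  rw [kern, dif_pos ⟨by omega, by omega⟩]
  exact (c.K_irred k h).1

theorem flux_nonneg (c : BDChain n) (k : ℕ) : 0 ≤ c.flux k :=
  mul_nonneg (c.mass_nonneg k) (c.kern_nonneg _ _)

theorem flux_eq_zero (c : BDChain n) {k : ℕ} (h : n ≤ k) : c.flux k = 0 := by
  rw [flux, kern, dif_neg (by omega), mul_zero]

theorem res_pos (c : BDChain n) {k : ℕ} (h : k < n) : 0 < c.res k :=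
  inv_pos.2 (c.flux_pos h)

theorem res_nonneg (c : BDChain n) (k : ℕ) : 0 ≤ c.res k := inv_nonneg.2 (c.flux_nonneg k)

theorem cum_pos (c : BDChain n) (k : ℕ) : 0 < c.cum k :=
  Finset.sum_pos' (fun i _ => c.mass_nonneg i) ⟨0, by simp, c.mass_pos (Nat.zero_le n)⟩

theorem cum_succ (c : BDChain n) (k : ℕ) : c.cum (k + 1) = c.cum k + c.mass (k + 1) :=
  Finset.sum_range_succ _ _

theorem cum_mono (c : BDChain n) : Monotone c.cum :=
  monotone_nat_of_le_succ fun k => by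
    rw [cum_succ]; linarith [c.mass_nonneg (k + 1)]

theorem cum_le_one (c : BDChain n) (k : ℕ) : c.cum k ≤ 1 := by
  rcases le_total k n with h | h
  · exact (c.cum_mono h).trans c.mass_sum.le
  · obtain ⟨d, rfl⟩ := Nat.exists_eq_add_of_le h
    induction d with
    | zero => exact c.mass_sum.le
    | succ d ih =>
      rw [← add_assoc, cum_succ]
      have : c.mass (n + d + 1) = 0 := by rw [mass, dif_neg (by omega)]
      linarith [ih (by omega)]

theorem mass_le_cum (c : BDChain n) (k : ℕ) : c.mass k ≤ c.cum k :=
  Finset.single_le_sum (fun i _ => c.mass_nonneg i) (by simp)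

/-- Each edge step takes at least one unit of time on average. -/
theorem one_le_res_mul_cum (c : BDChain n) {k : ℕ} (h : k < n) : 1 ≤ c.res k * c.cum k := by
  rw [res, inv_mul_eq_div, le_div_iff₀ (c.flux_pos h), one_mul]
  calc c.flux k ≤ c.mass k * 1 :=
        mul_le_mul_of_nonneg_left (c.kern_le_one _ _) (c.mass_nonneg k)
    _ ≤ c.cum k := by rw [mul_one]; exact c.mass_le_cum k

theorem sum_cross_edge {k : ℕ} (hk : k < n) (f : ℕ → ℕ → ℝ)
    (hf : ∀ a b, a + 1 < b → f a b = 0) :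
    ∑ a ∈ Finset.range (k + 1), ∑ b ∈ Finset.Ico (k + 1) (n + 1), f a b = f k (k + 1) := by
  rw [Finset.sum_eq_single k, Finset.sum_eq_single (k + 1)]
  · intro b hb hne; rw [Finset.mem_Ico] at hb; exact hf _ _ (by omega)
  · intro h; exact absurd (Finset.mem_Ico.2 ⟨le_rfl, by omega⟩) h
  · intro a ha hne
    refine Finset.sum_eq_zero fun b hb => hf _ _ ?_
    rw [Finset.mem_Ico] at hb; rw [Finset.mem_range] at ha; omega
  · intro h; simp at h

theorem flux_eq (c : BDChain n) (k : ℕ) : c.flux k = c.mass (k + 1) * c.kern (k + 1) k := by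
  by_cases hk : k < n
  · have split : ∀ f : ℕ → ℝ, ∑ b ∈ Finset.range (n + 1), f b =
        ∑ b ∈ Finset.range (k + 1), f b + ∑ b ∈ Finset.Ico (k + 1) (n + 1), f b := fun f =>
      (Finset.sum_range_add_sum_Ico f (by omega)).symm
    have e1 : ∑ z ∈ Finset.range (k + 1), ∑ i ∈ Finset.range (n + 1), c.mass z * c.kern z i
        = ∑ z ∈ Finset.range (k + 1), c.mass z := Finset.sum_congr rfl fun z hz => by
      rw [← Finset.mul_sum, c.kern_row (by rw [Finset.mem_range] at hz; omega), mul_one]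
    have e2 : ∑ z ∈ Finset.range (k + 1), ∑ i ∈ Finset.range (n + 1), c.mass i * c.kern i z
        = ∑ z ∈ Finset.range (k + 1), c.mass z := Finset.sum_congr rfl fun z hz => by
      rw [c.mass_stat (by rw [Finset.mem_range] at hz; omega)]
    simp only [split, Finset.sum_add_distrib] at e1 e2
    rw [sum_cross_edge hk (fun a b => c.mass a * c.kern a b)
      (fun a b h => by rw [c.kern_far (Or.inl h), mul_zero])] at e1
    rw [sum_cross_edge hk (fun a b => c.mass b * c.kern b a)
      (fun a b h => by rw [c.kern_far (Or.inr h), mul_zero]), Finset.sum_comm] at e2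
    rw [flux]; linarith
  · rw [c.flux_eq_zero (by omega), kern, dif_neg (by omega), mul_zero]

theorem reversible (c : BDChain n) (a b : ℕ) :
    c.mass a * c.kern a b = c.mass b * c.kern b a := by
  rcases lt_trichotomy a b with h | rfl | h
  · by_cases h' : b = a + 1
    · subst h'; exact c.flux_eq a
    · rw [c.kern_far (Or.inl (by omega)), c.kern_far (Or.inr (by omega)), mul_zero, mul_zero]
  · rfl
  · by_cases h' : a = b + 1
    · subst h'; exact (c.flux_eq b).symm
    · rw [c.kern_far (Or.inr (by omega)), c.kern_far (Or.inl (by omega)), mul_zero, mul_zero]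

theorem sum_mass_sub_act (c : BDChain n) (F : ℕ → ℝ) {k : ℕ} (hk : k ≤ n) :
    ∑ i ∈ Finset.range (k + 1), c.mass i * (F i - c.act F i) =
      c.flux k * (F k - F (k + 1)) := by
  have e1 : ∑ i ∈ Finset.range (k + 1), c.mass i * (F i - c.act F i) =
      ∑ i ∈ Finset.range (k + 1), ∑ z ∈ Finset.range (n + 1),
        c.mass i * c.kern i z * (F i - F z) := by
    refine Finset.sum_congr rfl fun i hi => ?_
    have : F i = ∑ z ∈ Finset.range (n + 1), c.kern i z * F i := by
      rw [← Finset.sum_mul, c.kern_row (by rw [Finset.mem_range] at hi; omega), one_mul]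
    conv_lhs => rw [this]
    rw [act, ← Finset.sum_sub_distrib, Finset.mul_sum]
    exact Finset.sum_congr rfl fun z _ => by ring
  have anti : ∑ i ∈ Finset.range (k + 1), ∑ z ∈ Finset.range (k + 1),
      c.mass i * c.kern i z * (F i - F z) = 0 := by
    have h1 : ∑ i ∈ Finset.range (k + 1), ∑ z ∈ Finset.range (k + 1),
        c.mass i * c.kern i z * (F i - F z) = - ∑ i ∈ Finset.range (k + 1),
          ∑ z ∈ Finset.range (k + 1), c.mass i * c.kern i z * (F i - F z) := by
      conv_lhs => rw [Finset.sum_comm]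
      rw [← Finset.sum_neg_distrib]
      refine Finset.sum_congr rfl fun i _ => ?_
      rw [← Finset.sum_neg_distrib]
      refine Finset.sum_congr rfl fun z _ => ?_
      rw [c.reversible z i]; ring
    linarith
  rw [e1]
  rcases hk.lt_or_eq with hk | rfl
  · simp only [← Finset.sum_range_add_sum_Ico _ (show k + 1 ≤ n + 1 by omega),
      Finset.sum_add_distrib]
    rw [anti, zero_add, sum_cross_edge hk _
      (fun a b h => by rw [c.kern_far (Or.inl h), mul_zero, zero_mul]), flux]
  · rw [anti, c.flux_eq_zero le_rfl, zero_mul]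

/-- The Green operator of the chain on `[0,j)` killed at `j`. -/
def green (c : BDChain n) (g : ℕ → ℝ) (j x : ℕ) : ℝ :=
  ∑ k ∈ Finset.Ico x j, c.res k * ∑ z ∈ Finset.range (k + 1), c.mass z * g z

theorem green_self (c : BDChain n) (g : ℕ → ℝ) (j : ℕ) : c.green g j j = 0 := by
  simp [green]

theorem green_succ (c : BDChain n) (g : ℕ → ℝ) {j x : ℕ} (h : x < j) :
    c.green g j x = c.res x * (∑ z ∈ Finset.range (x + 1), c.mass z * g z) +
      c.green g j (x + 1) :=
  Finset.sum_eq_sum_Ico_succ_bot h _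

theorem act_green (c : BDChain n) (g : ℕ → ℝ) {j x : ℕ} (h : x < j) (hj : j ≤ n) :
    c.act (c.green g j) x = c.green g j x - g x := by
  have key : ∀ k < j, ∑ i ∈ Finset.range (k + 1), c.mass i *
      (c.green g j i - c.act (c.green g j) i) = ∑ z ∈ Finset.range (k + 1), c.mass z * g z := by
    intro k hk
    rw [c.sum_mass_sub_act _ (by omega), c.green_succ g hk, res, add_sub_cancel_right,
      mul_inv_cancel_left₀ (c.flux_pos (by omega)).ne']
  have hx : c.mass x * (c.green g j x - c.act (c.green g j) x) = c.mass x * g x := by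
    cases x with
    | zero => simpa using key 0 h
    | succ x =>
      have h1 := key (x + 1) h
      rw [Finset.sum_range_succ, key x (by omega), Finset.sum_range_succ _ (x + 1)] at h1
      linarith
  have := mul_left_cancel₀ (c.mass_pos (show x ≤ n by omega)).ne' hx
  linarith

/-- `E_x τ_j` for `x ≤ j`. -/
def upMean (c : BDChain n) (j x : ℕ) : ℝ := c.green (fun _ => 1) j x

/-- `E_x τ_j (τ_j + 1) / 2` for `x ≤ j`. -/
def upSq (c : BDChain n) (j x : ℕ) : ℝ := c.green (c.upMean j) j x

theorem upMean_eq (c : BDChain n) (j x : ℕ) :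
    c.upMean j x = ∑ k ∈ Finset.Ico x j, c.res k * c.cum k := by
  simp [upMean, green, cum]

theorem upMean_self (c : BDChain n) (j : ℕ) : c.upMean j j = 0 := c.green_self _ _

theorem upSq_self (c : BDChain n) (j : ℕ) : c.upSq j j = 0 := c.green_self _ _

theorem act_upMean (c : BDChain n) {j x : ℕ} (h : x < j) (hj : j ≤ n) :
    c.act (c.upMean j) x = c.upMean j x - 1 := c.act_green _ h hj

theorem act_upSq (c : BDChain n) {j x : ℕ} (h : x < j) (hj : j ≤ n) :
    c.act (c.upSq j) x = c.upSq j x - c.upMean j x := c.act_green _ h hj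

theorem upMean_nonneg (c : BDChain n) (j x : ℕ) : 0 ≤ c.upMean j x := by
  rw [upMean_eq]
  exact Finset.sum_nonneg fun k _ => mul_nonneg (c.res_nonneg k) (c.cum_pos k).le

theorem sub_le_upMean (c : BDChain n) {j : ℕ} (hj : j ≤ n) (x : ℕ) :
    (j : ℝ) - x ≤ c.upMean j x := by
  rw [upMean_eq]
  calc (j : ℝ) - x ≤ ((j - x : ℕ) : ℝ) := by
        rw [sub_le_iff_le_add]; exact_mod_cast (by omega : j ≤ j - x + x)
    _ = ∑ k ∈ Finset.Ico x j, (1 : ℝ) := by simp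
    _ ≤ _ := Finset.sum_le_sum fun k hk =>
      c.one_le_res_mul_cum (by rw [Finset.mem_Ico] at hk; omega)

/-- `∑_{l<k} π([0,l])² / (π(l) p_l)`, the mean of `τ_k` for the chain started from
the stationary distribution restricted to `[0,k]`. -/
def acc (c : BDChain n) (k : ℕ) : ℝ := ∑ l ∈ Finset.range k, c.res l * c.cum l ^ 2

/-- The variance of the passage time from `k` to `k+1`. -/
def stepVar (c : BDChain n) (k : ℕ) : ℝ := (c.res k * c.cum k) ^ 2 + 2 * c.res k * c.acc k

/-- The variance of the continuous-time passage time from `x` to `j`. -/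
def upVar (c : BDChain n) (j x : ℕ) : ℝ := ∑ k ∈ Finset.Ico x j, c.stepVar k

theorem acc_nonneg (c : BDChain n) (k : ℕ) : 0 ≤ c.acc k :=
  Finset.sum_nonneg fun l _ => mul_nonneg (c.res_nonneg l) (sq_nonneg _)

theorem acc_succ (c : BDChain n) (k : ℕ) : c.acc (k + 1) = c.acc k + c.res k * c.cum k ^ 2 :=
  Finset.sum_range_succ _ _

theorem stepVar_nonneg (c : BDChain n) (k : ℕ) : 0 ≤ c.stepVar k := by
  have := c.res_nonneg k
  have := c.acc_nonneg k
  unfold stepVar; positivity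

theorem upMean_succ (c : BDChain n) {j x : ℕ} (h : x < j) :
    c.upMean j x = c.res x * c.cum x + c.upMean j (x + 1) := by
  rw [upMean_eq, upMean_eq]; exact Finset.sum_eq_sum_Ico_succ_bot h _

theorem sum_mass_mul_upMean (c : BDChain n) {j x : ℕ} (h : x ≤ j) :
    ∑ z ∈ Finset.range (x + 1), c.mass z * c.upMean j z =
      c.acc x + c.cum x * c.upMean j x := by
  induction x with
  | zero => simp [acc, cum]
  | succ x ih =>
    rw [Finset.sum_range_succ, ih (by omega), acc_succ, cum_succ, c.upMean_succ (by omega)]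
    ring

theorem two_mul_upSq (c : BDChain n) {j x : ℕ} (h : x ≤ j) :
    2 * c.upSq j x - c.upMean j x ^ 2 = c.upVar j x := by
  obtain ⟨d, rfl⟩ := Nat.exists_eq_add_of_le h
  induction d generalizing x with
  | zero => simp [upSq_self, upMean_self, upVar]
  | succ d ih =>
    have e : x + (d + 1) = x + 1 + d := by ring
    have := ih (x := x + 1) (by omega)
    rw [e, upSq, c.green_succ _ (by omega), c.sum_mass_mul_upMean (by omega), upVar,
      Finset.sum_eq_sum_Ico_succ_bot (by omega), c.upMean_succ (show x < x + 1 + d by omega)]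
    change _ = _ + c.upVar _ _
    rw [← this, stepVar, upSq]
    ring

theorem upVar_nonneg (c : BDChain n) (j x : ℕ) : 0 ≤ c.upVar j x :=
  Finset.sum_nonneg fun k _ => c.stepVar_nonneg k

theorem upMean_le_upVar (c : BDChain n) {j : ℕ} (hj : j ≤ n) (x : ℕ) :
    c.upMean j x ≤ c.upVar j x := by
  rw [upMean_eq, upVar]
  refine Finset.sum_le_sum fun k hk => ?_
  have h1 := c.one_le_res_mul_cum (show k < n by rw [Finset.mem_Ico] at hk; omega)
  have := c.res_nonneg k
  have := c.acc_nonneg k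
  have : 0 ≤ 2 * c.res k * c.acc k := by positivity
  unfold stepVar; nlinarith

end BDChain

namespace BDChain

variable {n : ℕ}

theorem act_le_act (c : BDChain n) {F G : ℕ → ℝ} {x : ℕ} (h : ∀ z ≤ x + 1, z ≤ n → F z ≤ G z) :
    c.act F x ≤ c.act G x := by
  refine Finset.sum_le_sum fun z hz => ?_
  rw [Finset.mem_range] at hz
  by_cases hx : z ≤ x + 1
  · exact mul_le_mul_of_nonneg_left (h z hx (by omega)) (c.kern_nonneg _ _)
  · rw [c.kern_far (Or.inl (by omega)), zero_mul, zero_mul]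

theorem act_const (c : BDChain n) (r : ℝ) {x : ℕ} (h : x ≤ n) : c.act (fun _ => r) x = r := by
  rw [act, ← Finset.sum_mul, c.kern_row h, one_mul]

theorem act_add (c : BDChain n) (F G : ℕ → ℝ) (x : ℕ) :
    c.act (fun z => F z + G z) x = c.act F x + c.act G x := by
  simp only [act, mul_add, Finset.sum_add_distrib]

theorem act_sub (c : BDChain n) (F G : ℕ → ℝ) (x : ℕ) :
    c.act (fun z => F z - G z) x = c.act F x - c.act G x := by
  simp only [act, mul_sub, Finset.sum_sub_distrib]

theorem act_mul (c : BDChain n) (r : ℝ) (F : ℕ → ℝ) (x : ℕ) :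
    c.act (fun z => r * F z) x = r * c.act F x := by
  simp only [act, Finset.mul_sum]
  exact Finset.sum_congr rfl fun z _ => by ring

theorem act_sum (c : BDChain n) {ι : Type*} (s : Finset ι) (F : ι → ℕ → ℝ) (x : ℕ) :
    c.act (fun z => ∑ i ∈ s, F i z) x = ∑ i ∈ s, c.act (F i) x := by
  simp only [act, Finset.mul_sum]
  exact Finset.sum_comm

theorem tendsto_act (c : BDChain n) {ι : Type*} {l : Filter ι} {F : ι → ℕ → ℝ} {G : ℕ → ℝ}
    {x : ℕ} (h : ∀ z ≤ x + 1, Tendsto (fun i => F i z) l (nhds (G z))) :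
    Tendsto (fun i => c.act (F i) x) l (nhds (c.act G x)) := by
  refine tendsto_finsetSum _ fun z _ => ?_
  by_cases hx : z ≤ x + 1
  · exact (h z hx).const_mul _
  · simp only [c.kern_far (Or.inl (show x + 1 < z by omega)), zero_mul]
    exact tendsto_const_nhds

/-- `P_x(τ_j > m)`, indexed by `ℕ`. -/
def surv (c : BDChain n) (j : ℕ) : ℕ → ℕ → ℝ
  | 0, x => if x = j then 0 else 1
  | m + 1, x => if x = j then 0 else c.act (surv c j m) x

theorem surv_self (c : BDChain n) (j m : ℕ) : c.surv j m j = 0 := by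
  cases m <;> simp [surv]

theorem surv_zero (c : BDChain n) {j x : ℕ} (h : x ≠ j) : c.surv j 0 x = 1 := by
  simp [surv, h]

theorem surv_succ (c : BDChain n) {j x : ℕ} (h : x ≠ j) (m : ℕ) :
    c.surv j (m + 1) x = c.act (c.surv j m) x := by
  simp [surv, h]

theorem surv_nonneg (c : BDChain n) (j m x : ℕ) : 0 ≤ c.surv j m x := by
  induction m generalizing x with
  | zero => unfold surv; split_ifs <;> norm_num
  | succ m ih =>
    unfold surv; split_ifs
    · exact le_rfl
    · exact Finset.sum_nonneg fun z _ => mul_nonneg (c.kern_nonneg _ _) (ih z)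

theorem surv_le_one (c : BDChain n) (j m : ℕ) {x : ℕ} (hx : x ≤ n) : c.surv j m x ≤ 1 := by
  induction m generalizing x with
  | zero => unfold surv; split_ifs <;> norm_num
  | succ m ih =>
    unfold surv; split_ifs
    · norm_num
    · rw [← c.act_const 1 hx]
      exact c.act_le_act fun z _ hz => ih hz

theorem hitSurv_eq (c : BDChain n) (j x : Fin (n + 1)) (m : ℕ) :
    c.hitSurv j x m = c.surv j m x := by
  induction m generalizing x with
  | zero =>
    by_cases h : x = j
    · simp [hitSurv, h, surv]
    · rw [hitSurv, if_neg h, c.surv_zero (fun h' => h (Fin.ext h'))]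
      simp [Matrix.one_apply]
  | succ m ih =>
    by_cases h : x = j
    · rw [hitSurv, if_pos h, h, surv_self]
    · rw [hitSurv, if_neg h, c.surv_succ (fun h' => h (Fin.ext h')), act_coe]
      simp only [pow_succ', Matrix.mul_apply]
      rw [Finset.sum_comm]
      refine Finset.sum_congr rfl fun z _ => ?_
      rw [← ih, ← Finset.mul_sum, hitSurv, killed, Matrix.of_apply]
      by_cases hz : z = j
      · simp [hz]
      · simp [h, hz]

theorem surv_le (c : BDChain n) {j : ℕ} (hj : j ≤ n) {U : ℕ → ℕ → ℝ} (hself : ∀ m, 0 ≤ U m j)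
    (hzero : ∀ x < j, 1 ≤ U 0 x) (hsucc : ∀ m, ∀ x < j, c.act (U m) x ≤ U (m + 1) x)
    (m : ℕ) {x : ℕ} (hx : x ≤ j) : c.surv j m x ≤ U m x := by
  induction m generalizing x with
  | zero =>
    rcases hx.lt_or_eq with h | rfl
    · rw [c.surv_zero h.ne]; exact hzero x h
    · rw [surv_self]; exact hself _
  | succ m ih =>
    rcases hx.lt_or_eq with h | rfl
    · rw [c.surv_succ h.ne]
      exact (c.act_le_act fun z hz _ => ih (by omega)).trans (hsucc m x h)
    · rw [surv_self]; exact hself _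

theorem le_surv (c : BDChain n) {j : ℕ} (hj : j ≤ n) {U : ℕ → ℕ → ℝ} (hself : ∀ m, U m j ≤ 0)
    (hzero : ∀ x < j, U 0 x ≤ 1) (hsucc : ∀ m, ∀ x < j, U (m + 1) x ≤ c.act (U m) x)
    (m : ℕ) {x : ℕ} (hx : x ≤ j) : U m x ≤ c.surv j m x := by
  induction m generalizing x with
  | zero =>
    rcases hx.lt_or_eq with h | rfl
    · rw [c.surv_zero h.ne]; exact hzero x h
    · rw [surv_self]; exact hself _
  | succ m ih =>
    rcases hx.lt_or_eq with h | rfl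
    · rw [c.surv_succ h.ne]
      exact (hsucc m x h).trans (c.act_le_act fun z hz _ => ih (by omega))
    · rw [surv_self]; exact hself _

theorem two_mul_upSq_eq (c : BDChain n) {j x : ℕ} (h : x ≤ j) :
    2 * c.upSq j x = c.upVar j x + c.upMean j x ^ 2 := by
  rw [← c.two_mul_upSq h]; ring

/-- Chebyshev's inequality for the upper tail of the hitting time. -/
theorem sq_mul_surv_le (c : BDChain n) {j : ℕ} (hj : j ≤ n) {a : ℝ} (ha : 0 ≤ a) (m : ℕ)
    {x : ℕ} (hx : x ≤ j) :
    a ^ 2 * c.surv j m x ≤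
      c.upVar j x - c.upMean j x + (c.upMean j x + a - m) ^ 2 := by
  rcases ha.eq_or_lt with rfl | ha
  · have := c.upMean_le_upVar hj x
    nlinarith [sq_nonneg (c.upMean j x + 0 - m)]
  have key := c.surv_le hj (U := fun m x => (2 * c.upSq j x - c.upMean j x + (a - m) ^ 2
      + 2 * c.upMean j x * (a - m)) / a ^ 2) ?_ ?_ ?_ m hx
  · have e := c.two_mul_upSq_eq hx
    rw [le_div_iff₀ (by positivity), e] at key
    linarith
  · intro m
    simp only [upSq_self, upMean_self]
    apply div_nonneg _ (by positivity)
    nlinarith [sq_nonneg (a - m)]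
  · intro x h
    rw [le_div_iff₀ (by positivity), c.two_mul_upSq_eq h.le]
    have h1 := c.upMean_le_upVar hj x
    have h2 := c.upMean_nonneg j x
    push_cast
    nlinarith [mul_nonneg h2 ha.le, sq_nonneg (c.upMean j x)]
  · intro m x h
    have e : (fun z => (2 * c.upSq j z - c.upMean j z + (a - m) ^ 2
      + 2 * c.upMean j z * (a - m)) / a ^ 2) = fun z =>
        (2 / a ^ 2) * c.upSq j z + ((2 * (a - m) - 1) / a ^ 2 * c.upMean j z +
          (fun _ => (a - m) ^ 2 / a ^ 2) z) := by
      funext z; ring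
    rw [e, act_add, act_mul, act_add, act_mul, c.act_const _ (by omega), c.act_upMean h hj,
      c.act_upSq h hj]
    apply le_of_eq
    push_cast
    ring

/-- Chebyshev's inequality for the lower tail of the hitting time. -/
theorem sq_mul_one_sub_surv_le (c : BDChain n) {j : ℕ} (hj : j ≤ n) {a : ℝ} (ha : 0 < a) (m : ℕ)
    {x : ℕ} (hx : x ≤ j) :
    a ^ 2 * (1 - c.surv j m x) ≤
      c.upVar j x - c.upMean j x + (c.upMean j x - a - m) ^ 2 := by
  have key := c.le_surv hj (U := fun m x => 1 - (2 * c.upSq j x - c.upMean j x + (a + m) ^ 2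
      - 2 * c.upMean j x * (a + m)) / a ^ 2) ?_ ?_ ?_ m hx
  · have e := c.two_mul_upSq_eq hx
    rw [e, sub_le_comm, le_div_iff₀ (by positivity)] at key
    linarith
  · intro m
    simp only [upSq_self, upMean_self]
    rw [sub_nonpos, le_div_iff₀ (by positivity)]
    have : (0 : ℝ) ≤ m := m.cast_nonneg
    nlinarith [mul_nonneg ha.le this]
  · intro x h
    rw [sub_le_self_iff, c.two_mul_upSq_eq h.le]
    have h1 := c.upMean_le_upVar hj x
    have h2 := c.upMean_nonneg j x
    push_cast
    apply div_nonneg _ (by positivity)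
    nlinarith [sq_nonneg (c.upMean j x - a)]
  · intro m x h
    have e : (fun z => 1 - (2 * c.upSq j z - c.upMean j z + (a + m) ^ 2
      - 2 * c.upMean j z * (a + m)) / a ^ 2) = fun z =>
        (-2 / a ^ 2) * c.upSq j z + ((2 * (a + m) + 1) / a ^ 2 * c.upMean j z +
          (fun _ => 1 - (a + m) ^ 2 / a ^ 2) z) := by
      funext z; ring
    rw [e, act_add, act_mul, act_add, act_mul, c.act_const _ (by omega), c.act_upMean h hj,
      c.act_upSq h hj]
    apply le_of_eq
    push_cast
    ring

/-- Harmonic functions vanishing at `j` vanish on `[0,j]`. -/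
theorem eq_zero_of_act_eq (c : BDChain n) {j : ℕ} (hj : j ≤ n) {F : ℕ → ℝ} (hself : F j = 0)
    (h : ∀ x < j, c.act F x = F x) {x : ℕ} (hx : x ≤ j) : F x = 0 := by
  have step : ∀ k < j, F k = F (k + 1) := by
    intro k hk
    have := c.sum_mass_sub_act F (k := k) (by omega)
    rw [Finset.sum_eq_zero (fun i hi => by
      rw [h i (by rw [Finset.mem_range] at hi; omega), sub_self, mul_zero])] at this
    have := (mul_eq_zero.1 this.symm).resolve_left (c.flux_pos (by omega)).ne'
    linarith
  obtain ⟨d, rfl⟩ := Nat.exists_eq_add_of_le hx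
  clear h
  induction d with
  | zero => exact hself
  | succ d ih =>
    exact ih (by omega) (by rw [step (x + d) (by omega)]; exact hself) (by omega)
      (fun k hk => step k (by omega))

theorem tendsto_green (c : BDChain n) {j : ℕ} (hj : j ≤ n) {F G : ℕ → ℕ → ℝ} {g : ℕ → ℝ}
    (hself : ∀ N, F N j = 0) (hzero : ∀ x, F 0 x = 0) (hmono : ∀ x, Monotone fun N => F N x)
    (hsucc : ∀ N, ∀ x < j, F (N + 1) x = c.act (F N) x + G N x) (hg : ∀ x < j, ∀ N, G N x ≤ g x)
    (hlim : ∀ x < j, Tendsto (fun N => G N x) atTop (nhds (g x))) {x : ℕ} (hx : x ≤ j) :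
    Tendsto (fun N => F N x) atTop (nhds (c.green g j x)) := by
  have hg0 : ∀ x < j, 0 ≤ g x := fun x h => by
    refine le_trans ?_ (hg x h 0)
    have h1 := hsucc 0 x h
    have h2 : c.act (F 0) x = 0 := by simp [act, hzero]
    have := hmono x (Nat.zero_le 1)
    simp only [hzero] at this
    rw [h2] at h1
    simp only [zero_add] at h1
    linarith
  have bdd : ∀ N, ∀ x ≤ j, F N x ≤ c.green g j x := by
    intro N
    induction N with
    | zero =>
      intro x hx
      rw [hzero]
      refine Finset.sum_nonneg fun k hk => mul_nonneg (c.res_nonneg k)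
        (Finset.sum_nonneg fun z hz => mul_nonneg (c.mass_nonneg z) (hg0 z ?_))
      rw [Finset.mem_Ico] at hk; rw [Finset.mem_range] at hz; omega
    | succ N ih =>
      intro x hx
      rcases hx.lt_or_eq with h | rfl
      · rw [hsucc N x h]
        have := c.act_le_act (F := F N) (G := c.green g j) (x := x)
          fun z hz _ => ih z (by omega)
        rw [c.act_green g h hj] at this
        linarith [hg x h N]
      · rw [hself, green_self]
  have conv : ∀ x ≤ j, Tendsto (fun N => F N x) atTop (nhds (⨆ N, F N x)) := fun x h =>
    tendsto_atTop_ciSup (hmono x) ⟨_, by rintro _ ⟨N, rfl⟩; exact bdd N x h⟩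
  have := c.eq_zero_of_act_eq hj (F := fun z => (⨆ N, F N z) - c.green g j z)
    (by simp [hself, green_self]) ?_ hx
  · rw [← sub_eq_zero.1 this]; exact conv x hx
  · intro x h
    rw [act_sub, c.act_green g h hj]
    have l1 := (conv x h.le).comp (tendsto_add_atTop_nat 1)
    have l2 := (c.tendsto_act (F := F) (x := x) fun z hz => conv z (by omega)).add (hlim x h)
    have := tendsto_nhds_unique l1 (l2.congr fun N => (hsucc N x h).symm)
    rw [this]; ring

theorem tendsto_sum_surv (c : BDChain n) {j : ℕ} (hj : j ≤ n) {x : ℕ} (hx : x ≤ j) :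
    Tendsto (fun N => ∑ m ∈ Finset.range N, c.surv j m x) atTop (nhds (c.upMean j x)) := by
  refine c.tendsto_green hj (F := fun N x => ∑ m ∈ Finset.range N, c.surv j m x)
    (G := fun _ _ => 1) ?_ ?_ ?_ ?_ (fun _ _ _ => le_rfl) (fun _ _ => tendsto_const_nhds) hx
  · intro N; simp [surv_self]
  · simp
  · intro x
    exact monotone_nat_of_le_succ fun N => by
      rw [Finset.sum_range_succ]; linarith [c.surv_nonneg j N x]
  · intro N x h
    rw [Finset.sum_range_succ', c.surv_zero h.ne, act_sum]
    simp only [c.surv_succ h.ne]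

theorem hasSum_surv (c : BDChain n) {j : ℕ} (hj : j ≤ n) {x : ℕ} (hx : x ≤ j) :
    HasSum (fun m => c.surv j m x) (c.upMean j x) :=
  (hasSum_iff_tendsto_nat_of_nonneg (fun m => c.surv_nonneg j m x) _).2
    (c.tendsto_sum_surv hj hx)

theorem hasSum_succ_mul_surv (c : BDChain n) {j : ℕ} (hj : j ≤ n) {x : ℕ} (hx : x ≤ j) :
    HasSum (fun m : ℕ => ((m : ℝ) + 1) * c.surv j m x) (c.upSq j x) := by
  have nn : ∀ (m : ℕ) x, 0 ≤ ((m : ℝ) + 1) * c.surv j m x := fun m x =>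
    mul_nonneg (by positivity) (c.surv_nonneg j m x)
  refine (hasSum_iff_tendsto_nat_of_nonneg (fun m => nn m x) _).2 ?_
  refine c.tendsto_green hj (F := fun N x => ∑ m ∈ Finset.range N, ((m : ℝ) + 1) * c.surv j m x)
    (G := fun N x => ∑ m ∈ Finset.range (N + 1), c.surv j m x) ?_ ?_ ?_ ?_ ?_ ?_ hx
  · intro N; simp [surv_self]
  · simp
  · intro x
    exact monotone_nat_of_le_succ fun N => by
      rw [Finset.sum_range_succ]; linarith [nn N x]
  · intro N x h
    rw [Finset.sum_range_succ', Finset.sum_range_succ' (fun m => c.surv j m x), act_sum]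
    simp only [c.surv_succ h.ne, act_mul]
    rw [← add_assoc, ← Finset.sum_add_distrib]
    push_cast
    simp only [zero_add, one_mul]
    congr 1
    exact Finset.sum_congr rfl fun m _ => by ring
  · intro x h N
    exact sum_le_hasSum _ (fun m _ => c.surv_nonneg j m x) (c.hasSum_surv hj h.le)
  · intro x h
    exact (c.tendsto_sum_surv hj h.le).comp (tendsto_add_atTop_nat 1)

end BDChain

/-- The weights of the Poisson distribution. -/
def poissonWeight (t : ℝ) (m : ℕ) : ℝ := Real.exp (-t) * t ^ m / m.factorial

theorem poissonWeight_nonneg {t : ℝ} (ht : 0 ≤ t) (m : ℕ) : 0 ≤ poissonWeight t m := by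
  unfold poissonWeight; positivity

theorem hasSum_poissonWeight (t : ℝ) : HasSum (poissonWeight t) 1 := by
  have := (NormedSpace.expSeries_div_hasSum_exp t).mul_left (Real.exp (-t))
  rw [← Real.exp_eq_exp_ℝ, ← Real.exp_add, neg_add_cancel, Real.exp_zero] at this
  refine this.congr_fun ?_
  intro m; unfold poissonWeight; ring

theorem poissonWeight_succ (t : ℝ) (m : ℕ) :
    ((m : ℝ) + 1) * poissonWeight t (m + 1) = t * poissonWeight t m := by
  unfold poissonWeight
  rw [Nat.factorial_succ]; push_cast
  have := Nat.factorial_ne_zero m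
  field_simp
  ring

theorem hasSum_mul_poissonWeight (t : ℝ) : HasSum (fun m : ℕ => (m : ℝ) * poissonWeight t m) t := by
  rw [← hasSum_nat_add_iff' 1]
  have := (hasSum_poissonWeight t).mul_left t
  simp only [mul_one, ← poissonWeight_succ] at this
  simpa using this

theorem hasSum_sq_mul_poissonWeight (t : ℝ) :
    HasSum (fun m : ℕ => (m : ℝ) ^ 2 * poissonWeight t m) (t ^ 2 + t) := by
  rw [← hasSum_nat_add_iff' 1]
  have := ((hasSum_mul_poissonWeight t).add (hasSum_poissonWeight t)).mul_left t
  have e : t ^ 2 + t - ∑ i ∈ Finset.range 1, (i : ℝ) ^ 2 * poissonWeight t i = t * (t + 1) := by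
    simp; ring
  rw [e]
  refine this.congr_fun fun m => ?_
  push_cast
  rw [sq, mul_assoc, poissonWeight_succ]
  ring

theorem hasSum_sub_sq_mul_poissonWeight (V w t : ℝ) :
    HasSum (fun m : ℕ => poissonWeight t m * (V + (w - m) ^ 2)) (V + (w - t) ^ 2 + t) := by
  have := (((hasSum_poissonWeight t).mul_left (V + w ^ 2)).add
    ((hasSum_mul_poissonWeight t).mul_left (-2 * w))).add (hasSum_sq_mul_poissonWeight t)
  have e : V + (w - t) ^ 2 + t = (V + w ^ 2) * 1 + -2 * w * t + (t ^ 2 + t) := by ring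
  rw [e]
  exact this.congr_fun fun m => by ring

/-- The expectation of a bounded sequence under the Poisson distribution. -/
def poissonMean (t : ℝ) (q : ℕ → ℝ) : ℝ := ∑' m, poissonWeight t m * q m

theorem summable_poissonWeight_mul {t : ℝ} (ht : 0 ≤ t) {q : ℕ → ℝ} {B : ℝ}
    (hq : ∀ m, |q m| ≤ B) : Summable fun m => poissonWeight t m * q m := by
  refine Summable.of_norm_bounded ((hasSum_poissonWeight t).summable.mul_right B) fun m => ?_
  rw [Real.norm_eq_abs, abs_mul, abs_of_nonneg (poissonWeight_nonneg ht m)]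
  exact mul_le_mul_of_nonneg_left (hq m) (poissonWeight_nonneg ht m)

theorem poissonMean_mono {t : ℝ} (ht : 0 ≤ t) {q r : ℕ → ℝ} {B : ℝ}
    (hq : ∀ m, |q m| ≤ B) (hr : ∀ m, |r m| ≤ B) (h : ∀ m, q m ≤ r m) :
    poissonMean t q ≤ poissonMean t r :=
  (summable_poissonWeight_mul ht hq).tsum_le_tsum
    (fun m => mul_le_mul_of_nonneg_left (h m) (poissonWeight_nonneg ht m))
    (summable_poissonWeight_mul ht hr)

theorem poissonMean_const (t r : ℝ) : poissonMean t (fun _ => r) = r := by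
  rw [poissonMean, tsum_mul_right, (hasSum_poissonWeight t).tsum_eq, one_mul]

theorem poissonMean_add {t : ℝ} (ht : 0 ≤ t) {q r : ℕ → ℝ} {B B' : ℝ}
    (hq : ∀ m, |q m| ≤ B) (hr : ∀ m, |r m| ≤ B') :
    poissonMean t (fun m => q m + r m) = poissonMean t q + poissonMean t r := by
  rw [poissonMean, poissonMean, poissonMean, ← (summable_poissonWeight_mul ht hq).tsum_add
    (summable_poissonWeight_mul ht hr)]
  simp only [mul_add]

theorem poissonMean_mul (t r : ℝ) (q : ℕ → ℝ) :
    poissonMean t (fun m => r * q m) = r * poissonMean t q := by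
  rw [poissonMean, poissonMean, ← tsum_mul_left]
  exact tsum_congr fun m => by ring

theorem poissonMean_sub {t : ℝ} (ht : 0 ≤ t) {q r : ℕ → ℝ} {B B' : ℝ}
    (hq : ∀ m, |q m| ≤ B) (hr : ∀ m, |r m| ≤ B') :
    poissonMean t (fun m => q m - r m) = poissonMean t q - poissonMean t r := by
  rw [poissonMean, poissonMean, poissonMean, ← (summable_poissonWeight_mul ht hq).tsum_sub
    (summable_poissonWeight_mul ht hr)]
  simp only [mul_sub]

theorem poissonMean_sum {t : ℝ} (ht : 0 ≤ t) {ι : Type*} (s : Finset ι) {q : ι → ℕ → ℝ} {B : ℝ}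
    (hq : ∀ i m, |q i m| ≤ B) :
    poissonMean t (fun m => ∑ i ∈ s, q i m) = ∑ i ∈ s, poissonMean t (q i) := by
  simp only [poissonMean, Finset.mul_sum]
  exact Summable.tsum_finsetSum fun i _ => summable_poissonWeight_mul ht (hq i)

theorem poissonMean_le_of_le_sq {t : ℝ} (ht : 0 ≤ t) {q : ℕ → ℝ} {B a V w : ℝ}
    (hq : ∀ m, |q m| ≤ B) (h : ∀ m : ℕ, a ^ 2 * q m ≤ V + (w - m) ^ 2) :
    a ^ 2 * poissonMean t q ≤ V + (w - t) ^ 2 + t := by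
  rw [← poissonMean_mul]
  refine hasSum_le (fun m => mul_le_mul_of_nonneg_left (h m) (poissonWeight_nonneg ht m))
    (summable_poissonWeight_mul ht (B := a ^ 2 * B) fun m => ?_).hasSum
    (hasSum_sub_sq_mul_poissonWeight V w t)
  rw [abs_mul, abs_of_nonneg (sq_nonneg a)]
  exact mul_le_mul_of_nonneg_left (hq m) (sq_nonneg a)

theorem integrableOn_poissonWeight (m : ℕ) :
    IntegrableOn (fun t => poissonWeight t m) (Set.Ioi 0) := by
  have := Real.GammaIntegral_convergent (s := (m : ℝ) + 1) (by positivity)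
  simp only [add_sub_cancel_right, Real.rpow_natCast] at this
  exact this.div_const _

theorem integral_poissonWeight (m : ℕ) :
    ∫ t in Set.Ioi (0 : ℝ), poissonWeight t m = 1 := by
  have := Real.Gamma_eq_integral (s := (m : ℝ) + 1) (by positivity)
  simp only [add_sub_cancel_right, Real.rpow_natCast] at this
  unfold poissonWeight
  rw [integral_div, ← this, Real.Gamma_nat_eq_factorial, div_self]
  exact_mod_cast Nat.factorial_ne_zero m

theorem integral_tsum_poissonWeight {q : ℕ → ℝ} (w : ℕ → ℝ) (hw : ∀ m, 0 ≤ w m)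
    (e : ℕ → ℕ) {s : ℝ}
    (hq : ∀ m, 0 ≤ q m) (hs : HasSum (fun m => w m * q m) s) :
    ∫ t in Set.Ioi (0 : ℝ), ∑' m, w m * poissonWeight t (e m) * q m = s := by
  have key := hasSum_integral_of_summable_integral_norm (μ := volume.restrict (Set.Ioi (0 : ℝ)))
    (F := fun m t => w m * poissonWeight t (e m) * q m) ?_ ?_
  · simp only [integral_mul_const, integral_const_mul, integral_poissonWeight, mul_one] at key
    exact key.unique hs
  · intro m
    exact ((integrableOn_poissonWeight (e m)).const_mul _).mul_const _
  · refine hs.summable.congr fun m => ?_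
    rw [setIntegral_congr_fun (g := fun t => w m * poissonWeight t (e m) * q m) measurableSet_Ioi]
    · rw [integral_mul_const, integral_const_mul, integral_poissonWeight, mul_one]
    · intro t ht
      have := poissonWeight_nonneg (le_of_lt ht) (e m)
      exact Real.norm_of_nonneg (mul_nonneg (mul_nonneg (hw m) this) (hq m))

namespace BDChain

variable {n : ℕ}

theorem hitSurvC_eq (c : BDChain n) (j x : Fin (n + 1)) (t : ℝ) :
    c.hitSurvC j x t = poissonMean t (fun m => c.surv j m x) := by
  unfold hitSurvC poissonMean
  simp only [hitSurv_eq]; rfl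

theorem hitMeanC_eq (c : BDChain n) {j x : Fin (n + 1)} (h : x ≤ j) :
    c.hitMeanC j x = c.upMean j x := by
  unfold hitMeanC
  simp only [hitSurvC_eq, poissonMean]
  have := integral_tsum_poissonWeight (fun _ => 1) (fun _ => zero_le_one) id
    (fun m => c.surv_nonneg j m x) (s := c.upMean j x) (by
      simpa using c.hasSum_surv (by omega) h)
  simpa using this

theorem hitVarC_eq (c : BDChain n) {j x : Fin (n + 1)} (h : x ≤ j) :
    c.hitVarC j x = c.upVar j x := by
  unfold hitVarC
  rw [c.hitMeanC_eq h, ← c.two_mul_upSq (show (x : ℕ) ≤ j from h)]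
  congr 1
  simp only [hitSurvC_eq, poissonMean]
  have := integral_tsum_poissonWeight (fun m => 2 * ((m : ℝ) + 1)) (fun _ => by positivity)
    (fun m => m + 1) (fun m => c.surv_nonneg j m x) (s := 2 * c.upSq j x) (by
      simp only [mul_assoc]
      exact (c.hasSum_succ_mul_surv (by omega) h).mul_left 2)
  rw [← this]
  refine setIntegral_congr_fun measurableSet_Ioi fun t _ => ?_
  rw [← tsum_mul_left]
  refine tsum_congr fun m => ?_
  rw [mul_assoc 2 _ (poissonWeight _ _), poissonWeight_succ]
  ring

end BDChain

namespace BDChain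

variable {n : ℕ}

/-- The chain seen through the reflection `i ↦ n - i`. -/
def rev (c : BDChain n) : BDChain n where
  K := Matrix.of fun i j => c.K i.rev j.rev
  pi i := c.pi i.rev
  K_nonneg i j := c.K_nonneg _ _
  K_rowSum i := by
    rw [← c.K_rowSum i.rev]
    exact Equiv.sum_comp Fin.revPerm (c.K i.rev)
  K_tridiag i j h := by
    apply c.K_tridiag
    rw [lt_abs] at h ⊢
    simp only [Fin.val_rev]
    omega
  K_irred i h := by
    have := c.K_irred (n - 1 - i) (by omega)
    have e1 : (⟨i, by omega⟩ : Fin (n + 1)).rev = ⟨n - 1 - i + 1, by omega⟩ := by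
      ext; simp only [Fin.val_rev]; omega
    have e2 : (⟨i + 1, by omega⟩ : Fin (n + 1)).rev = ⟨n - 1 - i, by omega⟩ := by
      ext; simp only [Fin.val_rev]; omega
    simp only [Matrix.of_apply, e1, e2]
    exact ⟨this.2, this.1⟩
  pi_pos i := c.pi_pos _
  pi_sum := by
    rw [← c.pi_sum]; exact Equiv.sum_comp Fin.revPerm c.pi
  pi_stat j := by
    rw [← c.pi_stat j.rev]
    exact Equiv.sum_comp Fin.revPerm fun i => c.pi i * c.K i j.rev

theorem mass_rev (c : BDChain n) {a : ℕ} (ha : a ≤ n) : c.rev.mass a = c.mass (n - a) := by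
  rw [mass, mass, dif_pos (by omega), dif_pos (by omega)]
  change c.pi _ = _
  congr 1
  ext; simp only [Fin.val_rev]; omega

theorem kern_rev (c : BDChain n) {a b : ℕ} (ha : a ≤ n) (hb : b ≤ n) :
    c.rev.kern a b = c.kern (n - a) (n - b) := by
  rw [kern, kern, dif_pos ⟨by omega, by omega⟩, dif_pos ⟨by omega, by omega⟩]
  change c.K _ _ = _
  congr 1 <;>
  · ext; simp only [Fin.val_rev]; omega

theorem flux_rev (c : BDChain n) {k : ℕ} (hk : k < n) : c.rev.flux k = c.flux (n - 1 - k) := by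
  rw [flux_eq, c.mass_rev (by omega), c.kern_rev (by omega) (by omega), flux,
    show n - (k + 1) = n - 1 - k by omega, show n - k = n - 1 - k + 1 by omega]

theorem res_rev (c : BDChain n) {k : ℕ} (hk : k < n) : c.rev.res k = c.res (n - 1 - k) := by
  rw [res, res, c.flux_rev hk]

theorem sum_Ico_res_rev (c : BDChain n) {a b : ℕ} (ha : a ≤ b) (hb : b ≤ n) :
    ∑ k ∈ Finset.Ico (n - b) (n - a), c.rev.res k = ∑ k ∈ Finset.Ico a b, c.res k := by
  have h1 : ∑ k ∈ Finset.Ico (n - b) (n - a), c.rev.res k =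
      ∑ k ∈ Finset.Ico (n - b) (n - a), c.res (n - 1 - k) :=
    Finset.sum_congr rfl fun k hk => c.res_rev (by rw [Finset.mem_Ico] at hk; omega)
  rw [h1]
  refine Finset.sum_nbij' (fun k => n - 1 - k) (fun k => n - 1 - k) ?_ ?_ ?_ ?_ ?_ <;>
    intro k hk <;> simp only [Finset.mem_Ico] at * <;> omega

theorem act_rev (c : BDChain n) (F : ℕ → ℝ) {x : ℕ} (hx : x ≤ n) :
    c.rev.act (fun z => F (n - z)) x = c.act F (n - x) := by
  unfold act
  rw [← Finset.sum_range_reflect]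
  refine Finset.sum_congr rfl fun z hz => ?_
  rw [Finset.mem_range] at hz
  simp only [c.kern_rev hx (show n + 1 - 1 - z ≤ n by omega),
    show n - (n + 1 - 1 - z) = z by omega]

theorem surv_rev (c : BDChain n) {j x : ℕ} (hj : j ≤ n) (hx : x ≤ n) (m : ℕ) :
    c.rev.surv (n - j) m x = c.surv j m (n - x) := by
  induction m generalizing x with
  | zero =>
    unfold surv
    simp only [show (x = n - j ↔ n - x = j) by omega]
  | succ m ih =>
    unfold surv
    simp only [show (x = n - j ↔ n - x = j) by omega, ← c.act_rev _ hx]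
    split_ifs
    · rfl
    · exact le_antisymm (c.rev.act_le_act fun z _ hz => (ih hz).le)
        (c.rev.act_le_act fun z _ hz => (ih hz).ge)

theorem hitSurv_rev (c : BDChain n) (j x : Fin (n + 1)) (m : ℕ) :
    c.rev.hitSurv j.rev x.rev m = c.hitSurv j x m := by
  rw [hitSurv_eq, hitSurv_eq, Fin.val_rev, Fin.val_rev, show n + 1 - (j + 1) = n - (j : ℕ) by omega,
    show n + 1 - (x + 1) = n - (x : ℕ) by omega, c.surv_rev (by omega) (by omega),
    show n - (n - (x : ℕ)) = x by omega]

theorem hitMeanC_rev (c : BDChain n) (j x : Fin (n + 1)) :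
    c.rev.hitMeanC j.rev x.rev = c.hitMeanC j x := by
  simp only [hitMeanC, hitSurvC, hitSurv_rev]

theorem hitVarC_rev (c : BDChain n) (j x : Fin (n + 1)) :
    c.rev.hitVarC j.rev x.rev = c.hitVarC j x := by
  simp only [hitVarC, hitSurvC, hitSurv_rev, hitMeanC_rev]

theorem pow_rev (c : BDChain n) (m : ℕ) (x y : Fin (n + 1)) :
    (c.rev.K ^ m) x y = (c.K ^ m) x.rev y.rev := by
  induction m generalizing x with
  | zero => simp [Matrix.one_apply]
  | succ m ih =>
    rw [pow_succ', pow_succ', Matrix.mul_apply, Matrix.mul_apply]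
    simp only [ih]
    exact Equiv.sum_comp Fin.revPerm fun z => c.K x.rev z * (c.K ^ m) z y.rev

theorem Ht_rev (c : BDChain n) (t : ℝ) (x y : Fin (n + 1)) :
    c.rev.Ht t x y = c.Ht t x.rev y.rev := by
  simp only [Ht, pow_rev]

theorem rev_rev (c : BDChain n) : c.rev.rev = c := by
  cases c
  simp only [rev, Matrix.of_apply, Fin.rev_rev]
  rfl

theorem iSup_finset_rev (μ ν : Fin (n + 1) → ℝ) :
    ⨆ A : Finset (Fin (n + 1)), (∑ y ∈ A, μ y.rev - ∑ y ∈ A, ν y.rev) =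
      ⨆ A : Finset (Fin (n + 1)), (∑ y ∈ A, μ y - ∑ y ∈ A, ν y) := by
  refine (Equiv.finsetCongr Fin.revPerm).iSup_congr fun A => ?_
  simp [Equiv.finsetCongr_apply]

theorem dTV_rev (c : BDChain n) (x : Fin (n + 1)) (m : ℕ) : c.rev.dTV x m = c.dTV x.rev m := by
  simp only [dTV, pow_rev]
  exact iSup_finset_rev (fun y => (c.K ^ m) x.rev y) c.pi

theorem dTVC_rev (c : BDChain n) (x : Fin (n + 1)) (t : ℝ) : c.rev.dTVC x t = c.dTVC x.rev t := by
  simp only [dTVC, Ht_rev]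
  exact iSup_finset_rev (fun y => c.Ht t x.rev y) c.pi

theorem piLow_eq (c : BDChain n) (M : Fin (n + 1)) : c.piLow M = c.cum M := by
  have h := Fin.sum_univ_eq_sum_range (fun k => if k ≤ (M : ℕ) then c.mass k else 0) (n + 1)
  rw [piLow, cum]
  simp only [mass_coe] at h
  refine h.trans ?_
  rw [← Finset.sum_filter]
  refine Finset.sum_congr ?_ fun _ _ => rfl
  ext k
  simp only [Finset.mem_filter, Finset.mem_range]
  omega

theorem piHigh_eq (c : BDChain n) (M : Fin (n + 1)) : c.piHigh M = c.rev.cum (n - M) := by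
  have : (n - M : ℕ) = ((M.rev : Fin (n + 1)) : ℕ) := by rw [Fin.val_rev]; omega
  rw [this, ← piLow_eq, piHigh, piLow, ← Equiv.sum_comp Fin.revPerm]
  refine Finset.sum_congr rfl fun i _ => ?_
  simp only [Fin.revPerm_apply, show (M ≤ i.rev ↔ i ≤ M.rev) from Fin.le_rev_iff]
  rfl

theorem cum_rev (c : BDChain n) {k : ℕ} (hk : k < n) :
    c.rev.cum (n - (k + 1)) = 1 - c.cum k := by
  rw [← c.mass_sum, cum, cum, cum, eq_sub_iff_add_eq,
    ← Finset.sum_range_add_sum_Ico _ (show k + 1 ≤ n + 1 by omega), add_comm]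
  congr 1
  rw [Finset.sum_congr rfl fun i hi =>
    c.mass_rev (show i ≤ n by rw [Finset.mem_range] at hi; omega)]
  refine Finset.sum_nbij' (fun k => n - k) (fun k => n - k) ?_ ?_ ?_ ?_ ?_ <;>
    intro k hk <;> simp only [Finset.mem_Ico, Finset.mem_range] at * <;> omega

/-- The chain that moves with probability one half at each step. -/
def lazy (c : BDChain n) : BDChain n where
  K := (1 / 2 : ℝ) • (1 + c.K)
  pi := c.pi
  K_nonneg i j := by
    have := c.K_nonneg i j
    simp only [Matrix.smul_apply, Matrix.add_apply, Matrix.one_apply, smul_eq_mul]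
    split_ifs <;> positivity
  K_rowSum i := by
    simp only [Matrix.smul_apply, Matrix.add_apply, Matrix.one_apply, smul_eq_mul]
    rw [← Finset.mul_sum, Finset.sum_add_distrib, c.K_rowSum]
    simp; norm_num
  K_tridiag i j h := by
    have h' : i ≠ j := by rintro rfl; simp at h
    simp [c.K_tridiag i j h, h']
  K_irred i h := by
    have := c.K_irred i h
    simp only [Matrix.smul_apply, Matrix.add_apply, Matrix.one_apply, smul_eq_mul]
    constructor <;> (rw [if_neg (by simp)]; linarith)
  pi_pos := c.pi_pos
  pi_sum := c.pi_sum
  pi_stat j := by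
    simp only [Matrix.smul_apply, Matrix.add_apply, Matrix.one_apply, smul_eq_mul]
    simp only [mul_left_comm _ (1 / 2 : ℝ), ← Finset.mul_sum, mul_add, Finset.sum_add_distrib,
      c.pi_stat]
    simp; ring

theorem mass_lazy (c : BDChain n) (k : ℕ) : c.lazy.mass k = c.mass k := rfl

theorem cum_lazy (c : BDChain n) (k : ℕ) : c.lazy.cum k = c.cum k := rfl

theorem flux_lazy (c : BDChain n) (k : ℕ) : c.lazy.flux k = c.flux k / 2 := by
  unfold flux kern
  rw [mass_lazy]
  split_ifs with h
  · simp [lazy]; ring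
  · simp

theorem res_lazy (c : BDChain n) (k : ℕ) : c.lazy.res k = 2 * c.res k := by
  rw [res, flux_lazy, res, inv_div, div_eq_mul_inv]

theorem upMean_lazy (c : BDChain n) (j x : ℕ) : c.lazy.upMean j x = 2 * c.upMean j x := by
  simp only [upMean_eq, Finset.mul_sum, res_lazy, cum_lazy, mul_assoc]

theorem acc_lazy (c : BDChain n) (k : ℕ) : c.lazy.acc k = 2 * c.acc k := by
  simp only [acc, Finset.mul_sum, res_lazy, cum_lazy, mul_assoc]

theorem upVar_lazy (c : BDChain n) (j x : ℕ) : c.lazy.upVar j x = 4 * c.upVar j x := by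
  simp only [upVar, Finset.mul_sum, stepVar, res_lazy, cum_lazy, acc_lazy]
  exact Finset.sum_congr rfl fun k _ => by ring

section Exponential

attribute [local instance] Matrix.linftyOpNormedRing Matrix.linftyOpNormedAlgebra

/-- The exponential `e^{-t} e^{tA}`. -/
def expKernel (A : Matrix (Fin (n + 1)) (Fin (n + 1)) ℝ) (t : ℝ) :
    Matrix (Fin (n + 1)) (Fin (n + 1)) ℝ := Real.exp (-t) • NormedSpace.exp (t • A)

theorem hasSum_expKernel (A : Matrix (Fin (n + 1)) (Fin (n + 1)) ℝ) (t : ℝ)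
    (x y : Fin (n + 1)) :
    HasSum (fun m => poissonWeight t m * (A ^ m) x y) (expKernel A t x y) := by
  have h := NormedSpace.exp_series_hasSum_exp' (𝕂 := ℝ) (t • A)
  have h2 := (h.map (Matrix.entryLinearMap ℝ ℝ x y) (by
    exact continuous_id.matrix_elem x y)).mul_left (Real.exp (-t))
  refine h2.congr_fun fun m => ?_
  simp only [Function.comp_apply, Matrix.entryLinearMap_apply, Matrix.smul_apply, smul_eq_mul,
    _root_.smul_pow, poissonWeight]
  ring

theorem Ht_eq_exp (c : BDChain n) (t : ℝ) (x y : Fin (n + 1)) :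
    c.Ht t x y = expKernel c.K t x y :=
  (hasSum_expKernel c.K t x y).tsum_eq

theorem expKernel_lazy (c : BDChain n) (t : ℝ) : expKernel c.lazy.K (2 * t) = expKernel c.K t := by
  have e : (2 * t) • c.lazy.K = algebraMap ℝ (Matrix (Fin (n + 1)) (Fin (n + 1)) ℝ) t +
      t • c.K := by
    rw [Algebra.algebraMap_eq_smul_one]
    simp only [lazy, smul_smul, smul_add]
    congr 2 <;> ring
  have e' : NormedSpace.exp (algebraMap ℝ (Matrix (Fin (n + 1)) (Fin (n + 1)) ℝ) t) =
      Real.exp t • 1 := by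
    rw [Algebra.algebraMap_eq_smul_one, Matrix.smul_one_eq_diagonal, Matrix.exp_diagonal,
      Matrix.smul_one_eq_diagonal]
    congr 1
    funext i
    rw [Pi.coe_exp, Real.exp_eq_exp_ℝ]
  unfold expKernel
  rw [e, Matrix.exp_add_of_commute _ _ (Algebra.commute_algebraMap_left t _), e', smul_one_mul,
    smul_smul, ← Real.exp_add]
  congr 2; ring

theorem Ht_eq_lazy (c : BDChain n) (t : ℝ) (x y : Fin (n + 1)) :
    c.Ht t x y = poissonMean (2 * t) fun m => (c.lazy.K ^ m) x y := by
  rw [poissonMean, (hasSum_expKernel c.lazy.K (2 * t) x y).tsum_eq, expKernel_lazy, Ht_eq_exp]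

end Exponential

end BDChain

namespace BDChain

variable {n : ℕ}

/-- The resistance between `a` and `b`. -/
def resSum (c : BDChain n) (a b : ℕ) : ℝ := ∑ k ∈ Finset.Ico a b, c.res k

theorem resSum_nonneg (c : BDChain n) (a b : ℕ) : 0 ≤ c.resSum a b :=
  Finset.sum_nonneg fun k _ => c.res_nonneg k

theorem resSum_self (c : BDChain n) (a : ℕ) : c.resSum a a = 0 := by simp [resSum]

theorem resSum_succ (c : BDChain n) {a b : ℕ} (h : a ≤ b) :
    c.resSum a (b + 1) = c.resSum a b + c.res b := Finset.sum_Ico_succ_top h _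

theorem resSum_eq (c : BDChain n) {a b : ℕ} (h : a < b) :
    c.resSum a b = c.res a + c.resSum (a + 1) b := Finset.sum_eq_sum_Ico_succ_bot h _

theorem resSum_pos (c : BDChain n) {a b : ℕ} (h : a < b) (hb : b ≤ n) : 0 < c.resSum a b := by
  rw [c.resSum_eq h]
  linarith [c.res_pos (show a < n by omega), c.resSum_nonneg (a + 1) b]

theorem upMean_anti (c : BDChain n) (j x : ℕ) : c.upMean j x ≤ c.upMean j 0 := by
  rw [upMean_eq, upMean_eq]
  exact Finset.sum_le_sum_of_subset_of_nonneg (Finset.Ico_subset_Ico_left (Nat.zero_le x))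
    fun k _ _ => mul_nonneg (c.res_nonneg k) (c.cum_pos k).le

theorem upVar_anti (c : BDChain n) (j x : ℕ) : c.upVar j x ≤ c.upVar j 0 :=
  Finset.sum_le_sum_of_subset_of_nonneg (Finset.Ico_subset_Ico_left (Nat.zero_le x))
    fun k _ _ => c.stepVar_nonneg k

theorem upVar_mono (c : BDChain n) {j M : ℕ} (h : j ≤ M) : c.upVar j 0 ≤ c.upVar M 0 :=
  Finset.sum_le_sum_of_subset_of_nonneg (Finset.Ico_subset_Ico_right h)
    fun k _ _ => c.stepVar_nonneg k

theorem upMean_add (c : BDChain n) {x j M : ℕ} (h : x ≤ j) (h' : j ≤ M) :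
    c.upMean M x = c.upMean j x + c.upMean M j := by
  simp only [upMean_eq]
  exact (Finset.sum_Ico_consecutive _ h h').symm

theorem upMean_le_resSum (c : BDChain n) (j x : ℕ) : c.upMean j x ≤ c.resSum x j := by
  rw [upMean_eq]
  exact Finset.sum_le_sum fun k _ =>
    mul_le_of_le_one_right (c.res_nonneg k) (c.cum_le_one k)

theorem sq_cum_mul_resSum_le (c : BDChain n) {l M : ℕ} (h : l ≤ M) :
    (c.cum l * c.resSum l M) ^ 2 ≤ c.upVar M 0 := by
  refine le_trans ?_ (c.upVar_anti M l)
  have acc_le : ∀ j, l ≤ j → c.cum l ^ 2 * c.resSum l j ≤ c.acc j := by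
    intro j hj
    rw [resSum, Finset.mul_sum, acc, Finset.range_eq_Ico]
    refine (Finset.sum_le_sum fun k hk => ?_).trans
      (Finset.sum_le_sum_of_subset_of_nonneg (Finset.Ico_subset_Ico_left (Nat.zero_le l))
        fun k _ _ => mul_nonneg (c.res_nonneg k) (sq_nonneg _))
    rw [mul_comm]
    have := c.cum_mono (Finset.mem_Ico.1 hk).1
    have := (c.cum_pos l).le
    exact mul_le_mul_of_nonneg_left (by gcongr) (c.res_nonneg k)
  induction M, h using Nat.le_induction with
  | base => simp [resSum, upVar]
  | succ j hj ih =>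
    rw [c.resSum_succ hj, upVar, Finset.sum_Ico_succ_top hj]
    change _ ≤ c.upVar j l + _
    have h1 := mul_le_mul_of_nonneg_left (acc_le j hj) (c.res_nonneg j)
    have h2 : (c.res j * c.cum l) ^ 2 ≤ (c.res j * c.cum j) ^ 2 := by
      have := c.cum_mono hj
      have := (c.cum_pos l).le
      have := c.res_nonneg j
      gcongr
    unfold stepVar
    nlinarith

theorem upVar_le (c : BDChain n) {M : ℕ} {B : ℝ}
    (hB : ∀ l < M, c.cum l * c.resSum l M ≤ B) : c.upVar M 0 ≤ 2 * B * c.upMean M 0 := by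
  have key : ∀ j ≤ M, c.upVar j 0 + 2 * c.acc j * c.resSum j M ≤ 2 * B * c.upMean j 0 := by
    intro j
    induction j with
    | zero => intro _; simp [upVar, acc, upMean_self]
    | succ j ih =>
      intro hj
      have h0 := ih (by omega)
      have h1 := c.resSum_eq (show j < M by omega)
      have h2 : c.upVar (j + 1) 0 = c.upVar j 0 + c.stepVar j :=
        Finset.sum_Ico_succ_top (Nat.zero_le j) _
      have h3 : c.upMean (j + 1) 0 = c.upMean j 0 + c.res j * c.cum j := by
        simp only [upMean_eq]; exact Finset.sum_Ico_succ_top (Nat.zero_le j) _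
      have h4 : c.res j * c.cum j * (c.cum j * c.resSum j M) ≤ c.res j * c.cum j * B :=
        mul_le_mul_of_nonneg_left (hB j (by omega))
          (mul_nonneg (c.res_nonneg j) (c.cum_pos j).le)
      have h5 := sq_nonneg (c.res j * c.cum j)
      rw [h1] at h0 h4
      rw [h2, h3, acc_succ, stepVar]
      nlinarith
  have := key M le_rfl
  rwa [resSum_self, mul_zero, add_zero] at this

theorem acc_le (c : BDChain n) {M : ℕ} {B : ℝ} (hB0 : 0 < B)
    (hB : ∀ l < M, c.cum l * c.resSum l M ≤ B) : c.acc M ≤ 4 * B := by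
  have key : ∀ j ≤ M, c.acc j + 4 * B ^ 2 / (B + c.resSum 0 M) ≤
      4 * B ^ 2 / (B + c.resSum j M) := by
    intro j
    induction j with
    | zero => intro _; simp [acc]
    | succ j ih =>
      intro hj
      have h0 := ih (by omega)
      have h1 := c.resSum_eq (show j < M by omega)
      rw [acc_succ]
      suffices h : c.res j * c.cum j ^ 2 ≤ 4 * B ^ 2 / (B + c.resSum (j + 1) M) -
          4 * B ^ 2 / (B + c.resSum j M) by linarith
      have hT := c.resSum_nonneg (j + 1) M
      have hr := c.res_nonneg j
      have hT' := c.resSum_nonneg j M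
      have h2 : c.cum j * (B + c.resSum j M) ≤ 2 * B := by
        have := hB j (by omega)
        have := c.cum_le_one j
        nlinarith
      have h3 : c.cum j ^ 2 * (B + c.resSum j M) ^ 2 ≤ 4 * B ^ 2 := by
        have := (c.cum_pos j).le
        calc c.cum j ^ 2 * (B + c.resSum j M) ^ 2 = (c.cum j * (B + c.resSum j M)) ^ 2 := by ring
          _ ≤ (2 * B) ^ 2 := by gcongr
          _ = _ := by ring
      rw [div_sub_div _ _ (by positivity) (by positivity), le_div_iff₀ (by positivity)]
      have e : 4 * B ^ 2 * (B + c.resSum j M) - (B + c.resSum (j + 1) M) * (4 * B ^ 2) =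
        c.res j * (4 * B ^ 2) := by rw [h1]; ring
      rw [e, mul_assoc]
      refine mul_le_mul_of_nonneg_left (le_trans ?_ h3) hr
      refine mul_le_mul_of_nonneg_left ?_ (sq_nonneg _)
      rw [sq]
      refine mul_le_mul_of_nonneg_right ?_ (by positivity)
      linarith
  have h := key M le_rfl
  have : 0 ≤ 4 * B ^ 2 / (B + c.resSum 0 M) := by
    have := c.resSum_nonneg 0 M
    positivity
  rw [resSum_self, add_zero, show 4 * B ^ 2 / B = 4 * B by field_simp] at h
  linarith

/-- The variance grows in a controlled way when the target is moved away from `M`. -/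
theorem upVar_le_of_le (c : BDChain n) {M j : ℕ} (hj : M ≤ j) {B : ℝ} (hB0 : 0 < B)
    (hB : ∀ l < M, c.cum l * c.resSum l M ≤ B) :
    c.upVar j 0 ≤ c.upVar M 0 + 3 * c.resSum M j ^ 2 + 8 * B * c.resSum M j := by
  have hacc := c.acc_le hB0 hB
  have key : c.upVar j 0 ≤ c.upVar M 0 + 3 * c.resSum M j ^ 2 + 8 * B * c.resSum M j ∧
      c.acc j ≤ c.acc M + c.resSum M j := by
    induction j, hj using Nat.le_induction with
    | base => simp [resSum]
    | succ j hj ih =>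
      have h1 := (c.cum_pos j).le
      have h2 := c.cum_le_one j
      have hr := c.res_nonneg j
      have hR := c.resSum_nonneg M j
      have h3 : c.cum j ^ 2 ≤ 1 := pow_le_one₀ h1 h2
      have h4 : c.upVar (j + 1) 0 = c.upVar j 0 + c.stepVar j :=
        Finset.sum_Ico_succ_top (Nat.zero_le j) _
      rw [c.resSum_succ hj, h4, acc_succ, stepVar]
      constructor
      · have : c.res j * c.acc j ≤ c.res j * (4 * B + c.resSum M j) :=
          mul_le_mul_of_nonneg_left (by linarith [ih.2]) hr
        nlinarith [ih.1, mul_le_mul_of_nonneg_left h3 (sq_nonneg (c.res j)), mul_nonneg hr hR]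
      · nlinarith [ih.2]
  exact key.1

theorem abs_surv_le_one (c : BDChain n) (j m : ℕ) {x : ℕ} (hx : x ≤ n) : |c.surv j m x| ≤ 1 := by
  rw [abs_of_nonneg (c.surv_nonneg j m x)]; exact c.surv_le_one j m hx

theorem poissonMean_surv_lazy_le (c : BDChain n) {j x : ℕ} (hj : j ≤ n) (hx : x ≤ j) {t d V : ℝ}
    (hd : 0 < d) (ht : c.upMean j x + d ≤ t) (hV : c.upVar j x ≤ V) :
    poissonMean (2 * t) (fun m => c.lazy.surv j m x) ≤ V / d ^ 2 + 1 / (2 * d) := by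
  have h0 := c.upMean_nonneg j x
  have key := poissonMean_le_of_le_sq (t := 2 * t) (by linarith)
    (fun m => c.lazy.abs_surv_le_one j m (hx.trans hj))
    (fun m => c.lazy.sq_mul_surv_le hj (a := 2 * (t - c.upMean j x)) (by linarith) m hx)
  rw [upVar_lazy, upMean_lazy] at key
  set P := poissonMean (2 * t) (fun m => c.lazy.surv j m x)
  set u := t - c.upMean j x with hu
  have hud : d ≤ u := by rw [hu]; linarith
  have hup : 0 < u := by linarith
  have h1 : P ≤ c.upVar j x / u ^ 2 + 1 / (2 * u) := by
    rw [div_add_div _ _ (by positivity) (by positivity), le_div_iff₀ (by positivity)]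
    have : 4 * u ^ 2 * P ≤ 4 * c.upVar j x + 2 * u := by
      rw [show 2 * c.upMean j x + 2 * u - 2 * t = 0 by rw [hu]; ring] at key
      nlinarith
    nlinarith
  refine h1.trans (add_le_add ?_ ?_)
  · have := (c.upVar_nonneg j x).trans hV
    gcongr
  · gcongr

theorem one_sub_poissonMean_surv_le (c : BDChain n) {j x : ℕ} (hj : j ≤ n) (hx : x ≤ j) {t d V : ℝ}
    (ht0 : 0 ≤ t) (hd : 0 < d) (ht : t + d ≤ c.upMean j x) (hV : c.upVar j x ≤ V) :
    1 - V / d ^ 2 ≤ poissonMean t (fun m => c.surv j m x) := by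
  have key := poissonMean_le_of_le_sq (t := t) ht0
    (q := fun m => 1 - c.surv j m x) (B := 1)
    (fun m => abs_le.2 ⟨by linarith [c.surv_le_one j m (hx.trans hj)],
      by linarith [c.surv_nonneg j m x]⟩)
    (fun m => c.sq_mul_one_sub_surv_le hj (a := c.upMean j x - t) (by linarith) m hx)
  rw [poissonMean_sub ht0 (q := fun _ => 1) (B := 1) (B' := 1) (fun _ => by norm_num)
    (fun m => c.abs_surv_le_one j m (hx.trans hj)), poissonMean_const] at key
  set P := poissonMean t (fun m => c.surv j m x)
  set u := c.upMean j x - t with hu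
  have hud : d ≤ u := by rw [hu]; linarith
  have hup : 0 < u := by linarith
  have : 1 - P ≤ c.upVar j x / u ^ 2 := by
    rw [le_div_iff₀ (by positivity)]
    rw [show c.upMean j x - u - t = 0 by rw [hu]; ring] at key
    nlinarith
  have h2 : c.upVar j x / u ^ 2 ≤ V / d ^ 2 := by
    have := (c.upVar_nonneg j x).trans hV
    gcongr
  linarith

theorem one_sub_surv_le (c : BDChain n) {j x : ℕ} (hj : j ≤ n) (hx : x ≤ j) {m : ℕ} {d V : ℝ}
    (hd : 0 < d) (hm : m + d ≤ c.upMean j x) (hV : c.upVar j x ≤ V) :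
    1 - V / d ^ 2 ≤ c.surv j m x := by
  have key := c.sq_mul_one_sub_surv_le hj (a := c.upMean j x - m) (by linarith) m hx
  set P := c.surv j m x
  set u := c.upMean j x - m with hu
  have hud : d ≤ u := by rw [hu]; linarith
  have hup : 0 < u := by linarith
  have : 1 - P ≤ c.upVar j x / u ^ 2 := by
    rw [le_div_iff₀ (by positivity)]
    rw [show c.upMean j x - u - m = 0 by rw [hu]; ring] at key
    have := c.upMean_nonneg j x
    nlinarith
  have h2 : c.upVar j x / u ^ 2 ≤ V / d ^ 2 := by
    have := (c.upVar_nonneg j x).trans hV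
    gcongr
  linarith

end BDChain

section TotalVariation

variable {ι : Type*}

/-- The total variation distance of two mass functions. -/
def tv (μ ν : ι → ℝ) : ℝ := ⨆ A : Finset ι, (∑ y ∈ A, μ y - ∑ y ∈ A, ν y)

theorem sub_le_tv [Fintype ι] (μ ν : ι → ℝ) (A : Finset ι) : ∑ y ∈ A, μ y - ∑ y ∈ A, ν y ≤ tv μ ν :=
  le_ciSup (f := fun A : Finset ι => ∑ y ∈ A, μ y - ∑ y ∈ A, ν y) (Set.finite_range _).bddAbove A

theorem tv_le {μ ν : ι → ℝ} {r : ℝ} (h : ∀ A : Finset ι, ∑ y ∈ A, μ y - ∑ y ∈ A, ν y ≤ r) :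
    tv μ ν ≤ r := ciSup_le h

theorem sum_sub_mul_le_tv [Fintype ι] (μ ν : ι → ℝ) {g : ι → ℝ} (h0 : ∀ y, 0 ≤ g y)
    (h1 : ∀ y, g y ≤ 1) : ∑ y, (μ y - ν y) * g y ≤ tv μ ν := by
  classical
  refine le_trans ?_ (sub_le_tv μ ν (Finset.univ.filter fun y => ν y ≤ μ y))
  rw [← Finset.sum_sub_distrib, Finset.sum_filter]
  refine Finset.sum_le_sum fun y _ => ?_
  have := h0 y
  have := h1 y
  split_ifs <;> nlinarith

theorem sum_sub_mul_le_two_mul_tv [Fintype ι] {μ ν : ι → ℝ} (h : ∑ y, μ y = ∑ y, ν y) {g : ι → ℝ}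
    (hg : ∀ y, |g y| ≤ 1) : ∑ y, (μ y - ν y) * g y ≤ 2 * tv μ ν := by
  have := sum_sub_mul_le_tv μ ν (g := fun y => (g y + 1) / 2)
    (fun y => by linarith [(abs_le.1 (hg y)).1]) (fun y => by linarith [(abs_le.1 (hg y)).2])
  have e : ∑ y, (μ y - ν y) * ((g y + 1) / 2) = (∑ y, (μ y - ν y) * g y) / 2 := by
    have : ∑ y, (μ y - ν y) * ((g y + 1) / 2) =
        ∑ y, ((μ y - ν y) * g y / 2 + (μ y - ν y) / 2) :=
      Finset.sum_congr rfl fun y _ => by ring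
    rw [this, Finset.sum_add_distrib, ← Finset.sum_div, ← Finset.sum_div, Finset.sum_sub_distrib,
      h, sub_self, zero_div, add_zero]
  linarith

end TotalVariation

namespace BDChain

variable {n : ℕ}

theorem dTVC_eq_tv (c : BDChain n) (x : Fin (n + 1)) (t : ℝ) :
    c.dTVC x t = tv (c.Ht t x) c.pi := rfl

theorem le_dTVMaxC (c : BDChain n) (x : Fin (n + 1)) (t : ℝ) : c.dTVC x t ≤ c.dTVMaxC t :=
  le_ciSup (f := fun x => c.dTVC x t) (Set.finite_range _).bddAbove x

theorem le_dTVMax (c : BDChain n) (x : Fin (n + 1)) (m : ℕ) : c.dTV x m ≤ c.dTVMax m :=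
  le_ciSup (f := fun x => c.dTV x m) (Set.finite_range _).bddAbove x

/-- The function on `ℕ` extending a function on the state space by zero. -/
def extend (f : Fin (n + 1) → ℝ) (k : ℕ) : ℝ := if h : k < n + 1 then f ⟨k, h⟩ else 0

theorem extend_coe (f : Fin (n + 1) → ℝ) (i : Fin (n + 1)) : extend f i = f i := by
  rw [extend, dif_pos i.isLt]

theorem iterate_act (c : BDChain n) (F : ℕ → ℝ) (m : ℕ) (x : Fin (n + 1)) :
    c.act^[m] F x = ∑ y, (c.K ^ m) x y * F y := by
  induction m generalizing x with
  | zero => simp [Matrix.one_apply]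
  | succ m ih =>
    rw [Function.iterate_succ_apply', act_coe, pow_succ']
    simp only [ih, Matrix.mul_apply, Finset.mul_sum, Finset.sum_mul, mul_assoc]
    exact Finset.sum_comm

theorem iterate_act_mem (c : BDChain n) {F : ℕ → ℝ} (h : ∀ x ≤ n, F x ∈ Set.Icc (0 : ℝ) 1) (m : ℕ)
    {x : ℕ} (hx : x ≤ n) : c.act^[m] F x ∈ Set.Icc (0 : ℝ) 1 := by
  induction m generalizing x with
  | zero => exact h x hx
  | succ m ih =>
    rw [Function.iterate_succ_apply']
    constructor
    · rw [← c.act_const 0 hx]; exact c.act_le_act fun z _ hz => (ih hz).1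
    · rw [← c.act_const 1 hx]; exact c.act_le_act fun z _ hz => (ih hz).2

theorem sum_mass_mul_act (c : BDChain n) (F : ℕ → ℝ) :
    ∑ x ∈ Finset.range (n + 1), c.mass x * c.act F x =
      ∑ x ∈ Finset.range (n + 1), c.mass x * F x := by
  simp only [act, Finset.mul_sum, ← mul_assoc]
  rw [Finset.sum_comm]
  refine Finset.sum_congr rfl fun z hz => ?_
  rw [← Finset.sum_mul, c.mass_stat (by rw [Finset.mem_range] at hz; omega)]

theorem sum_mass_mul_iterate (c : BDChain n) (F : ℕ → ℝ) (m : ℕ) :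
    ∑ x ∈ Finset.range (n + 1), c.mass x * c.act^[m] F x =
      ∑ x ∈ Finset.range (n + 1), c.mass x * F x := by
  induction m with
  | zero => rfl
  | succ m ih => simp only [Function.iterate_succ_apply']; rw [sum_mass_mul_act, ih]

theorem act_lazy (c : BDChain n) (F : ℕ → ℝ) {x : ℕ} (hx : x ≤ n) :
    c.lazy.act F x = 1 / 2 * F x + 1 / 2 * c.act F x := by
  have h1 := c.lazy.act_coe F ⟨x, by omega⟩
  have h2 := c.act_coe F ⟨x, by omega⟩
  simp only at h1 h2
  rw [h1, h2]
  simp only [lazy, Matrix.smul_apply, Matrix.add_apply, Matrix.one_apply, smul_eq_mul, mul_assoc,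
    add_mul, ← Finset.mul_sum, Finset.sum_add_distrib]
  simp
  ring

/-- The probability that the left coordinate of a pair of chains moving one at a time has not
reached `j` weakly before the right one is left of it. -/
def pairSurv (c : BDChain n) (j : ℕ) : ℕ → ℕ → ℕ → ℝ
  | 0, x, y => if x = j then (if j < y then 1 else 0) else 1
  | m + 1, x, y => if x = j then (if j < y then 1 else 0) else
      1 / 2 * c.act (fun z => pairSurv c j m z y) x + 1 / 2 * c.act (fun z => pairSurv c j m x z) y

theorem pairSurv_self (c : BDChain n) (j m y : ℕ) :
    c.pairSurv j m j y = if j < y then 1 else 0 := by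
  cases m <;> simp [pairSurv]

theorem pairSurv_nonneg (c : BDChain n) (j m x y : ℕ) : 0 ≤ c.pairSurv j m x y := by
  induction m generalizing x y with
  | zero => unfold pairSurv; split_ifs <;> norm_num
  | succ m ih =>
    have h : ∀ (F : ℕ → ℝ) (a : ℕ), (∀ z, 0 ≤ F z) → 0 ≤ c.act F a := fun F a hF =>
      Finset.sum_nonneg fun z _ => mul_nonneg (c.kern_nonneg _ _) (hF z)
    have h1 := h _ x fun z => ih z y
    have h2 := h _ y fun z => ih x z
    unfold pairSurv
    split_ifs <;> positivity

theorem abs_act_le (c : BDChain n) {F G : ℕ → ℝ} {x : ℕ}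
    (h : ∀ z ≤ n, z ≤ x + 1 → x ≤ z + 1 → |F z| ≤ G z) : |c.act F x| ≤ c.act G x := by
  refine (Finset.abs_sum_le_sum_abs _ _).trans (Finset.sum_le_sum fun z hz => ?_)
  rw [Finset.mem_range] at hz
  rw [abs_mul, abs_of_nonneg (c.kern_nonneg _ _)]
  by_cases hx : z ≤ x + 1 ∧ x ≤ z + 1
  · exact mul_le_mul_of_nonneg_left (h z (by omega) hx.1 hx.2) (c.kern_nonneg _ _)
  · rw [c.kern_far (by omega), zero_mul, zero_mul]

theorem abs_sub_le_pairSurv (c : BDChain n) {F : ℕ → ℝ} (hF : ∀ x ≤ n, F x ∈ Set.Icc (0 : ℝ) 1)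
    {j : ℕ} (m : ℕ) {x y : ℕ} (hxj : x ≤ j) (hxy : x ≤ y) (hy : y ≤ n) :
    |c.lazy.act^[m] F x - c.lazy.act^[m] F y| ≤ c.pairSurv j m x y := by
  have triv : ∀ (m x y : ℕ), x ≤ n → y ≤ n → |c.lazy.act^[m] F x - c.lazy.act^[m] F y| ≤ 1 := by
    intro m x y hx hy
    have h1 := c.lazy.iterate_act_mem hF m hx
    have h2 := c.lazy.iterate_act_mem hF m hy
    rw [abs_le]; constructor <;> linarith [h1.1, h1.2, h2.1, h2.2]
  rcases hxy.lt_or_eq with hlt | rfl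
  swap
  · rw [sub_self, abs_zero]; exact c.pairSurv_nonneg j m _ _
  induction m generalizing x y with
  | zero =>
    unfold pairSurv
    split_ifs with h1 h2
    · exact triv 0 x y (by omega) hy
    · omega
    · exact triv 0 x y (by omega) hy
  | succ m ih =>
    rcases hxj.lt_or_eq with hj | rfl
    swap
    · rw [pairSurv_self, if_pos hlt]; exact triv _ x y (by omega) hy
    have step : ∀ a b, a ≤ j → a ≤ b → b ≤ n →
        |c.lazy.act^[m] F a - c.lazy.act^[m] F b| ≤ c.pairSurv j m a b := by
      intro a b h1 h2 h3
      rcases h2.lt_or_eq with h | rfl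
      · exact ih h1 h2 h3 h
      · rw [sub_self, abs_zero]; exact c.pairSurv_nonneg j m _ _
    set G := c.lazy.act^[m] F with hG
    have e : c.lazy.act^[m + 1] F x - c.lazy.act^[m + 1] F y =
        1 / 2 * c.act (fun z => G z - G y) x + 1 / 2 * c.act (fun z => G x - G z) y := by
      rw [Function.iterate_succ_apply', ← hG, c.act_lazy _ (by omega), c.act_lazy _ hy,
        c.act_sub G (fun _ => G y), c.act_sub (fun _ => G x) G, c.act_const _ (by omega),
        c.act_const _ hy]
      ring
    rw [e, pairSurv, if_neg hj.ne]
    refine (abs_add_le _ _).trans (add_le_add ?_ ?_)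
    · rw [abs_mul, abs_of_pos (by norm_num : (0 : ℝ) < 1 / 2)]
      exact mul_le_mul_of_nonneg_left
        (c.abs_act_le fun z _ hz _ => step z y (by omega) (by omega) hy) (by norm_num)
    · rw [abs_mul, abs_of_pos (by norm_num : (0 : ℝ) < 1 / 2)]
      exact mul_le_mul_of_nonneg_left
        (c.abs_act_le fun z hz _ hz' => step x z (by omega) (by omega) hz) (by norm_num)

theorem sum_mass_mul_pairSurv_le (c : BDChain n) {j : ℕ} (hj : j ≤ n) (m : ℕ) {x : ℕ} (hx : x ≤ j) :
    ∑ y ∈ Finset.range (n + 1), c.mass y * c.pairSurv j m x y ≤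
      c.lazy.surv j m x + (1 - c.cum j) := by
  have tot : ∑ y ∈ Finset.range (n + 1), c.mass y = 1 := c.mass_sum
  have hself : ∀ m, ∑ y ∈ Finset.range (n + 1), c.mass y * c.pairSurv j m j y = 1 - c.cum j := by
    intro m
    have h1 : ∑ y ∈ Finset.range (j + 1), c.mass y * c.pairSurv j m j y = 0 := by
      refine Finset.sum_eq_zero fun y hy => ?_
      rw [Finset.mem_range] at hy
      rw [pairSurv_self, if_neg (by omega), mul_zero]
    have h2 : ∑ y ∈ Finset.Ico (j + 1) (n + 1), c.mass y * c.pairSurv j m j y =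
        ∑ y ∈ Finset.Ico (j + 1) (n + 1), c.mass y := by
      refine Finset.sum_congr rfl fun y hy => ?_
      rw [Finset.mem_Ico] at hy
      rw [pairSurv_self, if_pos (by omega), mul_one]
    have h3 := Finset.sum_range_add_sum_Ico c.mass (show j + 1 ≤ n + 1 by omega)
    rw [← Finset.sum_range_add_sum_Ico _ (show j + 1 ≤ n + 1 by omega), h1, h2, zero_add]
    rw [tot] at h3
    rw [cum]
    linarith
  have hq : 0 ≤ 1 - c.cum j := by linarith [c.cum_le_one j]
  induction m generalizing x with
  | zero =>
    rcases hx.lt_or_eq with h | rfl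
    · simp only [pairSurv, if_neg h.ne, mul_one, tot, c.lazy.surv_zero h.ne]; linarith
    · rw [hself, surv_self, zero_add]
  | succ m ih =>
    rcases hx.lt_or_eq with h | rfl
    swap
    · rw [hself, surv_self, zero_add]
    simp only [pairSurv, if_neg h.ne, mul_add, Finset.sum_add_distrib]
    have e1 : ∑ y ∈ Finset.range (n + 1), c.mass y *
        (1 / 2 * c.act (fun z => c.pairSurv j m z y) x) =
        1 / 2 * c.act (fun z => ∑ y ∈ Finset.range (n + 1), c.mass y * c.pairSurv j m z y) x := by
      rw [act_sum, Finset.mul_sum]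
      exact Finset.sum_congr rfl fun y _ => by rw [act_mul]; ring
    have e2 : ∑ y ∈ Finset.range (n + 1), c.mass y *
        (1 / 2 * c.act (fun z => c.pairSurv j m x z) y) =
        1 / 2 * ∑ y ∈ Finset.range (n + 1), c.mass y * c.pairSurv j m x y := by
      rw [← c.sum_mass_mul_act (fun z => c.pairSurv j m x z), Finset.mul_sum]
      exact Finset.sum_congr rfl fun y _ => by ring
    rw [e1, e2, add_comm, ← c.act_lazy
      (fun z => ∑ y ∈ Finset.range (n + 1), c.mass y * c.pairSurv j m z y) (by omega)]
    refine (c.lazy.act_le_act (G := fun z => c.lazy.surv j m z + (fun _ => 1 - c.cum j) z)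
      fun z hz _ => ih (by omega)).trans ?_
    rw [act_add, c.lazy.act_const _ (by omega), c.lazy.surv_succ h.ne]

/-- The discrepancy between `x` and the states to its right. -/
def rightGap (c : BDChain n) (F : ℕ → ℝ) (x m : ℕ) : ℝ :=
  ∑ y ∈ Finset.Ico x (n + 1), c.mass y * |c.lazy.act^[m] F x - c.lazy.act^[m] F y|

theorem rightGap_nonneg (c : BDChain n) (F : ℕ → ℝ) (x m : ℕ) : 0 ≤ c.rightGap F x m :=
  Finset.sum_nonneg fun y _ => mul_nonneg (c.mass_nonneg y) (abs_nonneg _)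

theorem rightGap_le_sum_mass (c : BDChain n) {F : ℕ → ℝ} (hF : ∀ x ≤ n, F x ∈ Set.Icc (0 : ℝ) 1)
    (x m : ℕ) : c.rightGap F x m ≤ ∑ y ∈ Finset.Ico x (n + 1), c.mass y := by
  refine Finset.sum_le_sum fun y hy => mul_le_of_le_one_right (c.mass_nonneg y) ?_
  rw [Finset.mem_Ico] at hy
  have h1 := c.lazy.iterate_act_mem hF m (show x ≤ n by omega)
  have h2 := c.lazy.iterate_act_mem hF m (show y ≤ n by omega)
  rw [abs_le]; constructor <;> linarith [h1.1, h1.2, h2.1, h2.2]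

theorem rightGap_le (c : BDChain n) {F : ℕ → ℝ} (hF : ∀ x ≤ n, F x ∈ Set.Icc (0 : ℝ) 1)
    {j x : ℕ} (hj : j ≤ n) (hx : x ≤ j) (m : ℕ) :
    c.rightGap F x m ≤ c.lazy.surv j m x + (1 - c.cum j) := by
  refine le_trans ?_ (c.sum_mass_mul_pairSurv_le hj m hx)
  rw [← Finset.sum_range_add_sum_Ico _ (show x ≤ n + 1 by omega)]
  refine (Finset.sum_le_sum fun y hy => ?_).trans (le_add_of_nonneg_left
    (Finset.sum_nonneg fun y _ => mul_nonneg (c.mass_nonneg y) (c.pairSurv_nonneg j m x y)))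
  rw [Finset.mem_Ico] at hy
  exact mul_le_mul_of_nonneg_left (c.abs_sub_le_pairSurv hF m hx hy.1 (by omega)) (c.mass_nonneg y)

theorem rightGap_le_of_lt (c : BDChain n) {F : ℕ → ℝ} (hF : ∀ x ≤ n, F x ∈ Set.Icc (0 : ℝ) 1)
    {j x : ℕ} (hx : j < x) (hxn : x ≤ n) (m : ℕ) :
    c.rightGap F x m ≤ 1 - c.cum j := by
  refine (c.rightGap_le_sum_mass hF x m).trans ?_
  have := c.mass_sum
  rw [cum, ← Finset.sum_range_add_sum_Ico _ (show j + 1 ≤ n + 1 by omega)] at this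
  rw [cum, ← this, add_sub_cancel_left]
  exact Finset.sum_le_sum_of_subset_of_nonneg (Finset.Ico_subset_Ico_left hx)
    fun y _ _ => c.mass_nonneg y

theorem abs_rightGap_le_one (c : BDChain n) {F : ℕ → ℝ} (hF : ∀ x ≤ n, F x ∈ Set.Icc (0 : ℝ) 1)
    {x : ℕ} (hx : x ≤ n) (m : ℕ) : |c.rightGap F x m| ≤ 1 := by
  rw [abs_of_nonneg (c.rightGap_nonneg F x m)]
  refine (c.rightGap_le_sum_mass hF x m).trans ?_
  rw [← c.mass_sum, cum, ← Finset.sum_range_add_sum_Ico _ (show x ≤ n + 1 by omega)]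
  exact le_add_of_nonneg_left (Finset.sum_nonneg fun y _ => c.mass_nonneg y)

theorem iterate_lazy_rev (c : BDChain n) (F : ℕ → ℝ) (m : ℕ) {x : ℕ} (hx : x ≤ n) :
    c.rev.lazy.act^[m] (fun z => F (n - z)) x = c.lazy.act^[m] F (n - x) := by
  induction m generalizing x with
  | zero => rfl
  | succ m ih =>
    rw [Function.iterate_succ_apply', Function.iterate_succ_apply', c.act_lazy _ (by omega),
      c.rev.act_lazy _ hx, ih hx, ← c.act_rev _ hx]
    congr 2
    exact le_antisymm (c.rev.act_le_act fun z _ hz => (ih hz).le)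
      (c.rev.act_le_act fun z _ hz => (ih hz).ge)

theorem rightGap_rev (c : BDChain n) (F : ℕ → ℝ) {x : ℕ} (hx : x ≤ n) (m : ℕ) :
    c.rev.rightGap (fun z => F (n - z)) (n - x) m = ∑ y ∈ Finset.range (x + 1),
      c.mass y * |c.lazy.act^[m] F x - c.lazy.act^[m] F y| := by
  unfold rightGap
  refine Finset.sum_nbij' (fun k => n - k) (fun k => n - k) ?_ ?_ ?_ ?_ ?_ <;>
    intro k hk <;> simp only [Finset.mem_Ico, Finset.mem_range] at *
  · omega
  · omega
  · omega
  · omega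
  · rw [c.mass_rev (by omega), c.iterate_lazy_rev F m (by omega), c.iterate_lazy_rev F m (by omega),
      show n - (n - x) = x by omega]

theorem iterate_sub_sum_le (c : BDChain n) (F : ℕ → ℝ) {x : ℕ} (hx : x ≤ n) (m : ℕ) :
    c.lazy.act^[m] F x - ∑ y ∈ Finset.range (n + 1), c.mass y * F y ≤
      c.rightGap F x m + c.rev.rightGap (fun z => F (n - z)) (n - x) m := by
  rw [c.rightGap_rev F hx, rightGap]
  have e : c.lazy.act^[m] F x - ∑ y ∈ Finset.range (n + 1), c.mass y * F y =
      ∑ y ∈ Finset.range (n + 1), c.mass y * (c.lazy.act^[m] F x - c.lazy.act^[m] F y) := by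
    have h1 : ∑ y ∈ Finset.range (n + 1), c.mass y = 1 := c.mass_sum
    have h2 := c.lazy.sum_mass_mul_iterate F m
    simp only [mass_lazy] at h2
    simp only [mul_sub, Finset.sum_sub_distrib]
    rw [← Finset.sum_mul, h1, one_mul, h2]
  rw [e]
  refine (Finset.sum_le_sum fun y _ => mul_le_mul_of_nonneg_left (le_abs_self _)
    (c.mass_nonneg y)).trans ?_
  rw [← Finset.sum_range_add_sum_Ico _ (show x ≤ n + 1 by omega), add_comm]
  refine add_le_add le_rfl (Finset.sum_le_sum_of_subset_of_nonneg ?_ fun y _ _ =>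
    mul_nonneg (c.mass_nonneg y) (abs_nonneg _))
  exact Finset.range_mono (by omega)

end BDChain

namespace BDChain
variable {n : ℕ}

/-- The means and standard deviations of the hitting times of `M` from both ends are at most
`s` and `b`. -/
structure Controlled (c : BDChain n) (M : ℕ) (s b : ℝ) : Prop where
  le_n : M ≤ n
  half_le : 1 / 2 ≤ b
  mean_left : c.upMean M 0 ≤ s
  mean_right : c.rev.upMean (n - M) 0 ≤ s
  var_left : c.upVar M 0 ≤ b ^ 2
  var_right : c.rev.upVar (n - M) 0 ≤ b ^ 2

namespace Controlled

variable {c : BDChain n} {M : ℕ} {s b : ℝ}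

theorem rev (h : c.Controlled M s b) : c.rev.Controlled (n - M) s b where
  le_n := Nat.sub_le _ _
  half_le := h.half_le
  mean_left := h.mean_right
  mean_right := by rw [rev_rev, Nat.sub_sub_self h.le_n]; exact h.mean_left
  var_left := h.var_right
  var_right := by rw [rev_rev, Nat.sub_sub_self h.le_n]; exact h.var_left

theorem pos (h : c.Controlled M s b) : 0 < b := by linarith [h.half_le]

theorem cum_mul_resSum_le (h : c.Controlled M s b) {l : ℕ} (hl : l ≤ M) :
    c.cum l * c.resSum l M ≤ b :=
  le_of_sq_le_sq ((c.sq_cum_mul_resSum_le hl).trans h.var_left) h.pos.le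

theorem exists_level (h : c.Controlled M s b) {η : ℝ} (h0 : 0 < η) (h1 : η ≤ 1) :
    ∃ j ≤ n, 1 - c.cum j ≤ η ∧ c.upMean j 0 ≤ s + b / η ∧ c.upVar j 0 ≤ 12 * (b / η) ^ 2 := by
  have hex : ∃ j, 1 - η ≤ c.cum j := ⟨n, by rw [c.mass_sum]; linarith⟩
  classical
  set j := Nat.find hex with hj
  have hjn : j ≤ n := Nat.find_min' hex (by rw [c.mass_sum]; linarith)
  have hb := h.pos
  have hbη : b ≤ b / η := by rw [le_div_iff₀ h0]; nlinarith
  refine ⟨j, hjn, by linarith [Nat.find_spec hex], ?_⟩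
  rcases le_or_gt j M with hjM | hjM
  · have e := c.upMean_add (Nat.zero_le j) hjM
    have := c.upMean_nonneg M j
    refine ⟨by linarith [h.mean_left], ?_⟩
    have := c.upVar_mono hjM
    have := h.var_left
    nlinarith
  · have hR : c.resSum M j ≤ b / η := by
      have hlt : c.cum (j - 1) < 1 - η := not_le.1 (Nat.find_min hex (by omega))
      have h2 := h.rev.cum_mul_resSum_le (l := n - j) (by omega)
      have h3 : c.rev.resSum (n - j) (n - M) = c.resSum M j := c.sum_Ico_res_rev hjM.le hjn
      have h4 := c.cum_rev (k := j - 1) (by omega)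
      rw [show j - 1 + 1 = j by omega] at h4
      rw [h3, h4] at h2
      rw [le_div_iff₀ h0]
      nlinarith [c.resSum_nonneg M j]
    have hR0 := c.resSum_nonneg M j
    refine ⟨?_, ?_⟩
    · have e := c.upMean_add (Nat.zero_le M) hjM.le
      have := c.upMean_le_resSum j M
      linarith [h.mean_left]
    · have h2 := c.upVar_le_of_le hjM.le hb fun l hl => h.cum_mul_resSum_le hl.le
      have := h.var_left
      nlinarith

theorem poissonMean_rightGap_le (h : c.Controlled M s b) {F : ℕ → ℝ}
    (hF : ∀ x ≤ n, F x ∈ Set.Icc (0 : ℝ) 1) {η C t : ℝ} (h0 : 0 < η) (h1 : η ≤ 1) (hC : 0 < C)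
    (ht0 : 0 ≤ t) (ht : s + b / η + C * b ≤ t) {x : ℕ} (hx : x ≤ n) :
    poissonMean (2 * t) (c.rightGap F x) ≤ 12 / (η * C) ^ 2 + 1 / C + η := by
  obtain ⟨j, hjn, hj1, hj2, hj3⟩ := h.exists_level h0 h1
  have hb := h.pos
  have hpos : 0 ≤ 12 / (η * C) ^ 2 + 1 / C := by positivity
  rcases le_or_gt x j with hxj | hxj
  · have h2 := c.poissonMean_surv_lazy_le (t := t) (d := C * b) hjn hxj (by positivity)
      (by linarith [c.upMean_anti j x]) ((c.upVar_anti j x).trans hj3)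
    have h3 : 12 * (b / η) ^ 2 / (C * b) ^ 2 = 12 / (η * C) ^ 2 := by field_simp
    have h4 : 1 / (2 * (C * b)) ≤ 1 / C :=
      one_div_le_one_div_of_le hC (by nlinarith [h.half_le])
    have hs := fun m => c.lazy.abs_surv_le_one j m hx
    refine (poissonMean_mono (B := 2) (by positivity) (fun m =>
      (c.abs_rightGap_le_one hF hx m).trans (by norm_num)) (fun m => ?_)
      fun m => c.rightGap_le hF hjn hxj m).trans ?_
    · refine (abs_add_le _ _).trans ?_
      have h5 : |1 - c.cum j| ≤ 1 := by
        rw [abs_of_nonneg (by linarith [c.cum_le_one j])]; linarith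
      linarith [hs m]
    · rw [poissonMean_add (by positivity) hs (B' := |1 - c.cum j|) fun _ => le_rfl,
        poissonMean_const]
      linarith
  · refine (poissonMean_mono (B := 1) (by positivity) (c.abs_rightGap_le_one hF hx)
      (r := fun _ => 1 - c.cum j) (fun m => ?_) fun m => c.rightGap_le_of_lt hF hxj hx m).trans ?_
    · rw [abs_of_nonneg (by linarith [c.cum_le_one j])]; linarith
    · rw [poissonMean_const]; linarith

end Controlled

theorem extend_mem {f : Fin (n + 1) → ℝ} (h : ∀ y, f y ∈ Set.Icc (0 : ℝ) 1) (k : ℕ) :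
    extend f k ∈ Set.Icc (0 : ℝ) 1 := by
  unfold extend
  split_ifs
  · exact h _
  · norm_num

theorem abs_pow_le_one (c : BDChain n) (m : ℕ) (x y : Fin (n + 1)) : |(c.K ^ m) x y| ≤ 1 := by
  have := c.iterate_act_mem (F := extend fun z => if z = y then 1 else 0)
    (fun z _ => extend_mem (fun w => by split_ifs <;> norm_num) z) m (x := x) (by omega)
  rw [iterate_act] at this
  simp only [extend_coe, mul_ite, mul_one, mul_zero, Finset.sum_ite_eq', Finset.mem_univ,
    if_true] at this
  rw [abs_of_nonneg this.1]
  exact this.2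

theorem sum_poissonMean_mul (c : BDChain n) {t : ℝ} (ht : 0 ≤ t) (F : ℕ → ℝ) (x : Fin (n + 1)) :
    ∑ y : Fin (n + 1), poissonMean t (fun m => (c.K ^ m) x y) * F y =
      poissonMean t fun m => c.act^[m] F x := by
  have e : (fun m => c.act^[m] F x) = fun m => ∑ y : Fin (n + 1), F y * (c.K ^ m) x y := by
    funext m
    rw [iterate_act]
    exact Finset.sum_congr rfl fun y _ => mul_comm _ _
  rw [e, poissonMean_sum ht (ι := Fin (n + 1)) Finset.univ (q := fun y m => F y * (c.K ^ m) x y)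
    (B := ∑ y : Fin (n + 1), |F y|)]
  · refine Finset.sum_congr rfl fun y _ => ?_
    rw [mul_comm, ← poissonMean_mul]
  · intro y m
    rw [abs_mul]
    exact (mul_le_of_le_one_right (abs_nonneg _) (c.abs_pow_le_one m x y)).trans
      (Finset.single_le_sum (f := fun y : Fin (n + 1) => |F y|) (fun _ _ => abs_nonneg _)
        (Finset.mem_univ y))

theorem Ht_sum_eq_lazy (c : BDChain n) {t : ℝ} (ht : 0 ≤ t) (F : ℕ → ℝ) (x : Fin (n + 1)) :
    ∑ y : Fin (n + 1), c.Ht t x y * F y = poissonMean (2 * t) fun m => c.lazy.act^[m] F x := by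
  simp only [Ht_eq_lazy]
  exact c.lazy.sum_poissonMean_mul (by positivity) F x

theorem Ht_sum_eq (c : BDChain n) {t : ℝ} (ht : 0 ≤ t) (F : ℕ → ℝ) (x : Fin (n + 1)) :
    ∑ y : Fin (n + 1), c.Ht t x y * F y = poissonMean t fun m => c.act^[m] F x :=
  c.sum_poissonMean_mul ht F x

theorem sum_mass_mul_eq (c : BDChain n) (F : ℕ → ℝ) :
    ∑ y ∈ Finset.range (n + 1), c.mass y * F y = ∑ y : Fin (n + 1), c.pi y * F y := by
  rw [← Fin.sum_univ_eq_sum_range (fun y => c.mass y * F y)]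
  simp only [mass_coe]

theorem indicator_mem (A : Finset (Fin (n + 1))) (x : ℕ) :
    extend (fun y => if y ∈ A then 1 else 0) x ∈ Set.Icc (0 : ℝ) 1 :=
  extend_mem (fun y => by split_ifs <;> norm_num) x

theorem Controlled.dTVC_le {c : BDChain n} {M : ℕ} {s b : ℝ} (h : c.Controlled M s b)
    {η t : ℝ} (h0 : 0 < η) (h1 : η ≤ 1) (ht : s + (1 / η + 100 / η ^ 2) * b ≤ t)
    (x : Fin (n + 1)) : c.dTVC x t ≤ 6 * η := by
  have hb := h.pos
  have ht0 : 0 ≤ t := by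
    have : 0 ≤ (1 / η + 100 / η ^ 2) * b := by positivity
    linarith [h.mean_left, c.upMean_nonneg M 0]
  have ht' : s + b / η + 100 / η ^ 2 * b ≤ t := by
    have : (1 / η + 100 / η ^ 2) * b = b / η + 100 / η ^ 2 * b := by ring
    linarith
  have hsmall : 12 / (η * (100 / η ^ 2)) ^ 2 + 1 / (100 / η ^ 2) + η ≤ 3 * η := by
    have e : 12 / (η * (100 / η ^ 2)) ^ 2 + 1 / (100 / η ^ 2) =
        12 / 10000 * η ^ 2 + η ^ 2 / 100 := by
      field_simp
      ring
    rw [e]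
    nlinarith
  rw [dTVC_eq_tv]
  refine tv_le fun A => ?_
  set F : ℕ → ℝ := extend fun y => if y ∈ A then 1 else 0 with hF
  have hmem : ∀ x ≤ n, F x ∈ Set.Icc (0 : ℝ) 1 := fun x _ => indicator_mem A x
  have hmem' : ∀ x ≤ n, F (n - x) ∈ Set.Icc (0 : ℝ) 1 := fun x _ => indicator_mem A _
  have e1 : ∑ y ∈ A, c.Ht t x y = ∑ y : Fin (n + 1), c.Ht t x y * F y := by
    simp [hF, extend_coe]
  have e2 : ∑ y ∈ A, c.pi y = ∑ y ∈ Finset.range (n + 1), c.mass y * F y := by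
    rw [sum_mass_mul_eq]
    simp [hF, extend_coe]
  have hxn : (x : ℕ) ≤ n := by omega
  have b1 : ∀ m, |c.lazy.act^[m] F x| ≤ 1 := fun m => by
    have := c.lazy.iterate_act_mem hmem m hxn
    rw [abs_of_nonneg this.1]; exact this.2
  rw [e1, e2, Ht_sum_eq_lazy c ht0, ← poissonMean_const (2 * t) (∑ y ∈ Finset.range _, _),
    ← poissonMean_sub (by positivity) b1 fun _ => le_rfl]
  have g1 := c.abs_rightGap_le_one hmem hxn
  have g2 := c.rev.abs_rightGap_le_one hmem' (Nat.sub_le n x)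
  refine (poissonMean_mono (B := 1 + |∑ y ∈ Finset.range (n + 1), c.mass y * F y| + 1)
    (by positivity) (fun m => ?_) (fun m => ?_) fun m => c.iterate_sub_sum_le F hxn m).trans ?_
  · refine (abs_sub _ _).trans ?_
    linarith [b1 m]
  · refine (abs_add_le _ _).trans ?_
    linarith [g1 m, g2 m, abs_nonneg (∑ y ∈ Finset.range (n + 1), c.mass y * F y)]
  · rw [poissonMean_add (by positivity) g1 g2]
    have i1 := h.poissonMean_rightGap_le hmem h0 h1 (C := 100 / η ^ 2) (by positivity) ht0 ht' hxn
    have i2 := h.rev.poissonMean_rightGap_le hmem' h0 h1 (C := 100 / η ^ 2) (by positivity) ht0 ht'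
      (Nat.sub_le n x)
    linarith

theorem exists_low_level (c : BDChain n) {M : ℕ} {b η : ℝ} (hb : 0 ≤ b)
    (hV : c.upVar M 0 ≤ b ^ 2) (h0 : 0 < η) (h1 : η ≤ c.cum M) :
    ∃ j ≤ M, ∑ i ∈ Finset.range j, c.mass i ≤ η ∧ c.upMean M 0 - b / η ≤ c.upMean j 0 ∧
      c.upVar j 0 ≤ b ^ 2 := by
  have hex : ∃ j, η ≤ c.cum j := ⟨M, h1⟩
  classical
  set j := Nat.find hex with hj
  have hjM : j ≤ M := Nat.find_min' hex h1
  refine ⟨j, hjM, ?_, ?_, (c.upVar_mono hjM).trans hV⟩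
  · rcases Nat.eq_zero_or_pos j with h | h
    · rw [h]; simpa using h0.le
    · have := Nat.find_min hex (m := j - 1) (by omega)
      rw [cum, show j - 1 + 1 = j by omega] at this
      exact (not_le.1 this).le
  · have e := c.upMean_add (Nat.zero_le j) hjM
    have h2 := c.upMean_le_resSum M j
    have h3 : c.cum j * c.resSum j M ≤ b :=
      le_of_sq_le_sq ((c.sq_cum_mul_resSum_le hjM).trans hV) hb
    have h4 : c.resSum j M ≤ b / η := by
      rw [le_div_iff₀ h0]
      nlinarith [c.resSum_nonneg j M, Nat.find_spec hex]
    linarith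

/-- The indicator of `[0, j)`. -/
def indLt (j z : ℕ) : ℝ := if z < j then 1 else 0

theorem indLt_mem (j z : ℕ) : indLt j z ∈ Set.Icc (0 : ℝ) 1 := by
  unfold indLt
  split_ifs <;> norm_num

theorem surv_le_iterate (c : BDChain n) {j : ℕ} (hj : j ≤ n) (m : ℕ) {x : ℕ} (hx : x ≤ j) :
    c.surv j m x ≤ c.act^[m] (indLt j) x := by
  refine c.surv_le hj (U := fun m x => c.act^[m] (indLt j) x)
    (fun m => ?_) (fun x hx => ?_) (fun m x hx => ?_) m hx
  · exact (c.iterate_act_mem (fun x _ => indLt_mem j x) m hj).1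
  · simp [indLt, hx]
  · rw [Function.iterate_succ_apply']

theorem sum_filter_lt (f : Fin (n + 1) → ℝ) (j : ℕ) :
    ∑ y ∈ Finset.univ.filter (fun y : Fin (n + 1) => (y : ℕ) < j), f y =
      ∑ y : Fin (n + 1), f y * indLt j y := by
  simp [Finset.sum_filter, indLt]

theorem sum_pi_filter_lt (c : BDChain n) {j : ℕ} (hj : j ≤ n) :
    ∑ y ∈ Finset.univ.filter (fun y : Fin (n + 1) => (y : ℕ) < j), c.pi y =
      ∑ i ∈ Finset.range j, c.mass i := by
  rw [sum_filter_lt, ← c.sum_mass_mul_eq (indLt j)]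
  simp only [indLt, mul_ite, mul_one, mul_zero]
  rw [← Finset.sum_filter]
  congr 1
  ext i
  simp only [Finset.mem_filter, Finset.mem_range]
  omega

theorem le_dTV (c : BDChain n) {M m : ℕ} (hM : M ≤ n) {b η D : ℝ} (hb : 0 < b)
    (hV : c.upVar M 0 ≤ b ^ 2) (h0 : 0 < η) (h1 : η ≤ c.cum M) (hD : 0 < D)
    (hm : m + D * b + b / η ≤ c.upMean M 0) : 1 - 1 / D ^ 2 - η ≤ c.dTV 0 m := by
  obtain ⟨j, hjM, hj1, hj2, hj3⟩ := c.exists_low_level hb.le hV h0 h1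
  have hjn := hjM.trans hM
  refine le_trans ?_ (sub_le_tv _ _ (Finset.univ.filter fun y : Fin (n + 1) => (y : ℕ) < j))
  rw [c.sum_pi_filter_lt hjn, sum_filter_lt, ← c.iterate_act (indLt j)]
  have h2 := c.surv_le_iterate hjn m (Nat.zero_le j)
  have h3 := c.one_sub_surv_le hjn (Nat.zero_le j) (m := m) (d := D * b) (by positivity)
    (by linarith) hj3
  have h4 : b ^ 2 / (D * b) ^ 2 = 1 / D ^ 2 := by field_simp
  rw [h4] at h3
  rw [Fin.val_zero]
  linarith

theorem le_dTVC (c : BDChain n) {M : ℕ} (hM : M ≤ n) {t b η D : ℝ} (ht0 : 0 ≤ t) (hb : 0 < b)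
    (hV : c.upVar M 0 ≤ b ^ 2) (h0 : 0 < η) (h1 : η ≤ c.cum M) (hD : 0 < D)
    (ht : t + D * b + b / η ≤ c.upMean M 0) : 1 - 1 / D ^ 2 - η ≤ c.dTVC 0 t := by
  obtain ⟨j, hjM, hj1, hj2, hj3⟩ := c.exists_low_level hb.le hV h0 h1
  have hjn := hjM.trans hM
  refine le_trans ?_ (sub_le_tv _ _ (Finset.univ.filter fun y : Fin (n + 1) => (y : ℕ) < j))
  rw [c.sum_pi_filter_lt hjn, sum_filter_lt, c.Ht_sum_eq ht0 (indLt j)]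
  have h2 : poissonMean t (fun m => c.surv j m 0) ≤
      poissonMean t fun m => c.act^[m] (indLt j) 0 := by
    refine poissonMean_mono ht0 (fun m => c.abs_surv_le_one j m (Nat.zero_le n)) (fun m => ?_)
      fun m => c.surv_le_iterate hjn m (Nat.zero_le j)
    have := c.iterate_act_mem (fun x _ => indLt_mem j x) m (Nat.zero_le n)
    rw [abs_of_nonneg this.1]; exact this.2
  have h3 := c.one_sub_poissonMean_surv_le hjn (Nat.zero_le j) (d := D * b) ht0 (by positivity)
    (by linarith) hj3
  have h4 : b ^ 2 / (D * b) ^ 2 = 1 / D ^ 2 := by field_simp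
  rw [h4] at h3
  rw [Fin.val_zero]
  linarith

end BDChain

namespace BDChain
variable {n : ℕ}

theorem mul_sq_le_of_mul_add_le {α β γ : ℝ} (hβ : 0 < β) (hγ : 0 < γ) (h : α * (β + γ) ≤ β * γ)
    (a b : ℝ) : α * a ^ 2 ≤ β * (a - b) ^ 2 + γ * b ^ 2 := by
  have hs : 0 < β + γ := by positivity
  have : 0 ≤ (β + γ) * (β * (a - b) ^ 2 + γ * b ^ 2 - α * a ^ 2) := by
    have e : (β + γ) * (β * (a - b) ^ 2 + γ * b ^ 2 - α * a ^ 2) =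
        ((β + γ) * b - β * a) ^ 2 + (β * γ - α * (β + γ)) * a ^ 2 := by ring
    rw [e]
    have := mul_nonneg (sub_nonneg.2 h) (sq_nonneg a)
    positivity
  linarith [nonneg_of_mul_nonneg_right this hs]

theorem hardy_step {p B r T : ℝ} (hp : 0 < p) (hB : 0 < B) (hr : 0 < r) (hT : 0 < T)
    (h : p * (r + T) ≤ B) (a b : ℝ) :
    (p + B / (r + T)) * a ^ 2 ≤ 4 * B * (r⁻¹ * (a - b) ^ 2) + (p + B / T) * b ^ 2 := by
  rw [← mul_assoc]
  refine mul_sq_le_of_mul_add_le (by positivity) (by positivity) ?_ a b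
  have hu : p * (r + T) + B ≤ 2 * B := by linarith
  have hv : p * T + B ≤ 2 * B := by nlinarith
  have hk : (p * (r + T) + B) * (p * T + B) ≤ 2 * B * (2 * B) :=
    mul_le_mul hu hv (by positivity) (by positivity)
  have e : 4 * B * r⁻¹ * (p + B / T) - (p + B / (r + T)) * (4 * B * r⁻¹ + (p + B / T)) =
      (4 * B ^ 2 - (p * (r + T) + B) * (p * T + B)) / (T * (r + T)) := by
    field_simp
    ring
  have : 0 ≤ (4 * B ^ 2 - (p * (r + T) + B) * (p * T + B)) / (T * (r + T)) :=
    div_nonneg (by nlinarith) (by positivity)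
  linarith

/-- The Dirichlet energy. -/
def energy (c : BDChain n) (F : ℕ → ℝ) : ℝ :=
  ∑ k ∈ Finset.range n, c.flux k * (F k - F (k + 1)) ^ 2

theorem hardy (c : BDChain n) {M : ℕ} (hM : M ≤ n) {B : ℝ} (hB0 : 0 < B)
    (hB : ∀ l < M, c.cum l * c.resSum l M ≤ B) {F : ℕ → ℝ} (hF : F M = 0) :
    ∑ k ∈ Finset.range M, c.mass k * F k ^ 2 ≤
      4 * B * ∑ k ∈ Finset.range M, c.flux k * (F k - F (k + 1)) ^ 2 := by
  have flux_eq_inv : ∀ k, c.flux k = (c.res k)⁻¹ := fun k => (inv_inv _).symm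
  have key : ∀ j < M, ∑ k ∈ Finset.range (j + 1), c.mass k * F k ^ 2 ≤
      4 * B * ∑ k ∈ Finset.range j, c.flux k * (F k - F (k + 1)) ^ 2 +
        (c.cum j + B / c.resSum j M) * F j ^ 2 := by
    intro j
    induction j with
    | zero =>
      intro h
      have : 0 ≤ B / c.resSum 0 M * F 0 ^ 2 :=
        mul_nonneg (div_nonneg hB0.le (c.resSum_nonneg _ _)) (sq_nonneg _)
      simp [cum, add_mul, this]
    | succ j ih =>
      intro h
      have h1 := ih (by omega)
      have h2 := c.resSum_eq (show j < M by omega)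
      have h3 := hB j (by omega)
      rw [h2] at h3 h1
      have h4 := hardy_step (c.cum_pos j) hB0 (c.res_pos (show j < n by omega))
        (c.resSum_pos h hM) h3 (F j) (F (j + 1))
      rw [Finset.sum_range_succ, Finset.sum_range_succ (n := j) (f := fun k => c.flux k * _),
        c.cum_succ, flux_eq_inv]
      nlinarith
  rcases Nat.eq_zero_or_pos M with h | h
  · simp [h]
  · obtain ⟨j, rfl⟩ : ∃ j, M = j + 1 := ⟨M - 1, by omega⟩
    have h1 := key j (by omega)
    have h2 : c.resSum j (j + 1) = c.res j := by simp [resSum]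
    have h3 := hB j (by omega)
    rw [h2] at h1 h3
    have hr := c.res_pos (show j < n by omega)
    rw [← le_div_iff₀ hr] at h3
    rw [Finset.sum_range_succ (fun k => c.flux k * (F k - F (k + 1)) ^ 2), hF, sub_zero,
      flux_eq_inv]
    have h5 : (c.cum j + B / c.res j) * F j ^ 2 ≤ 4 * B * ((c.res j)⁻¹ * F j ^ 2) := by
      have : 4 * B * ((c.res j)⁻¹ * F j ^ 2) = 4 * (B / c.res j) * F j ^ 2 := by
        rw [div_eq_mul_inv]; ring
      rw [this]
      have : 0 ≤ B / c.res j := by positivity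
      exact mul_le_mul_of_nonneg_right (by linarith) (sq_nonneg _)
    rw [mul_add]
    linarith

theorem energy_nonneg (c : BDChain n) (F : ℕ → ℝ) : 0 ≤ c.energy F :=
  Finset.sum_nonneg fun k _ => mul_nonneg (c.flux_nonneg k) (sq_nonneg _)

theorem sum_Ico_flux_rev (c : BDChain n) (F : ℕ → ℝ) {M : ℕ} (hM : M ≤ n) :
    ∑ k ∈ Finset.range (n - M), c.rev.flux k * (F (n - k) - F (n - (k + 1))) ^ 2 =
      ∑ k ∈ Finset.Ico M n, c.flux k * (F k - F (k + 1)) ^ 2 := by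
  refine Finset.sum_nbij' (fun k => n - 1 - k) (fun k => n - 1 - k) ?_ ?_ ?_ ?_ ?_ <;>
    intro k hk <;> simp only [Finset.mem_Ico, Finset.mem_range] at *
  · omega
  · omega
  · omega
  · omega
  · rw [c.flux_rev (by omega), show n - (k + 1) = n - 1 - k by omega,
      show n - k = n - 1 - k + 1 by omega]
    ring

theorem sum_range_mass_rev (c : BDChain n) (G : ℕ → ℝ) {M : ℕ} (hM : M ≤ n) :
    ∑ k ∈ Finset.range (n - M), c.rev.mass k * G (n - k) =
      ∑ k ∈ Finset.Ico (M + 1) (n + 1), c.mass k * G k := by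
  refine Finset.sum_nbij' (fun k => n - k) (fun k => n - k) ?_ ?_ ?_ ?_ ?_ <;>
    intro k hk <;> simp only [Finset.mem_Ico, Finset.mem_range] at *
  · omega
  · omega
  · omega
  · omega
  · rw [c.mass_rev (by omega)]

theorem Controlled.poincare {c : BDChain n} {M : ℕ} {s b : ℝ} (h : c.Controlled M s b)
    {F : ℕ → ℝ} (hF : F M = 0) :
    ∑ k ∈ Finset.range (n + 1), c.mass k * F k ^ 2 ≤ 4 * b * c.energy F := by
  have h1 := c.hardy h.le_n h.pos (fun l hl => h.cum_mul_resSum_le hl.le) hF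
  have h2 := c.rev.hardy h.rev.le_n h.pos (fun l hl => h.rev.cum_mul_resSum_le hl.le)
    (F := fun k => F (n - k)) (by rw [Nat.sub_sub_self h.le_n, hF])
  rw [c.sum_Ico_flux_rev F h.le_n, c.sum_range_mass_rev (fun k => F k ^ 2) h.le_n] at h2
  rw [energy, ← Finset.sum_range_add_sum_Ico _ h.le_n,
    ← Finset.sum_range_add_sum_Ico _ (show M + 1 ≤ n + 1 by linarith [h.le_n]),
    Finset.sum_range_succ, hF]
  linarith

theorem sum_mass_mul_mul_sub_act (c : BDChain n) (F : ℕ → ℝ) :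
    ∑ x ∈ Finset.range (n + 1), c.mass x * (F x * (F x - c.act F x)) = c.energy F := by
  have key : ∀ k ≤ n, ∑ x ∈ Finset.range (k + 1), c.mass x * (F x * (F x - c.act F x)) =
      ∑ x ∈ Finset.range k, c.flux x * (F x - F (x + 1)) ^ 2 +
        F k * (c.flux k * (F k - F (k + 1))) := by
    intro k
    induction k with
    | zero =>
      intro h
      have := c.sum_mass_sub_act F h
      simp only [zero_add, Finset.sum_range_one, Finset.range_zero, Finset.sum_empty] at this ⊢
      rw [← this]; ring
    | succ k ih =>
      intro h
      have h1 := c.sum_mass_sub_act F h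
      rw [Finset.sum_range_succ, c.sum_mass_sub_act F (by omega)] at h1
      rw [Finset.sum_range_succ, ih (by omega), Finset.sum_range_succ (n := k), ← h1]
      ring
  rw [key n le_rfl, c.flux_eq_zero le_rfl, zero_mul, mul_zero, add_zero, energy]

/-- The average with respect to the stationary distribution. -/
def avg (c : BDChain n) (f : Fin (n + 1) → ℝ) : ℝ := ∑ y, c.pi y * f y

/-- The Dirichlet form. -/
def dirichlet (c : BDChain n) (f g : Fin (n + 1) → ℝ) : ℝ := c.avg (f * (g - c.K *ᵥ g))

theorem avg_add (c : BDChain n) (f g : Fin (n + 1) → ℝ) : c.avg (f + g) = c.avg f + c.avg g := by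
  simp [avg, mul_add, Finset.sum_add_distrib]

theorem avg_sub (c : BDChain n) (f g : Fin (n + 1) → ℝ) : c.avg (f - g) = c.avg f - c.avg g := by
  simp [avg, mul_sub]

theorem avg_smul (c : BDChain n) (r : ℝ) (f : Fin (n + 1) → ℝ) : c.avg (r • f) = r * c.avg f := by
  simp [avg, Finset.mul_sum, mul_left_comm]

theorem avg_const (c : BDChain n) (r : ℝ) : c.avg (fun _ => r) = r := by
  simp [avg, ← Finset.sum_mul, c.pi_sum]

theorem avg_mono (c : BDChain n) {f g : Fin (n + 1) → ℝ} (h : ∀ y, f y ≤ g y) :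
    c.avg f ≤ c.avg g :=
  Finset.sum_le_sum fun y _ => mul_le_mul_of_nonneg_left (h y) (c.pi_pos y).le

theorem eq_zero_of_avg_mul_self (c : BDChain n) {f : Fin (n + 1) → ℝ} (h : c.avg (f * f) = 0) :
    f = 0 := by
  funext y
  have := (Finset.sum_eq_zero_iff_of_nonneg (fun y _ =>
    mul_nonneg (c.pi_pos y).le (mul_self_nonneg (f y)))).1 h y (Finset.mem_univ y)
  simpa [(c.pi_pos y).ne'] using this

theorem mulVec_apply (c : BDChain n) (f : Fin (n + 1) → ℝ) (x : Fin (n + 1)) :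
    (c.K *ᵥ f) x = ∑ y, c.K x y * f y := rfl

theorem avg_mulVec (c : BDChain n) (f : Fin (n + 1) → ℝ) : c.avg (c.K *ᵥ f) = c.avg f := by
  simp only [avg, mulVec_apply, Finset.mul_sum, ← mul_assoc]
  rw [Finset.sum_comm]
  simp only [← Finset.sum_mul, c.pi_stat]

theorem avg_mul_mulVec (c : BDChain n) (f g : Fin (n + 1) → ℝ) :
    c.avg (f * (c.K *ᵥ g)) = c.avg (g * (c.K *ᵥ f)) := by
  simp only [avg, Pi.mul_apply, mulVec_apply, Finset.mul_sum]
  rw [Finset.sum_comm]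
  refine Finset.sum_congr rfl fun x _ => Finset.sum_congr rfl fun y _ => ?_
  have := c.reversible x y
  rw [mass_coe, mass_coe, kern_coe, kern_coe] at this
  linear_combination (-(f y * g x)) * this

theorem mulVec_const (c : BDChain n) (r : ℝ) : c.K *ᵥ (fun _ => r) = fun _ => r := by
  funext x
  rw [mulVec_apply, ← Finset.sum_mul, c.K_rowSum, one_mul]

theorem dirichlet_comm (c : BDChain n) (f g : Fin (n + 1) → ℝ) :
    c.dirichlet f g = c.dirichlet g f := by
  rw [dirichlet, dirichlet, mul_sub, mul_sub, avg_sub, avg_sub, avg_mul_mulVec, mul_comm f g]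

theorem dirichlet_add (c : BDChain n) (f g h : Fin (n + 1) → ℝ) :
    c.dirichlet f (g + h) = c.dirichlet f g + c.dirichlet f h := by
  rw [dirichlet, dirichlet, dirichlet, ← avg_add, Matrix.mulVec_add]
  congr 1
  ring

theorem dirichlet_smul (c : BDChain n) (r : ℝ) (f g : Fin (n + 1) → ℝ) :
    c.dirichlet f (r • g) = r * c.dirichlet f g := by
  rw [dirichlet, dirichlet, ← avg_smul, Matrix.mulVec_smul, ← smul_sub, mul_smul_comm]

theorem dirichlet_const (c : BDChain n) (r : ℝ) (f : Fin (n + 1) → ℝ) :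
    c.dirichlet f (fun _ => r) = 0 := by
  rw [dirichlet, mulVec_const, sub_self, mul_zero]
  exact c.avg_const 0

theorem act_extend (c : BDChain n) (f : Fin (n + 1) → ℝ) (x : Fin (n + 1)) :
    c.act (extend f) x = (c.K *ᵥ f) x := by
  rw [act_coe, mulVec_apply]
  simp only [extend_coe]

theorem dirichlet_self (c : BDChain n) (f : Fin (n + 1) → ℝ) :
    c.dirichlet f f = c.energy (extend f) := by
  rw [← sum_mass_mul_mul_sub_act, c.sum_mass_mul_eq fun x =>
    extend f x * (extend f x - c.act (extend f) x), dirichlet, avg]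
  simp only [extend_coe, act_extend, Pi.mul_apply, Pi.sub_apply]

theorem dirichlet_restrict (c : BDChain n) (F : ℕ → ℝ) :
    c.dirichlet (fun y => F y) (fun y => F y) = c.energy F := by
  rw [← sum_mass_mul_mul_sub_act, c.sum_mass_mul_eq fun x => F x * (F x - c.act F x), dirichlet,
    avg]
  simp only [act_coe, Pi.mul_apply, Pi.sub_apply, mulVec_apply]

theorem dirichlet_nonneg (c : BDChain n) (f : Fin (n + 1) → ℝ) : 0 ≤ c.dirichlet f f := by
  rw [dirichlet_self]; exact c.energy_nonneg _

theorem continuous_avg (c : BDChain n) : Continuous c.avg := by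
  unfold avg; fun_prop

theorem continuous_dirichlet_self (c : BDChain n) : Continuous fun f => c.dirichlet f f := by
  unfold dirichlet avg
  simp only [Pi.mul_apply, Pi.sub_apply, mulVec_apply]
  fun_prop

theorem avg_sub_avg (c : BDChain n) (g : Fin (n + 1) → ℝ) :
    c.avg (g - fun _ => c.avg g) = 0 := by
  rw [avg_sub, avg_const, sub_self]

theorem avg_mul_self_sub (c : BDChain n) (g : Fin (n + 1) → ℝ) (a : ℝ) :
    c.avg ((g - fun _ => a) * (g - fun _ => a)) = c.avg (g * g) - 2 * a * c.avg g + a ^ 2 := by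
  have e : (g - fun _ => a) * (g - fun _ => a) = g * g - (2 * a) • g + fun _ => a ^ 2 := by
    funext y
    simp
    ring
  rw [e, avg_add, avg_sub, avg_smul, avg_const]

theorem dirichlet_sub_const (c : BDChain n) (g : Fin (n + 1) → ℝ) (a : ℝ) :
    c.dirichlet (g - fun _ => a) (g - fun _ => a) = c.dirichlet g g := by
  have e : (g - fun _ => a) = g + fun _ => -a := by funext y; simp [sub_eq_add_neg]
  rw [e, dirichlet_add, dirichlet_const, add_zero, dirichlet_comm, dirichlet_add, dirichlet_const,
    add_zero]

/-- The spectral gap is attained. -/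
theorem exists_eigenfunction (c : BDChain n) (hn : 0 < n) :
    ∃ (l : ℝ) (f : Fin (n + 1) → ℝ), c.avg (f * f) = 1 ∧ c.avg f = 0 ∧
      c.K *ᵥ f = (1 - l) • f ∧ c.dirichlet f f = l ∧
      ∀ g, l * (c.avg (g * g) - c.avg g ^ 2) ≤ c.dirichlet g g := by
  set S : Set (Fin (n + 1) → ℝ) := {f | c.avg (f * f) = 1 ∧ c.avg f = 0} with hS
  have normalize : ∀ g : Fin (n + 1) → ℝ, 0 < c.avg (g * g) → c.avg g = 0 →
      (Real.sqrt (c.avg (g * g)))⁻¹ • g ∈ S := by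
    intro g h1 h2
    refine ⟨?_, by rw [avg_smul, h2, mul_zero]⟩
    rw [smul_mul_smul_comm, avg_smul, ← mul_inv, Real.mul_self_sqrt h1.le, inv_mul_cancel₀ h1.ne']
  have hclosed : IsClosed S := by
    have h1 : IsClosed {f : Fin (n + 1) → ℝ | c.avg (f * f) = 1} :=
      isClosed_eq (c.continuous_avg.comp (continuous_id.mul continuous_id)) continuous_const
    exact h1.inter (isClosed_eq c.continuous_avg continuous_const)
  have hbdd : Bornology.IsBounded S := by
    refine (Metric.isBounded_iff_subset_closedBall 0).2 ⟨∑ y, (c.pi y)⁻¹, fun f hf => ?_⟩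
    have hsum : 0 ≤ ∑ y, (c.pi y)⁻¹ := Finset.sum_nonneg fun y _ => (inv_pos.2 (c.pi_pos y)).le
    rw [mem_closedBall_zero_iff, pi_norm_le_iff_of_nonneg hsum]
    intro y
    have hp := c.pi_pos y
    have h1 : c.pi y * (f y * f y) ≤ 1 := by
      rw [← hf.1]
      exact Finset.single_le_sum (f := fun y => c.pi y * (f * f) y)
        (fun y _ => mul_nonneg (c.pi_pos y).le (mul_self_nonneg (f y))) (Finset.mem_univ y)
    have h2 : c.pi y ≤ 1 := by
      rw [← c.pi_sum]
      exact Finset.single_le_sum (fun y _ => (c.pi_pos y).le) (Finset.mem_univ y)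
    refine le_trans ?_ (Finset.single_le_sum (f := fun y => (c.pi y)⁻¹)
      (fun y _ => (inv_pos.2 (c.pi_pos y)).le) (Finset.mem_univ y))
    rw [Real.norm_eq_abs]
    refine abs_le_of_sq_le_sq ?_ (by positivity)
    have h3 : f y ^ 2 ≤ (c.pi y)⁻¹ := by
      rw [← one_div, le_div_iff₀ hp]; linarith
    have h4 : 1 ≤ (c.pi y)⁻¹ := (one_le_inv₀ hp).2 h2
    nlinarith
  have hne : S.Nonempty := by
    set g : Fin (n + 1) → ℝ := fun y => if y = 0 then 1 else 0 with hg
    have h0 := c.avg_sub_avg g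
    refine ⟨_, normalize _ (lt_of_le_of_ne ?_ fun h => ?_) h0⟩
    · exact Finset.sum_nonneg fun y _ => mul_nonneg (c.pi_pos y).le (mul_self_nonneg _)
    · have h2 := c.eq_zero_of_avg_mul_self h.symm
      have h3 := congrFun h2 0
      have h4 := congrFun h2 (Fin.last n)
      have h5 : Fin.last n ≠ 0 := by
        intro h; have := congrArg Fin.val h; simp at this; omega
      simp [hg, h5] at h3 h4
      linarith
  obtain ⟨f, hf, hmin⟩ := (Metric.isCompact_of_isClosed_isBounded hclosed hbdd).exists_isMinOn hne
    c.continuous_dirichlet_self.continuousOn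
  have hvar : ∀ g, c.dirichlet f f * (c.avg (g * g) - c.avg g ^ 2) ≤ c.dirichlet g g := by
    intro g
    set h := g - fun _ => c.avg g with hh
    have e1 : c.avg (h * h) = c.avg (g * g) - c.avg g ^ 2 := by
      rw [hh, avg_mul_self_sub]; ring
    rw [← e1, ← c.dirichlet_sub_const g (c.avg g), ← hh]
    have hnn : 0 ≤ c.avg (h * h) :=
      Finset.sum_nonneg fun y _ => mul_nonneg (c.pi_pos y).le (mul_self_nonneg _)
    rcases hnn.eq_or_lt with h0 | h0
    · rw [← h0, mul_zero]; exact c.dirichlet_nonneg h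
    · have h1 := hmin (normalize h h0 (c.avg_sub_avg g))
      change c.dirichlet f f ≤ c.dirichlet (_ • h) (_ • h) at h1
      rw [dirichlet_smul, c.dirichlet_comm (_ • h), dirichlet_smul, ← mul_assoc, ← mul_inv,
        Real.mul_self_sqrt hnn, inv_mul_eq_div, le_div_iff₀ h0] at h1
      exact h1
  refine ⟨c.dirichlet f f, f, hf.1, hf.2, ?_, rfl, hvar⟩
  set l := c.dirichlet f f with hl
  have hbil : ∀ g, c.dirichlet f g - l * c.avg (f * g) = 0 := by
    intro g
    have key : ∀ t : ℝ, 0 ≤ (c.dirichlet g g - l * (c.avg (g * g) - c.avg g ^ 2)) * (t * t) +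
        2 * (c.dirichlet f g - l * c.avg (f * g)) * t + 0 := by
      intro t
      have := hvar (f + t • g)
      have e1 : (f + t • g) * (f + t • g) = f * f + (2 * t) • (f * g) + (t ^ 2) • (g * g) := by
        funext y; simp; ring
      have e2 : c.dirichlet (f + t • g) (f + t • g) =
          l + 2 * t * c.dirichlet f g + t ^ 2 * c.dirichlet g g := by
        rw [dirichlet_add, dirichlet_smul, dirichlet_comm, dirichlet_comm _ _ g, dirichlet_add,
          dirichlet_add, dirichlet_smul, dirichlet_smul, c.dirichlet_comm g f]
        ring
      rw [e2, e1, avg_add, avg_add, avg_smul, avg_smul, avg_add, avg_smul, hf.1, hf.2] at this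
      nlinarith
    have := discrim_le_zero key
    rw [discrim] at this
    nlinarith [sq_nonneg (c.dirichlet f g - l * c.avg (f * g))]
  have e : ∀ g, c.avg (g * ((f - c.K *ᵥ f) - l • f)) = 0 := by
    intro g
    have := hbil g
    rw [dirichlet_comm, dirichlet] at this
    rw [mul_sub, avg_sub, mul_smul_comm, avg_smul, mul_comm g f]
    exact this
  have h0 := c.eq_zero_of_avg_mul_self (e _)
  funext y
  have := congrFun h0 y
  simp only [Pi.sub_apply, Pi.smul_apply, smul_eq_mul, Pi.zero_apply] at this ⊢
  linarith

end BDChain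

theorem hasSum_poissonWeight_mul_pow (t r : ℝ) :
    HasSum (fun m => poissonWeight t m * r ^ m) (Real.exp (-(1 - r) * t)) := by
  have := (NormedSpace.expSeries_div_hasSum_exp (t * r)).mul_left (Real.exp (-t))
  rw [← Real.exp_eq_exp_ℝ, ← Real.exp_add, show -t + t * r = -(1 - r) * t by ring] at this
  refine this.congr_fun ?_
  intro m
  unfold poissonWeight
  rw [mul_pow]
  ring

theorem poissonMean_pow_mul (t r a : ℝ) :
    poissonMean t (fun m => r ^ m * a) = Real.exp (-(1 - r) * t) * a := by
  rw [← ((hasSum_poissonWeight_mul_pow t r).mul_right a).tsum_eq, poissonMean]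
  simp only [mul_assoc]

theorem abs_sum_sub_mul_le {ι : Type*} [Fintype ι] {μ ν f : ι → ℝ} (h : ∑ y, μ y = ∑ y, ν y)
    {N : ℝ} (hN : 0 < N) (hf : ∀ y, |f y| ≤ N) : |∑ y, (μ y - ν y) * f y| ≤ 2 * N * tv μ ν := by
  have key : ∀ e : ℝ, |e| = 1 → e * ∑ y, (μ y - ν y) * f y ≤ 2 * N * tv μ ν := by
    intro e he
    have := sum_sub_mul_le_two_mul_tv h (g := fun y => e * f y / N) fun y => by
      rw [abs_div, abs_mul, he, one_mul, abs_of_pos hN, div_le_one hN]; exact hf y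
    have e2 : ∑ y, (μ y - ν y) * (e * f y / N) = e / N * ∑ y, (μ y - ν y) * f y := by
      rw [Finset.mul_sum]
      exact Finset.sum_congr rfl fun y _ => by ring
    rw [e2, div_mul_eq_mul_div, div_le_iff₀ hN] at this
    linarith
  rw [abs_le]
  constructor
  · linarith [key (-1) (by norm_num)]
  · linarith [key 1 (by norm_num)]

namespace BDChain
variable {n : ℕ}

theorem iterate_act_extend (c : BDChain n) {r : ℝ} {f : Fin (n + 1) → ℝ}
    (h : c.K *ᵥ f = r • f) (m : ℕ) (x : Fin (n + 1)) :
    c.act^[m] (extend f) x = r ^ m * f x := by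
  induction m generalizing x with
  | zero => simp [extend_coe]
  | succ m ih =>
    rw [Function.iterate_succ_apply', act_coe]
    simp only [ih]
    have := congrFun h x
    rw [mulVec_apply, Pi.smul_apply, smul_eq_mul] at this
    rw [pow_succ, mul_assoc, ← this, Finset.mul_sum]
    exact Finset.sum_congr rfl fun y _ => by ring

theorem pow_rowSum (c : BDChain n) (m : ℕ) (x : Fin (n + 1)) : ∑ y, (c.K ^ m) x y = 1 := by
  have h := c.iterate_act (extend (n := n) fun _ => 1) m x
  rw [c.iterate_act_extend (r := 1) (by rw [mulVec_const, one_smul])] at h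
  simpa [extend_coe] using h.symm

theorem Ht_rowSum (c : BDChain n) {t : ℝ} (ht : 0 ≤ t) (x : Fin (n + 1)) :
    ∑ y, c.Ht t x y = 1 := by
  have h := c.Ht_sum_eq ht (extend (n := n) fun _ => 1) x
  have h1 : c.K *ᵥ (fun _ => 1) = (1 : ℝ) • fun _ => 1 := by rw [mulVec_const, one_smul]
  simp only [c.iterate_act_extend h1, extend_coe, one_pow, mul_one, poissonMean_const] at h
  exact h

theorem exists_abs_max {f : Fin (n + 1) → ℝ} (hf : f ≠ 0) :
    ∃ x, 0 < |f x| ∧ ∀ y, |f y| ≤ |f x| := by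
  obtain ⟨x, -, hx⟩ := Finset.exists_max_image Finset.univ (fun y => |f y|)
    (Finset.univ_nonempty (α := Fin (n + 1)))
  refine ⟨x, ?_, fun y => hx y (Finset.mem_univ y)⟩
  obtain ⟨y, hy⟩ := Function.ne_iff.1 hf
  exact (abs_pos.2 hy).trans_le (hx y (Finset.mem_univ y))

theorem abs_one_sub_pow_le (c : BDChain n) {l : ℝ} {f : Fin (n + 1) → ℝ} (hf : f ≠ 0)
    (hf0 : c.avg f = 0) (h : c.K *ᵥ f = (1 - l) • f) (m : ℕ) :
    |1 - l| ^ m ≤ 2 * c.dTVMax m := by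
  obtain ⟨x, hx, hmax⟩ := exists_abs_max hf
  have h1 := abs_sum_sub_mul_le (μ := fun y => (c.K ^ m) x y) (ν := c.pi)
    (by rw [c.pow_rowSum, c.pi_sum]) hx hmax
  have h2 := c.iterate_act (extend f) m x
  rw [c.iterate_act_extend h] at h2
  simp only [extend_coe] at h2
  simp only [sub_mul, Finset.sum_sub_distrib] at h1
  rw [← h2, show ∑ y, c.pi y * f y = 0 from hf0, sub_zero, abs_mul, abs_pow] at h1
  have h3 : tv (fun y => (c.K ^ m) x y) c.pi ≤ c.dTVMax m := c.le_dTVMax x m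
  nlinarith

theorem exp_le_two_mul_dTVMaxC (c : BDChain n) {l : ℝ} {f : Fin (n + 1) → ℝ} (hf : f ≠ 0)
    (hf0 : c.avg f = 0) (h : c.K *ᵥ f = (1 - l) • f) {t : ℝ} (ht : 0 ≤ t) :
    Real.exp (-l * t) ≤ 2 * c.dTVMaxC t := by
  obtain ⟨x, hx, hmax⟩ := exists_abs_max hf
  have h1 := abs_sum_sub_mul_le (μ := fun y => c.Ht t x y) (ν := c.pi)
    (by rw [c.Ht_rowSum ht, c.pi_sum]) hx hmax
  have h2 := c.Ht_sum_eq ht (extend f) x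
  simp only [c.iterate_act_extend h, extend_coe, poissonMean_pow_mul] at h2
  simp only [sub_mul, Finset.sum_sub_distrib] at h1
  rw [h2, show ∑ y, c.pi y * f y = 0 from hf0, sub_zero, abs_mul, abs_of_pos (Real.exp_pos _),
    sub_sub_cancel] at h1
  have h3 : tv (fun y => c.Ht t x y) c.pi ≤ c.dTVMaxC t := c.le_dTVMaxC x t
  nlinarith

/-- A function equal to one on `[0, j]`, harmonic on `(j, M)`, and zero on `[M, n]`. -/
def ramp (c : BDChain n) (j M k : ℕ) : ℝ := if k ≤ j then 1 else c.resSum k M / c.resSum j M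

theorem ramp_of_le (c : BDChain n) {j M k : ℕ} (h : k ≤ j) : c.ramp j M k = 1 := if_pos h

theorem ramp_of_ge (c : BDChain n) {j M k : ℕ} (hj : j < M) (hM : M ≤ n) (h : j ≤ k) :
    c.ramp j M k = c.resSum k M / c.resSum j M := by
  rcases h.eq_or_lt with rfl | h
  · rw [ramp_of_le c le_rfl, div_self (c.resSum_pos hj hM).ne']
  · exact if_neg (by omega)

theorem resSum_of_ge (c : BDChain n) {a b : ℕ} (h : b ≤ a) : c.resSum a b = 0 := by
  rw [resSum, Finset.Ico_eq_empty_of_le h, Finset.sum_empty]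

theorem energy_ramp (c : BDChain n) {j M : ℕ} (hj : j < M) (hM : M ≤ n) :
    c.energy (c.ramp j M) = 1 / c.resSum j M := by
  have hT := c.resSum_pos hj hM
  rw [energy, ← Finset.sum_range_add_sum_Ico _ (show j ≤ n by omega),
    ← Finset.sum_Ico_consecutive _ hj.le hM, Finset.sum_eq_zero (s := Finset.range j),
    Finset.sum_eq_zero (s := Finset.Ico M n), zero_add, add_zero]
  · have e : ∀ k ∈ Finset.Ico j M, c.flux k * (c.ramp j M k - c.ramp j M (k + 1)) ^ 2 =
        c.res k / c.resSum j M ^ 2 := by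
      intro k hk
      rw [Finset.mem_Ico] at hk
      rw [c.ramp_of_ge hj hM hk.1, c.ramp_of_ge hj hM (by omega), c.resSum_eq hk.2, ← sub_div,
        add_sub_cancel_right, res]
      have := (c.flux_pos (show k < n by omega)).ne'
      field_simp
    rw [Finset.sum_congr rfl e, ← Finset.sum_div]
    change c.resSum j M / _ = _
    field_simp
  · intro k hk
    rw [Finset.mem_Ico] at hk
    rw [c.ramp_of_ge hj hM (by omega), c.ramp_of_ge hj hM (by omega), c.resSum_of_ge hk.1,
      c.resSum_of_ge (show M ≤ k + 1 by omega)]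
    simp
  · intro k hk
    rw [Finset.mem_range] at hk
    rw [c.ramp_of_le hk.le, c.ramp_of_le hk]
    simp

theorem sum_Ico_mass (c : BDChain n) {M : ℕ} (hM : M ≤ n) :
    ∑ k ∈ Finset.Ico M (n + 1), c.mass k = c.rev.cum (n - M) := by
  rw [cum]
  refine Finset.sum_nbij' (fun k => n - k) (fun k => n - k) ?_ ?_ ?_ ?_ ?_ <;>
    intro k hk <;> simp only [Finset.mem_Ico, Finset.mem_range] at *
  · omega
  · omega
  · omega
  · omega
  · rw [c.mass_rev (by omega), show n - (n - k) = k by omega]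

theorem le_variance_ramp (c : BDChain n) {j M : ℕ} (hj : j < M) (hM : M ≤ n) {κ : ℝ} (h0 : 0 ≤ κ)
    (hκ : κ ≤ c.rev.cum (n - M)) :
    c.cum j * κ ≤ c.avg ((fun y : Fin (n + 1) => c.ramp j M y) *
      fun y : Fin (n + 1) => c.ramp j M y) - c.avg (fun y : Fin (n + 1) => c.ramp j M y) ^ 2 := by
  set G : Fin (n + 1) → ℝ := fun y => c.ramp j M y with hG
  set a := c.avg G with ha
  have h1 : c.avg ((G - fun _ => a) * (G - fun _ => a)) = c.avg (G * G) - a ^ 2 := by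
    rw [avg_mul_self_sub, ← ha]; ring
  rw [← h1]
  have h2 : c.avg ((G - fun _ => a) * (G - fun _ => a)) =
      ∑ k ∈ Finset.range (n + 1), c.mass k * (c.ramp j M k - a) ^ 2 := by
    rw [c.sum_mass_mul_eq fun k => (c.ramp j M k - a) ^ 2, avg]
    simp only [hG, Pi.mul_apply, Pi.sub_apply, sq]
  rw [h2, ← Finset.sum_range_add_sum_Ico _ (show j + 1 ≤ n + 1 by omega),
    ← Finset.sum_Ico_consecutive _ (show j + 1 ≤ M by omega) (show M ≤ n + 1 by omega)]
  have i1 : ∑ k ∈ Finset.range (j + 1), c.mass k * (c.ramp j M k - a) ^ 2 =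
      c.cum j * (1 - a) ^ 2 := by
    rw [cum, Finset.sum_mul]
    refine Finset.sum_congr rfl fun k hk => ?_
    rw [Finset.mem_range] at hk
    rw [c.ramp_of_le (by omega)]
  have i2 : ∑ k ∈ Finset.Ico M (n + 1), c.mass k * (c.ramp j M k - a) ^ 2 =
      c.rev.cum (n - M) * a ^ 2 := by
    rw [← c.sum_Ico_mass hM, Finset.sum_mul]
    refine Finset.sum_congr rfl fun k hk => ?_
    rw [Finset.mem_Ico] at hk
    rw [c.ramp_of_ge hj hM (by omega), c.resSum_of_ge hk.1]
    ring
  have i3 : 0 ≤ ∑ k ∈ Finset.Ico (j + 1) M, c.mass k * (c.ramp j M k - a) ^ 2 :=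
    Finset.sum_nonneg fun k _ => mul_nonneg (c.mass_nonneg k) (sq_nonneg _)
  rw [i1, i2]
  have h3 : c.cum j + κ ≤ 1 := by
    have := c.mass_sum
    rw [cum, ← Finset.sum_range_add_sum_Ico _ (show j + 1 ≤ n + 1 by omega)] at this
    have h4 : ∑ k ∈ Finset.Ico M (n + 1), c.mass k ≤ ∑ k ∈ Finset.Ico (j + 1) (n + 1), c.mass k :=
      Finset.sum_le_sum_of_subset_of_nonneg (Finset.Ico_subset_Ico_left (by omega))
        fun y _ _ => c.mass_nonneg y
    rw [c.sum_Ico_mass hM] at h4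
    rw [cum]
    linarith
  have hp := c.cum_pos j
  have h5 : κ * a ^ 2 ≤ c.rev.cum (n - M) * a ^ 2 :=
    mul_le_mul_of_nonneg_right hκ (sq_nonneg a)
  have h6 : c.cum j * κ ≤ c.cum j * (1 - a) ^ 2 + κ * a ^ 2 := by
    have hs : 0 < c.cum j + κ := by linarith
    have : 0 ≤ (c.cum j + κ) * (c.cum j * (1 - a) ^ 2 + κ * a ^ 2 - c.cum j * κ) := by
      have e : (c.cum j + κ) * (c.cum j * (1 - a) ^ 2 + κ * a ^ 2 - c.cum j * κ) =
          (c.cum j * (1 - a) - κ * a) ^ 2 + c.cum j * κ * (1 - (c.cum j + κ)) := by ring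
      rw [e]
      have : 0 ≤ 1 - (c.cum j + κ) := by linarith
      positivity
    linarith [nonneg_of_mul_nonneg_right this hs]
  linarith

theorem gap_mul_cum_mul_resSum_le (c : BDChain n) {l : ℝ}
    (hl : ∀ g, l * (c.avg (g * g) - c.avg g ^ 2) ≤ c.dirichlet g g) (hl0 : 0 ≤ l)
    {j M : ℕ} (hj : j < M) (hM : M ≤ n) {κ : ℝ} (h0 : 0 ≤ κ) (hκ : κ ≤ c.rev.cum (n - M)) :
    l * κ * (c.cum j * c.resSum j M) ≤ 1 := by
  have h1 := hl fun y => c.ramp j M y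
  rw [dirichlet_restrict, c.energy_ramp hj hM, le_div_iff₀ (c.resSum_pos hj hM)] at h1
  have h2 := mul_le_mul_of_nonneg_left (c.le_variance_ramp hj hM h0 hκ) hl0
  have h3 := mul_le_mul_of_nonneg_right h2 (c.resSum_nonneg j M)
  linarith

theorem gap_mul_upVar_le (c : BDChain n) {l : ℝ}
    (hl : ∀ g, l * (c.avg (g * g) - c.avg g ^ 2) ≤ c.dirichlet g g) (hl0 : 0 < l)
    {M : ℕ} (hM : M ≤ n) {κ : ℝ} (h0 : 0 < κ) (hκ : κ ≤ c.rev.cum (n - M)) :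
    l * κ * c.upVar M 0 ≤ 2 * c.upMean M 0 := by
  have h := c.upVar_le (M := M) (B := 1 / (l * κ)) fun j hj => by
    rw [le_div_iff₀ (by positivity), mul_comm]
    exact c.gap_mul_cum_mul_resSum_le hl hl0.le hj hM h0.le hκ
  calc l * κ * c.upVar M 0 ≤ l * κ * (2 * (1 / (l * κ)) * c.upMean M 0) := by gcongr
    _ = 2 * c.upMean M 0 := by field_simp

theorem upVar_le_two_mul_sq (c : BDChain n) (M : ℕ) : c.upVar M 0 ≤ 2 * c.upMean M 0 ^ 2 := by
  have h := c.upVar_le (M := M) (B := c.upMean M 0) fun j hj => by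
    rw [upMean_eq, resSum, Finset.mul_sum]
    refine le_trans (Finset.sum_le_sum fun k hk => ?_) (Finset.sum_le_sum_of_subset_of_nonneg
      (Finset.Ico_subset_Ico_left (Nat.zero_le j)) fun k _ _ =>
        mul_nonneg (c.res_nonneg k) (c.cum_pos k).le)
    rw [mul_comm]
    exact mul_le_mul_of_nonneg_left (c.cum_mono (Finset.mem_Ico.1 hk).1) (c.res_nonneg k)
  linarith [h, sq (c.upMean M 0)]

theorem Controlled.one_le_mul_dirichlet {c : BDChain n} {M : ℕ} {s b : ℝ}
    (h : c.Controlled M s b) {g : Fin (n + 1) → ℝ} (hg : c.avg g = 0) :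
    c.avg (g * g) ≤ 4 * b * c.dirichlet g g := by
  have hM := h.le_n
  set a := g ⟨M, by omega⟩ with ha
  set G := g - fun _ => a with hG
  have h1 := h.poincare (F := extend G) (by
    have := extend_coe G ⟨M, by omega⟩
    simp only at this
    rw [this, hG, Pi.sub_apply, ← ha, sub_self])
  rw [c.sum_mass_mul_eq fun k => extend G k ^ 2, ← dirichlet_self, hG, dirichlet_sub_const,
    ← hG] at h1
  have h2 : ∑ y : Fin (n + 1), c.pi y * extend G y ^ 2 = c.avg (G * G) := by
    simp only [avg, extend_coe, Pi.mul_apply, sq]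
  rw [h2, hG, avg_mul_self_sub, hg] at h1
  nlinarith [sq_nonneg a]

end BDChain

theorem factorial_le_mul_sqrt {m : ℕ} (hm : 1 ≤ m) :
    (m.factorial : ℝ) ≤ Real.exp 1 * √m * (m / Real.exp 1) ^ m := by
  have h := Stirling.stirlingSeq'_antitone (Nat.zero_le (m - 1))
  simp only [Function.comp_apply, Nat.succ_eq_add_one, Nat.sub_add_cancel hm, zero_add,
    Stirling.stirlingSeq_one] at h
  rw [Stirling.stirlingSeq] at h
  have hm' : (0 : ℝ) < m := by exact_mod_cast hm
  have h2 : (0 : ℝ) < √2 := by positivity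
  rw [Real.sqrt_mul zero_le_two, div_le_iff₀ (by positivity)] at h
  refine h.trans (le_of_eq ?_)
  field_simp

theorem pow_mul_exp_neg_le {x : ℝ} (hx : 0 ≤ x) (k : ℕ) :
    x ^ k * Real.exp (-x) ≤ (k / Real.exp 1) ^ k := by
  rcases Nat.eq_zero_or_pos k with rfl | hk
  · simpa using hx
  have hk' : (0 : ℝ) < k := by exact_mod_cast hk
  have h := Real.add_one_le_exp (x / k - 1)
  rw [sub_add_cancel, div_le_iff₀ hk'] at h
  have h2 := pow_le_pow_left₀ hx h k
  have e : (Real.exp (x / k - 1) * k) ^ k = (k / Real.exp 1) ^ k * Real.exp x := by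
    rw [Real.exp_sub, mul_pow, div_pow, div_pow, ← Real.exp_nat_mul, mul_div_cancel₀ _ hk'.ne']
    ring
  rw [e] at h2
  rw [Real.exp_neg, ← div_eq_mul_inv, div_le_iff₀ (Real.exp_pos x)]
  exact h2

theorem sqrt_mul_div_pow_le_factorial (k : ℕ) :
    √((k : ℝ) + 1) * (k / Real.exp 1) ^ k ≤ k.factorial := by
  rcases Nat.eq_zero_or_pos k with rfl | hk
  · simp
  refine le_trans ?_ (Stirling.le_factorial_stirling k)
  have : (1 : ℝ) ≤ k := by exact_mod_cast hk
  gcongr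
  nlinarith [Real.pi_gt_three]

theorem sqrt_succ_mul_poissonWeight_le_one {t : ℝ} (ht : 0 ≤ t) (k : ℕ) :
    √((k : ℝ) + 1) * poissonWeight t k ≤ 1 := by
  have hf : (0 : ℝ) < k.factorial := by exact_mod_cast Nat.factorial_pos _
  rw [poissonWeight, ← mul_div_assoc, div_le_one hf]
  refine le_trans ?_ (sqrt_mul_div_pow_le_factorial k)
  rw [mul_comm (Real.exp _)]
  exact mul_le_mul_of_nonneg_left (pow_mul_exp_neg_le ht k) (Real.sqrt_nonneg _)

theorem sqrt_mul_poissonWeight_le_one {t : ℝ} (ht : 0 ≤ t) (k : ℕ) :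
    √t * poissonWeight t k ≤ 1 := by
  have hw := poissonWeight_nonneg ht k
  have hw' := poissonWeight_nonneg ht (k + 1)
  set r := √((k : ℝ) + 1) with hr
  have hr0 : 0 < r := Real.sqrt_pos.2 (by positivity)
  have hr2 : r ^ 2 = k + 1 := Real.sq_sqrt (by positivity)
  have hs2 : √t ^ 2 = t := Real.sq_sqrt ht
  have h1 : r * poissonWeight t k ≤ 1 := sqrt_succ_mul_poissonWeight_le_one ht k
  have h2 : r * poissonWeight t (k + 1) ≤ 1 := by
    refine le_trans (mul_le_mul_of_nonneg_right ?_ hw')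
      (sqrt_succ_mul_poissonWeight_le_one ht (k + 1))
    rw [hr]
    exact Real.sqrt_le_sqrt (by push_cast; linarith)
  have h3 := poissonWeight_succ t k
  rw [← hr2, ← hs2] at h3
  rw [hs2] at h3
  have h4 : (2 * r) * (√t * poissonWeight t k) ≤ 2 * r * 1 := by
    nlinarith [mul_nonneg (sq_nonneg (√t - r)) hw, mul_le_mul_of_nonneg_left h1 hr0.le,
      mul_le_mul_of_nonneg_left h2 hr0.le]
  exact le_of_mul_le_mul_left h4 (by positivity)

theorem choose_mul_pow_le {d : ℝ} (hd : 0 < d) {m i : ℕ} (hm : 1 ≤ m) (hi : i ≤ m) :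
    (m.choose i : ℝ) * d ^ (m - i) ≤
      Real.exp 1 / √d * (Real.exp (m * d) * poissonWeight m i) := by
  have hm' : (0 : ℝ) < m := by exact_mod_cast hm
  have h1 := factorial_le_mul_sqrt hm
  have h2 := sqrt_mul_poissonWeight_le_one (t := m * d) (by positivity) (m - i)
  rw [Nat.cast_choose ℝ hi]
  have hf : (0 : ℝ) < (m - i).factorial := by exact_mod_cast Nat.factorial_pos _
  have hf' : (0 : ℝ) < i.factorial := by exact_mod_cast Nat.factorial_pos _
  have hpow : (m : ℝ) ^ m = m ^ i * m ^ (m - i) := by rw [← pow_add, Nat.add_sub_cancel' hi]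
  have hexp : Real.exp 1 ^ m = Real.exp m := by rw [← Real.exp_nat_mul, mul_one]
  rw [div_pow, hexp, hpow] at h1
  rw [poissonWeight, Real.sqrt_mul hm'.le, mul_pow, Real.exp_neg] at h2
  rw [poissonWeight, Real.exp_neg]
  set E := Real.exp (m * d)
  set A := Real.exp (m : ℝ)
  have hE : 0 < E := Real.exp_pos _
  have hA : 0 < A := Real.exp_pos _
  have hD : 0 < √d := Real.sqrt_pos.2 hd
  have hS : 0 < √(m : ℝ) := Real.sqrt_pos.2 hm'
  have h3 : √(m : ℝ) * (m ^ (m - i) * d ^ (m - i)) ≤ E * (m - i).factorial / √d := by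
    rw [le_div_iff₀ hD]
    rw [← mul_div_assoc, div_le_one hf] at h2
    have := mul_le_mul_of_nonneg_left h2 hE.le
    calc _ = E * (√(m : ℝ) * √d * (E⁻¹ * (m ^ (m - i) * d ^ (m - i)))) := by field_simp
      _ ≤ _ := this
  calc (m.factorial : ℝ) / (i.factorial * (m - i).factorial) * d ^ (m - i)
      ≤ Real.exp 1 * √m * (m ^ i * m ^ (m - i) / A) / (i.factorial * (m - i).factorial) *
          d ^ (m - i) := by gcongr
    _ = Real.exp 1 * m ^ i / A / (i.factorial * (m - i).factorial) *
          (√m * (m ^ (m - i) * d ^ (m - i))) := by ring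
    _ ≤ Real.exp 1 * m ^ i / A / (i.factorial * (m - i).factorial) *
          (E * (m - i).factorial / √d) := by gcongr
    _ = _ := by field_simp

section Exponential

attribute [local instance] Matrix.linftyOpNormedRing Matrix.linftyOpNormedAlgebra

namespace BDChain
variable {n : ℕ}

theorem expKernel_smul_one_add (A : Matrix (Fin (n + 1)) (Fin (n + 1)) ℝ) (a t : ℝ) :
    expKernel (a • 1 + A) t = Real.exp (t * a) • expKernel A t := by
  have e : t • (a • 1 + A) =
      algebraMap ℝ (Matrix (Fin (n + 1)) (Fin (n + 1)) ℝ) (t * a) + t • A := by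
    rw [Algebra.algebraMap_eq_smul_one, smul_add, smul_smul]
  have e' : NormedSpace.exp (algebraMap ℝ (Matrix (Fin (n + 1)) (Fin (n + 1)) ℝ) (t * a)) =
      Real.exp (t * a) • 1 := by
    rw [Algebra.algebraMap_eq_smul_one, Matrix.smul_one_eq_diagonal, Matrix.exp_diagonal,
      Matrix.smul_one_eq_diagonal]
    congr 1
    funext i
    rw [Pi.coe_exp, Real.exp_eq_exp_ℝ]
  unfold expKernel
  rw [e, Matrix.exp_add_of_commute _ _ (Algebra.commute_algebraMap_left _ _), e', smul_one_mul,
    smul_comm]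

end BDChain
end Exponential

namespace BDChain
variable {n : ℕ}

theorem pow_apply_le_Ht (c : BDChain n) {d : ℝ} (hd : 0 < d) (hK : ∀ i, d ≤ c.K i i) {m : ℕ}
    (hm : 1 ≤ m) (x y : Fin (n + 1)) : (c.K ^ m) x y ≤ Real.exp 1 / √d * c.Ht m x y := by
  set L : Matrix (Fin (n + 1)) (Fin (n + 1)) ℝ := c.K - d • 1 with hL
  have hKL : c.K = d • 1 + L := by rw [hL, add_sub_cancel]
  have hL0 : ∀ i j, 0 ≤ L i j := by
    intro i j
    simp only [hL, Matrix.sub_apply, Matrix.smul_apply, Matrix.one_apply, smul_eq_mul]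
    split_ifs with h
    · subst h; linarith [hK i]
    · linarith [c.K_nonneg i j]
  have hLp : ∀ k i j, 0 ≤ (L ^ k) i j := by
    intro k
    induction k with
    | zero => intro i j; rw [pow_zero, Matrix.one_apply]; split_ifs <;> norm_num
    | succ k ih =>
      intro i j
      rw [pow_succ, Matrix.mul_apply]
      exact Finset.sum_nonneg fun z _ => mul_nonneg (ih i z) (hL0 z j)
  have h1 : (c.K ^ m) x y =
      ∑ i ∈ Finset.range (m + 1), (m.choose i : ℝ) * d ^ (m - i) * (L ^ i) x y := by
    have hcomm : Commute L (d • 1) := (Commute.one_right L).smul_right d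
    rw [hKL, add_comm (d • 1) L, hcomm.add_pow, Matrix.sum_apply]
    refine Finset.sum_congr rfl fun i _ => ?_
    rw [_root_.smul_pow, one_pow, mul_smul_comm, mul_one, ← nsmul_eq_mul', Matrix.smul_apply,
      Matrix.smul_apply, nsmul_eq_mul, smul_eq_mul]
    ring
  have h2 : Real.exp (m * d) * ∑ i ∈ Finset.range (m + 1), poissonWeight m i * (L ^ i) x y ≤
      c.Ht m x y := by
    rw [Ht_eq_exp, hKL, expKernel_smul_one_add, Matrix.smul_apply, smul_eq_mul]
    refine mul_le_mul_of_nonneg_left ?_ (Real.exp_pos _).le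
    exact sum_le_hasSum _ (fun i _ => mul_nonneg (poissonWeight_nonneg m.cast_nonneg i) (hLp i x y))
      (hasSum_expKernel L m x y)
  rw [h1]
  refine le_trans ?_ (mul_le_mul_of_nonneg_left h2 (by positivity))
  rw [← mul_assoc, Finset.mul_sum]
  refine Finset.sum_le_sum fun i hi => ?_
  have := mul_le_mul_of_nonneg_right
    (choose_mul_pow_le hd hm (Nat.lt_succ_iff.1 (Finset.mem_range.1 hi))) (hLp i x y)
  linarith

theorem mulVec_sub_apply (c : BDChain n) (g : Fin (n + 1) → ℝ) (x : Fin (n + 1)) :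
    (c.K *ᵥ g) x - g x = ∑ y, c.K x y * (g y - g x) := by
  simp only [mulVec_apply, mul_sub, Finset.sum_sub_distrib, ← Finset.sum_mul, c.K_rowSum, one_mul]

theorem sq_mulVec_sub_le (c : BDChain n) {d : ℝ} (hK : ∀ i, d ≤ c.K i i)
    (g : Fin (n + 1) → ℝ) (x : Fin (n + 1)) :
    ((c.K *ᵥ g) x - g x) ^ 2 ≤ (1 - d) * ∑ y, c.K x y * (g y - g x) ^ 2 := by
  have h1 : ∀ p, p ≠ 0 → ∑ y ∈ Finset.univ.erase x, c.K x y * (g y - g x) ^ p =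
      ∑ y, c.K x y * (g y - g x) ^ p := fun p hp => Finset.sum_erase _ (by simp [hp])
  have h2 : ∑ y ∈ Finset.univ.erase x, c.K x y ≤ 1 - d := by
    have := Finset.add_sum_erase Finset.univ (c.K x) (Finset.mem_univ x)
    rw [c.K_rowSum] at this
    linarith [hK x]
  have h3 := Finset.sum_sq_le_sum_mul_sum_of_sq_le_mul (Finset.univ.erase x) (f := c.K x)
    (g := fun y => c.K x y * (g y - g x) ^ 2) (r := fun y => c.K x y * (g y - g x))
    (fun y _ => c.K_nonneg x y) (fun y _ => mul_nonneg (c.K_nonneg x y) (sq_nonneg _))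
    (fun y _ => le_of_eq (by ring))
  have h4 := h1 1 one_ne_zero
  simp only [pow_one] at h4
  rw [h4, h1 2 two_ne_zero] at h3
  rw [mulVec_sub_apply]
  exact h3.trans (mul_le_mul_of_nonneg_right h2
    (Finset.sum_nonneg fun y _ => mul_nonneg (c.K_nonneg x y) (sq_nonneg _)))

theorem sum_mul_sum_sq_eq (c : BDChain n) (g : Fin (n + 1) → ℝ) :
    ∑ x, c.pi x * ∑ y, c.K x y * (g y - g x) ^ 2 = 2 * c.dirichlet g g := by
  have h1 : ∀ x, c.pi x * ∑ y, c.K x y * (g y - g x) ^ 2 =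
      c.pi x * (c.K *ᵥ (g * g)) x +
        (c.pi x * (g x * g x) - 2 * (c.pi x * (g x * (c.K *ᵥ g) x))) := by
    intro x
    have e : ∑ y, c.K x y * (g y - g x) ^ 2 =
        ∑ y, c.K x y * (g * g) y + (g x ^ 2 * ∑ y, c.K x y - 2 * g x * ∑ y, c.K x y * g y) := by
      rw [Finset.mul_sum, Finset.mul_sum, ← Finset.sum_sub_distrib, ← Finset.sum_add_distrib]
      exact Finset.sum_congr rfl fun y _ => by rw [Pi.mul_apply]; ring
    rw [e, c.K_rowSum, mulVec_apply, mulVec_apply]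
    ring
  simp only [h1, Finset.sum_add_distrib, Finset.sum_sub_distrib, ← Finset.mul_sum]
  have h2 := c.avg_mulVec (g * g)
  have h3 : c.dirichlet g g = c.avg (g * g) - c.avg (g * c.K *ᵥ g) := by
    rw [dirichlet, mul_sub, avg_sub]
  rw [h3]
  simp only [avg, Pi.mul_apply] at h2 ⊢
  rw [h2]
  ring

theorem avg_mulVec_mul_self_le (c : BDChain n) {d : ℝ} (hK : ∀ i, d ≤ c.K i i)
    (g : Fin (n + 1) → ℝ) :
    c.avg ((c.K *ᵥ g) * (c.K *ᵥ g)) ≤ c.avg (g * g) - 2 * d * c.dirichlet g g := by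
  have h1 : ∑ x, c.pi x * ((c.K *ᵥ g) x - g x) ^ 2 ≤ (1 - d) * (2 * c.dirichlet g g) := by
    rw [← sum_mul_sum_sq_eq, Finset.mul_sum]
    refine Finset.sum_le_sum fun x _ => ?_
    have := mul_le_mul_of_nonneg_left (c.sq_mulVec_sub_le hK g x) (c.pi_pos x).le
    linarith
  have h2 : c.avg ((c.K *ᵥ g) * (c.K *ᵥ g)) =
      ∑ x, c.pi x * ((c.K *ᵥ g) x - g x) ^ 2 + (c.avg (g * g) - 2 * c.dirichlet g g) := by
    simp only [avg, dirichlet, Pi.mul_apply, Pi.sub_apply, Finset.mul_sum,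
      ← Finset.sum_sub_distrib, ← Finset.sum_add_distrib]
    exact Finset.sum_congr rfl fun y _ => by ring
  linarith

theorem Controlled.avg_pow_mulVec_le {c : BDChain n} {M : ℕ} {s b : ℝ} (h : c.Controlled M s b)
    {d : ℝ} (hd : 0 < d) (hK : ∀ i, d ≤ c.K i i) {g : Fin (n + 1) → ℝ} (hg : c.avg g = 0) (u : ℕ) :
    c.avg ((c.K ^ u *ᵥ g) * (c.K ^ u *ᵥ g)) ≤ Real.exp (-(d / (2 * b)) * u) * c.avg (g * g) ∧
      c.avg (c.K ^ u *ᵥ g) = 0 := by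
  have hb := h.pos
  induction u with
  | zero => simp [hg]
  | succ u ih =>
    rw [pow_succ', ← Matrix.mulVec_mulVec]
    refine ⟨?_, by rw [avg_mulVec, ih.2]⟩
    set f := c.K ^ u *ᵥ g
    have h1 := c.avg_mulVec_mul_self_le hK f
    have h2 := h.one_le_mul_dirichlet ih.2
    have h3 : c.avg (f * f) / (4 * b) ≤ c.dirichlet f f := by
      rw [div_le_iff₀ (by positivity)]; linarith
    have h4 : 0 ≤ c.avg (f * f) :=
      Finset.sum_nonneg fun y _ => mul_nonneg (c.pi_pos y).le (mul_self_nonneg _)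
    have h5 := Real.add_one_le_exp (-(d / (2 * b)))
    calc _ ≤ c.avg (f * f) - 2 * d * c.dirichlet f f := h1
      _ ≤ c.avg (f * f) - 2 * d * (c.avg (f * f) / (4 * b)) := by gcongr
      _ = (-(d / (2 * b)) + 1) * c.avg (f * f) := by field_simp; ring
      _ ≤ Real.exp (-(d / (2 * b))) * c.avg (f * f) := by gcongr
      _ ≤ Real.exp (-(d / (2 * b))) * (Real.exp (-(d / (2 * b)) * u) * c.avg (g * g)) := by
        gcongr; exact ih.1
      _ = _ := by
        rw [← mul_assoc, ← Real.exp_add]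
        push_cast
        congr 2; ring

theorem avg_abs_le (c : BDChain n) {g : Fin (n + 1) → ℝ} {r : ℝ} (hr : 0 ≤ r)
    (h : c.avg (g * g) ≤ r ^ 2) : c.avg (fun y => |g y|) ≤ r := by
  have h1 := c.avg_mul_self_sub (fun y => |g y|) (c.avg fun y => |g y|)
  have h2 : (fun y => |g y|) * (fun y => |g y|) = g * g := by
    funext y; simp
  rw [h2] at h1
  have h4 : 0 ≤ c.avg (((fun y => |g y|) - fun _ => c.avg fun y => |g y|) *
      ((fun y => |g y|) - fun _ => c.avg fun y => |g y|)) :=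
    Finset.sum_nonneg fun y _ => mul_nonneg (c.pi_pos y).le (mul_self_nonneg _)
  exact abs_le_of_sq_le_sq' (by nlinarith) hr |>.2

theorem Controlled.dTV_add_le {c : BDChain n} {M : ℕ} {s b : ℝ} (h : c.Controlled M s b)
    {d : ℝ} (hd : 0 < d) (hK : ∀ i, d ≤ c.K i i) {m : ℕ} (hm : 1 ≤ m) (u : ℕ) (x : Fin (n + 1)) :
    c.dTV x (m + u) ≤ Real.exp 1 / √d * (Real.exp (-(d / (4 * b)) * u) + c.dTVC x m) := by
  have hb := h.pos
  refine tv_le fun A => ?_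
  set f : Fin (n + 1) → ℝ := fun y => if y ∈ A then 1 else 0 with hf
  set a := c.avg f with ha
  have hf01 : ∀ y, f y ∈ Set.Icc (0 : ℝ) 1 := fun y => by
    simp only [hf]; split_ifs <;> norm_num
  have ha0 : 0 ≤ a := Finset.sum_nonneg fun y _ => mul_nonneg (c.pi_pos y).le (hf01 y).1
  have ha1 : a ≤ 1 := by
    rw [← c.avg_const 1]; exact c.avg_mono fun y => (hf01 y).2
  set g := c.K ^ u *ᵥ (f - fun _ => a) with hg
  have hgavg : c.avg (f - fun _ => a) = 0 := by rw [avg_sub, avg_const, ← ha, sub_self]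
  have hconst : ∀ k : ℕ, c.K ^ k *ᵥ (fun _ => a) = fun _ => a := by
    intro k; funext z
    rw [Matrix.mulVec, dotProduct, ← Finset.sum_mul, c.pow_rowSum, one_mul]
  have hgabs : ∀ y, |g y| ≤ 1 := by
    intro y
    have h1 := c.iterate_act_mem (F := extend f) (fun k _ => extend_mem hf01 k) u (x := y)
      (by omega)
    rw [c.iterate_act] at h1
    simp only [extend_coe] at h1
    have h2 : g y = ∑ z, (c.K ^ u) y z * f z - a := by
      rw [hg, Matrix.mulVec_sub, hconst]; rfl
    rw [h2, abs_le]
    constructor <;> linarith [h1.1, h1.2]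
  have hE : ∑ y ∈ A, (c.K ^ (m + u)) x y - ∑ y ∈ A, c.pi y = ∑ z, (c.K ^ m) x z * g z := by
    have h1 : (c.K ^ m *ᵥ g) x = (c.K ^ (m + u) *ᵥ f) x - a := by
      rw [hg, Matrix.mulVec_mulVec, ← pow_add, Matrix.mulVec_sub, hconst]; rfl
    have h2 : (c.K ^ m *ᵥ g) x = ∑ z, (c.K ^ m) x z * g z := rfl
    rw [← h2, h1, ha]
    simp [Matrix.mulVec, dotProduct, avg, hf, Finset.sum_ite_mem]
  rw [hE]
  have hT : ∑ z, c.Ht m x z * |g z| ≤ Real.exp (-(d / (4 * b)) * u) + c.dTVC x m := by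
    have h1 := sum_sub_mul_le_tv (c.Ht m x) c.pi (g := fun z => |g z|) (fun z => abs_nonneg _) hgabs
    simp only [sub_mul, Finset.sum_sub_distrib] at h1
    have h2 : c.avg (fun z => |g z|) ≤ Real.exp (-(d / (4 * b)) * u) := by
      refine c.avg_abs_le (Real.exp_pos _).le ?_
      refine (h.avg_pow_mulVec_le hd hK hgavg u).1.trans ?_
      have h3 : c.avg ((f - fun _ => a) * (f - fun _ => a)) ≤ 1 := by
        rw [← c.avg_const 1]
        refine c.avg_mono fun y => ?_
        have h5 := hf01 y
        simp only [Pi.mul_apply, Pi.sub_apply]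
        have : |f y - a| ≤ 1 := by rw [abs_le]; constructor <;> linarith [h5.1, h5.2]
        rw [← abs_mul_abs_self]
        nlinarith [abs_nonneg (f y - a)]
      have h4 : Real.exp (-(d / (4 * b)) * u) ^ 2 = Real.exp (-(d / (2 * b)) * u) := by
        rw [sq, ← Real.exp_add]; congr 1; field_simp; ring
      rw [h4]
      exact mul_le_of_le_one_right (Real.exp_pos _).le h3
    rw [dTVC_eq_tv]
    rw [avg] at h2
    linarith
  refine le_trans ?_ (mul_le_mul_of_nonneg_left hT (by positivity))
  rw [Finset.mul_sum]
  refine Finset.sum_le_sum fun z _ => ?_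
  have hp : 0 ≤ (c.K ^ m) x z := by
    have := c.iterate_act_mem (F := extend fun w => if w = z then 1 else 0)
      (fun w _ => extend_mem (fun w => by split_ifs <;> norm_num) w) m (x := x) (by omega)
    rw [c.iterate_act] at this
    simpa [extend_coe] using this.1
  calc (c.K ^ m) x z * g z ≤ (c.K ^ m) x z * |g z| :=
        mul_le_mul_of_nonneg_left (le_abs_self _) hp
    _ ≤ (Real.exp 1 / √d * c.Ht m x z) * |g z| :=
        mul_le_mul_of_nonneg_right (c.pow_apply_le_Ht hd hK hm x z) (abs_nonneg _)
    _ = _ := by ring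

end BDChain

namespace BDChain
variable {n : ℕ}

/-- The state `0` maximizes the mean hitting time `s` of `M`, the number `b` is the maximal
standard deviation, and both sides of `M` have stationary mass at least `κ`. -/
structure Balanced (c : BDChain n) (M : ℕ) (s b κ : ℝ) : Prop extends c.Controlled M s b where
  mean_eq : c.upMean M 0 = s
  var_eq : b ^ 2 = max (c.upVar M 0) (c.rev.upVar (n - M) 0)
  le_cum : κ ≤ c.cum M
  le_rev_cum : κ ≤ c.rev.cum (n - M)

theorem dTVMaxC_rev (c : BDChain n) (t : ℝ) : c.rev.dTVMaxC t = c.dTVMaxC t := by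
  simp only [dTVMaxC, dTVC_rev]
  exact Fin.revPerm.iSup_comp (g := fun x => c.dTVC x t)

theorem dTVMax_rev (c : BDChain n) (m : ℕ) : c.rev.dTVMax m = c.dTVMax m := by
  simp only [dTVMax, dTV_rev]
  exact Fin.revPerm.iSup_comp (g := fun x => c.dTV x m)

theorem hitMeanC_zero (c : BDChain n) (M : Fin (n + 1)) : c.hitMeanC M 0 = c.upMean M 0 :=
  c.hitMeanC_eq (Fin.zero_le M)

theorem hitVarC_zero (c : BDChain n) (M : Fin (n + 1)) : c.hitVarC M 0 = c.upVar M 0 :=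
  c.hitVarC_eq (Fin.zero_le M)

theorem val_rev_eq (M : Fin (n + 1)) : ((M.rev : Fin (n + 1)) : ℕ) = n - M := by
  rw [Fin.val_rev]; omega

theorem hitMeanC_last (c : BDChain n) (M : Fin (n + 1)) :
    c.hitMeanC M (Fin.last n) = c.rev.upMean (n - M) 0 := by
  rw [← hitMeanC_rev, Fin.rev_last, hitMeanC_zero, val_rev_eq]

theorem hitVarC_last (c : BDChain n) (M : Fin (n + 1)) :
    c.hitVarC M (Fin.last n) = c.rev.upVar (n - M) 0 := by
  rw [← hitVarC_rev, Fin.rev_last, hitVarC_zero, val_rev_eq]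

theorem balanced_of_eq (c : BDChain n) (hn : 1 ≤ n) {M : ℕ} (hM : M ≤ n) {s b κ : ℝ} (hb : 0 ≤ b)
    (hs : max (c.upMean M 0) (c.rev.upMean (n - M) 0) = s)
    (hs' : c.upMean M 0 = s) (hb' : b ^ 2 = max (c.upVar M 0) (c.rev.upVar (n - M) 0))
    (h1 : κ ≤ c.cum M) (h2 : κ ≤ c.rev.cum (n - M)) : c.Balanced M s b κ where
  le_n := hM
  half_le := by
    have l1 := c.sub_le_upMean hM 0
    have l2 := c.upMean_le_upVar hM 0
    have l3 := c.rev.sub_le_upMean (Nat.sub_le n M) 0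
    have l4 := c.rev.upMean_le_upVar (Nat.sub_le n M) 0
    have l5 := le_max_left (c.upVar M 0) (c.rev.upVar (n - M) 0)
    have l6 := le_max_right (c.upVar M 0) (c.rev.upVar (n - M) 0)
    rw [Nat.cast_sub hM] at l3
    have : (1 : ℝ) ≤ n := by exact_mod_cast hn
    rw [← hb'] at l5 l6
    push_cast at l1 l3
    by_contra! hlt
    nlinarith
  mean_left := hs'.le
  mean_right := hs ▸ le_max_right _ _
  var_left := hb' ▸ le_max_left _ _
  var_right := hb' ▸ le_max_right _ _
  mean_eq := hs'
  var_eq := hb'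
  le_cum := h1
  le_rev_cum := h2

theorem exists_balanced (c : BDChain n) (hn : 1 ≤ n) (M x : Fin (n + 1)) {b κ : ℝ}
    (hx : (x = 0 ∨ x = Fin.last n) ∧
      max (c.hitMeanC M 0) (c.hitMeanC M (Fin.last n)) = c.hitMeanC M x)
    (hb : b = Real.sqrt (max (c.hitVarC M 0) (c.hitVarC M (Fin.last n))))
    (h1 : κ ≤ c.piLow M) (h2 : κ ≤ c.piHigh M) :
    ∃ (e : BDChain n) (N : ℕ), e.Balanced N (c.hitMeanC M x) b κ ∧ e.dTV 0 = c.dTV x ∧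
      e.dTVC 0 = c.dTVC x ∧ e.dTVMax = c.dTVMax ∧ e.dTVMaxC = c.dTVMaxC ∧
      ∀ i, ∃ j, e.K i i = c.K j j := by
  obtain ⟨hx, hmax⟩ := hx
  have hM : (M : ℕ) ≤ n := by omega
  have hb0 : 0 ≤ b := hb ▸ Real.sqrt_nonneg _
  have hb2 : b ^ 2 = max (c.upVar M 0) (c.rev.upVar (n - M) 0) := by
    rw [hb, Real.sq_sqrt, hitVarC_zero, hitVarC_last]
    rw [hitVarC_zero]
    exact le_max_of_le_left (c.upVar_nonneg M 0)
  rw [hitMeanC_zero, hitMeanC_last] at hmax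
  rw [piLow_eq] at h1
  rw [piHigh_eq] at h2
  rcases hx with rfl | rfl
  · exact ⟨c, M, c.balanced_of_eq hn hM hb0 hmax (c.hitMeanC_zero M).symm hb2 h1 h2, rfl, rfl, rfl,
      rfl, fun i => ⟨i, rfl⟩⟩
  · have hN : n - (n - (M : ℕ)) = M := Nat.sub_sub_self hM
    refine ⟨c.rev, n - M, c.rev.balanced_of_eq hn (Nat.sub_le _ _) hb0 ?_
      (c.hitMeanC_last M).symm ?_ h2 ?_, ?_, ?_, ?_, ?_, fun i => ⟨i.rev, rfl⟩⟩
    · rw [rev_rev, hN, max_comm, hmax]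
    · rw [rev_rev, hN, max_comm, hb2]
    · rwa [rev_rev, hN]
    · funext m; rw [dTV_rev, Fin.rev_zero]
    · funext t; rw [dTVC_rev, Fin.rev_zero]
    · funext m; rw [dTVMax_rev]
    · funext t; rw [dTVMaxC_rev]

namespace Controlled

variable {c : BDChain n} {M : ℕ} {s b : ℝ}

theorem mean_nonneg (h : c.Controlled M s b) : 0 ≤ s := (c.upMean_nonneg M 0).trans h.mean_left

theorem le_two_mul_mean (h : c.Controlled M s b) : (n : ℝ) ≤ 2 * s := by
  have l1 := c.sub_le_upMean h.le_n 0
  have l3 := c.rev.sub_le_upMean (Nat.sub_le n M) 0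
  rw [Nat.cast_sub h.le_n] at l3
  push_cast at l1 l3
  linarith [h.mean_left, h.mean_right]

theorem dTVMaxC_le (h : c.Controlled M s b) {η t : ℝ} (h0 : 0 < η) (h1 : η ≤ 1)
    (ht : s + (1 / η + 100 / η ^ 2) * b ≤ t) : c.dTVMaxC t ≤ 6 * η :=
  ciSup_le fun x => h.dTVC_le h0 h1 ht x

theorem exists_eigenfunction_pos (h : c.Controlled M s b) (hn : 0 < n) :
    ∃ (l : ℝ) (f : Fin (n + 1) → ℝ), 0 < l ∧ f ≠ 0 ∧ c.avg f = 0 ∧ c.K *ᵥ f = (1 - l) • f ∧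
      ∀ g, l * (c.avg (g * g) - c.avg g ^ 2) ≤ c.dirichlet g g := by
  obtain ⟨l, f, hf1, hf0, hKf, hfl, hl⟩ := c.exists_eigenfunction hn
  refine ⟨l, f, ?_, ?_, hf0, hKf, hl⟩
  · have := h.one_le_mul_dirichlet hf0
    rw [hf1, hfl] at this
    have hb := h.pos
    by_contra! hneg
    nlinarith
  · rintro rfl
    simp [avg] at hf1

theorem upVar_mul_log_le_of_dTVMaxC (h : c.Controlled M s b) (hn : 0 < n) {κ : ℝ} (h0 : 0 < κ)
    (hκ : κ ≤ c.rev.cum (n - M)) {ε t : ℝ} (hε : 0 < ε) (ht : 0 ≤ t) (hd : c.dTVMaxC t ≤ ε) :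
    c.upVar M 0 * Real.log (1 / (2 * ε)) ≤ 2 / κ * s * t := by
  obtain ⟨l, f, hl0, hf, hf0, hKf, hl⟩ := h.exists_eigenfunction_pos hn
  have h1 := (c.exp_le_two_mul_dTVMaxC hf hf0 hKf ht).trans
    (mul_le_mul_of_nonneg_left hd zero_le_two)
  have h2 : Real.log (1 / (2 * ε)) ≤ l * t := by
    have := (Real.le_log_iff_exp_le (by positivity)).2 h1
    rw [one_div, Real.log_inv]
    linarith
  have h3 := c.gap_mul_upVar_le hl hl0 h.le_n h0 hκ
  have h4 := h.mean_left
  have hv := c.upVar_nonneg M 0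
  calc c.upVar M 0 * Real.log (1 / (2 * ε)) ≤ c.upVar M 0 * (l * t) := by gcongr
    _ = l * κ * c.upVar M 0 * t / κ := by field_simp
    _ ≤ 2 * s * t / κ :=
      div_le_div_of_nonneg_right (mul_le_mul_of_nonneg_right (by linarith) ht) h0.le
    _ = _ := by ring

theorem upVar_mul_log_le_of_dTVMax (h : c.Controlled M s b) (hn : 0 < n) {κ : ℝ} (h0 : 0 < κ)
    (hκ : κ ≤ c.rev.cum (n - M)) :
    c.upVar M 0 ≤ 4 / κ * s ∨ ∀ (ε : ℝ) (m : ℕ), 0 < ε → c.dTVMax m ≤ ε →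
      c.upVar M 0 * Real.log (1 / (2 * ε)) ≤ 4 / κ * s * m := by
  obtain ⟨l, f, hl0, hf, hf0, hKf, hl⟩ := h.exists_eigenfunction_pos hn
  have h3 := c.gap_mul_upVar_le hl hl0 h.le_n h0 hκ
  have h4 := h.mean_left
  have hv := c.upVar_nonneg M 0
  rcases le_or_gt l (1 / 2) with hle | hlt
  · right
    intro ε m hε hd
    have h1 := (c.abs_one_sub_pow_le hf hf0 hKf m).trans
      (mul_le_mul_of_nonneg_left hd zero_le_two)
    have h2 : Real.log (1 / (2 * ε)) ≤ 2 * l * m := by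
      have h5 := Real.log_le_log
        (by rw [abs_of_pos (by linarith)]; exact pow_pos (by linarith) m) h1
      rw [Real.log_pow, Real.log_abs] at h5
      have h6 := Real.one_sub_inv_le_log_of_pos (show 0 < 1 - l by linarith)
      have h7 : -(2 * l) ≤ 1 - (1 - l)⁻¹ := by
        have : (1 - l)⁻¹ ≤ 1 + 2 * l := by
          rw [inv_le_iff_one_le_mul₀ (by linarith)]
          nlinarith
        linarith
      have h8 := mul_le_mul_of_nonneg_left (h7.trans h6) (Nat.cast_nonneg (α := ℝ) m)
      rw [one_div, Real.log_inv]
      linarith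
    calc c.upVar M 0 * Real.log (1 / (2 * ε)) ≤ c.upVar M 0 * (2 * l * m) := by gcongr
      _ = 2 * (l * κ * c.upVar M 0) * m / κ := by field_simp
      _ ≤ 2 * (2 * s) * m / κ :=
        div_le_div_of_nonneg_right (mul_le_mul_of_nonneg_right (by linarith) m.cast_nonneg) h0.le
      _ = _ := by ring
  · left
    rw [div_mul_eq_mul_div, le_div_iff₀ h0]
    have : 0 ≤ κ * c.upVar M 0 := by positivity
    nlinarith

end Controlled

namespace Balanced

variable {c : BDChain n} {M : ℕ} {s b κ : ℝ}

theorem le_two_mul_mean (h : c.Balanced M s b κ) : b ≤ 2 * s := by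
  have h1 := c.upVar_le_two_mul_sq M
  have h2 := c.rev.upVar_le_two_mul_sq (n - M)
  have hs := h.mean_nonneg
  have h3 : b ^ 2 ≤ 2 * s ^ 2 := by
    rw [h.var_eq]
    refine max_le (h1.trans ?_) (h2.trans ?_)
    · rw [h.mean_eq]
    · have := pow_le_pow_left₀ (c.rev.upMean_nonneg (n - M) 0) h.mean_right 2
      linarith
  nlinarith

theorem sq_mul_log_le_of_dTVMaxC (h : c.Balanced M s b κ) (hn : 0 < n) (h0 : 0 < κ)
    {ε t : ℝ} (hε : 0 < ε) (ht : 0 ≤ t) (hd : c.dTVMaxC t ≤ ε) :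
    b ^ 2 * Real.log (1 / (2 * ε)) ≤ 2 / κ * s * t := by
  rw [h.var_eq]
  rcases max_choice (c.upVar M 0) (c.rev.upVar (n - M) 0) with e | e <;> rw [e]
  · exact h.upVar_mul_log_le_of_dTVMaxC hn h0 h.le_rev_cum hε ht hd
  · refine h.rev.upVar_mul_log_le_of_dTVMaxC hn h0 ?_ hε ht (by rwa [dTVMaxC_rev])
    rw [rev_rev, Nat.sub_sub_self h.le_n]
    exact h.le_cum

theorem sq_mul_log_le_of_dTVMax (h : c.Balanced M s b κ) (hn : 0 < n) (h0 : 0 < κ) :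
    b ^ 2 ≤ 4 / κ * s ∨ ∀ (ε : ℝ) (m : ℕ), 0 < ε → c.dTVMax m ≤ ε →
      b ^ 2 * Real.log (1 / (2 * ε)) ≤ 4 / κ * s * m := by
  rw [h.var_eq]
  rcases max_choice (c.upVar M 0) (c.rev.upVar (n - M) 0) with e | e <;> rw [e]
  · exact h.upVar_mul_log_le_of_dTVMax hn h0 h.le_rev_cum
  · simp only [← c.dTVMax_rev]
    refine h.rev.upVar_mul_log_le_of_dTVMax hn h0 ?_
    rw [rev_rev, Nat.sub_sub_self h.le_n]
    exact h.le_cum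

end Balanced

end BDChain

theorem bddBelow_mixC (d : ℝ → ℝ) (ε : ℝ) : BddBelow {t : ℝ | 0 ≤ t ∧ d t ≤ ε} :=
  ⟨0, fun _ h => h.1⟩

namespace BDChain

/-- An upper bound for the normalized deviation of the mixing time at level `ε` above the mean. -/
def upperConst (ε : ℝ) : ℝ := 1 / (ε / 6) + 100 / (ε / 6) ^ 2

/-- An upper bound for the normalized deviation of the mixing time at level `ε` below the mean. -/
def lowerConst (κ ε : ℝ) : ℝ := 2 / (1 - ε) + 1 / min κ ((1 - ε) / 4)

variable {n : ℕ}

namespace Balanced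

variable {c : BDChain n} {M : ℕ} {s b κ : ℝ}

theorem dTVMaxC_le_of_mem (h : c.Balanced M s b κ) {ε : ℝ} (hε : ε ∈ Set.Ioo (0 : ℝ) 1) :
    s + upperConst ε * b ∈ {t : ℝ | 0 ≤ t ∧ c.dTVMaxC t ≤ ε} := by
  obtain ⟨h0, h1⟩ := hε
  constructor
  · have := h.mean_nonneg
    have := h.pos
    unfold upperConst
    positivity
  · have := h.dTVMaxC_le (η := ε / 6) (by linarith) (by linarith) le_rfl
    unfold upperConst
    linarith

theorem mixC_dTVMaxC_le (h : c.Balanced M s b κ) {ε : ℝ} (hε : ε ∈ Set.Ioo (0 : ℝ) 1) :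
    mixC c.dTVMaxC ε ≤ s + upperConst ε * b :=
  csInf_le (bddBelow_mixC _ _) (h.dTVMaxC_le_of_mem hε)

theorem mixC_dTVC_le (h : c.Balanced M s b κ) {ε : ℝ} (hε : ε ∈ Set.Ioo (0 : ℝ) 1)
    (x : Fin (n + 1)) : mixC (c.dTVC x) ε ≤ mixC c.dTVMaxC ε :=
  csInf_le_csInf (bddBelow_mixC _ _) ⟨_, h.dTVMaxC_le_of_mem hε⟩
    fun t ht => ⟨ht.1, (c.le_dTVMaxC x t).trans ht.2⟩

theorem lt_one_sub (κ : ℝ) {ε : ℝ} (hε : ε ∈ Set.Ioo (0 : ℝ) 1) :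
    ε < 1 - 1 / (2 / (1 - ε)) ^ 2 - min κ ((1 - ε) / 4) := by
  obtain ⟨h0, h1⟩ := hε
  have h2 := min_le_right κ ((1 - ε) / 4)
  have h3 : 1 / (2 / (1 - ε)) ^ 2 = (1 - ε) ^ 2 / 4 := by
    have : 1 - ε ≠ 0 := by linarith
    field_simp
    norm_num
  rw [h3]
  nlinarith

theorem mean_sub_le_mixC (h : c.Balanced M s b κ) (hκ : 0 < κ) {ε : ℝ}
    (hε : ε ∈ Set.Ioo (0 : ℝ) 1) : s - lowerConst κ ε * b ≤ mixC (c.dTVC 0) ε := by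
  have h1 : 0 < 1 - ε := by linarith [hε.2]
  refine le_csInf ⟨s + upperConst ε * b, (h.dTVMaxC_le_of_mem hε).1,
    (c.le_dTVMaxC 0 _).trans (h.dTVMaxC_le_of_mem hε).2⟩ fun t ⟨ht0, ht⟩ => ?_
  by_contra! hlt
  refine absurd (c.le_dTVC h.le_n ht0 h.pos h.var_left (lt_min hκ (by linarith : 0 < (1 - ε) / 4))
    ((min_le_left _ _).trans h.le_cum) (D := 2 / (1 - ε)) (by positivity) ?_)
    (not_le.2 (ht.trans_lt (lt_one_sub κ hε)))
  rw [h.mean_eq]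
  unfold lowerConst at hlt
  rw [add_mul, one_div_mul_eq_div] at hlt
  linarith

theorem sq_mul_log_le_mixC (h : c.Balanced M s b κ) (hn : 0 < n) (hκ : 0 < κ) {ε : ℝ}
    (hε : ε ∈ Set.Ioo (0 : ℝ) 1) :
    b ^ 2 * Real.log (1 / (2 * ε)) ≤ 4 / κ * s * mixC c.dTVMaxC ε := by
  have hs : 0 < s := by
    have h1 := h.le_two_mul_mean
    have h2 := h.pos
    linarith
  have hA : 0 < 4 / κ * s := by positivity
  rw [← div_le_iff₀' hA]
  refine le_csInf ⟨_, h.dTVMaxC_le_of_mem hε⟩ fun t ⟨ht0, ht⟩ => ?_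
  rw [div_le_iff₀' hA]
  have h3 : 2 / κ * s * t ≤ 4 / κ * s * t := by
    have : 2 / κ ≤ 4 / κ := by gcongr; norm_num
    gcongr
  exact (h.sq_mul_log_le_of_dTVMaxC hn hκ hε.1 ht0 ht).trans h3

theorem exists_dTVMax_le {δ : ℝ} (hδ : 0 < δ) {ε : ℝ} (hε : 0 < ε) :
    ∃ C : ℝ, ∀ (n : ℕ) (c : BDChain n) (M : ℕ) (s b κ : ℝ), c.Balanced M s b κ →
      (∀ i, δ ≤ c.K i i) → ∃ m : ℕ, m ≤ s + C * b ∧ c.dTVMax m ≤ ε := by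
  set K := Real.exp 1 / √δ with hKdef
  have hK : 0 < K := by positivity
  set η := min 1 (ε / (12 * K)) with hη
  have hη0 : 0 < η := lt_min one_pos (by positivity)
  set A := 1 / η + 100 / η ^ 2 with hA
  have hA0 : 0 < A := by positivity
  set B := max 0 (4 / δ * Real.log (2 * K / ε)) with hB
  have hB0 : 0 ≤ B := le_max_left _ _
  refine ⟨A + B + 4, fun n c M s b κ h hc => ?_⟩
  have hb := h.half_le
  have hb0 := h.pos
  have hs := h.mean_nonneg
  have hm0 : 0 < s + A * b := by positivity
  have hm1 := Nat.le_ceil (s + A * b)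
  have hm2 := (Nat.ceil_lt_add_one hm0.le).le
  have hu1 := Nat.le_ceil (B * b)
  have hu2 := (Nat.ceil_lt_add_one (a := B * b) (by positivity)).le
  refine ⟨⌈s + A * b⌉₊ + ⌈B * b⌉₊, ?_, ciSup_le fun x => ?_⟩
  · push_cast
    linarith
  · refine (h.dTV_add_le hδ hc (Nat.one_le_ceil_iff.2 hm0) ⌈B * b⌉₊ x).trans ?_
    rw [← hKdef]
    have h1 : c.dTVC x (⌈s + A * b⌉₊ : ℕ) ≤ ε / (2 * K) := by
      refine (c.le_dTVMaxC x _).trans ((h.dTVMaxC_le hη0 (min_le_left _ _) hm1).trans ?_)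
      calc 6 * η ≤ 6 * (ε / (12 * K)) := by gcongr; exact min_le_right _ _
        _ = ε / (2 * K) := by field_simp; norm_num
    have h2 : Real.exp (-(δ / (4 * b)) * ⌈B * b⌉₊) ≤ ε / (2 * K) := by
      rw [← Real.le_log_iff_exp_le (by positivity)]
      have h3 : Real.log (2 * K / ε) ≤ δ / 4 * B := by
        calc Real.log (2 * K / ε) = δ / 4 * (4 / δ * Real.log (2 * K / ε)) := by field_simp
          _ ≤ δ / 4 * B := by gcongr; exact le_max_right _ _
      have h4 : δ / 4 * B ≤ δ / (4 * b) * ⌈B * b⌉₊ := by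
        calc δ / 4 * B = δ / (4 * b) * (B * b) := by field_simp
          _ ≤ _ := by gcongr
      rw [← inv_div (2 * K) ε, Real.log_inv]
      linarith
    calc K * (Real.exp (-(δ / (4 * b)) * ⌈B * b⌉₊) + c.dTVC x (⌈s + A * b⌉₊ : ℕ))
        ≤ K * (ε / (2 * K) + ε / (2 * K)) := by gcongr
      _ = ε := by field_simp; norm_num

theorem mean_sub_le_of_dTV_le (h : c.Balanced M s b κ) (hκ : 0 < κ) {ε : ℝ}
    (hε : ε ∈ Set.Ioo (0 : ℝ) 1) {m : ℕ} (hm : c.dTV 0 m ≤ ε) :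
    s - lowerConst κ ε * b ≤ m := by
  have h1 : 0 < 1 - ε := by linarith [hε.2]
  by_contra! hlt
  refine absurd (c.le_dTV h.le_n h.pos h.var_left (lt_min hκ (by linarith : 0 < (1 - ε) / 4))
    ((min_le_left _ _).trans h.le_cum) (D := 2 / (1 - ε)) (m := m) (by positivity) ?_)
    (not_le.2 (hm.trans_lt (lt_one_sub κ hε)))
  rw [h.mean_eq]
  unfold lowerConst at hlt
  rw [add_mul, one_div_mul_eq_div] at hlt
  linarith

end Balanced

end BDChain

theorem tendsto_div_nhds_one {T s b : ℕ → ℝ} {C : ℝ} (hs : ∀ n, 1 ≤ n → 0 < s n)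
    (hT : ∀ n, 1 ≤ n → |T n - s n| ≤ C * b n)
    (hb : Tendsto (fun n => b n / s n) atTop (nhds 0)) :
    Tendsto (fun n => T n / s n) atTop (nhds 1) := by
  rw [tendsto_iff_norm_sub_tendsto_zero]
  refine squeeze_zero' (.of_forall fun _ => norm_nonneg _) ?_ (by simpa using hb.const_mul C)
  filter_upwards [eventually_ge_atTop 1] with n hn
  have h := hs n hn
  rw [Real.norm_eq_abs, div_sub_one h.ne', abs_div, abs_of_pos h, ← mul_div_assoc]
  exact div_le_div_of_nonneg_right (hT n hn) h.le

/-- A maximal cutoff at `t` forces the window of size `b` to be negligible with respect to the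
mean `s`, as soon as the mixing times dominate `b ^ 2 / s` uniformly. -/
theorem tendsto_window_div_mean {Tm : ℝ → ℕ → ℝ} {s b t : ℕ → ℝ} {A : ℝ} (hA : 0 ≤ A)
    (hsn : ∀ n : ℕ, 1 ≤ n → (n : ℝ) ≤ 2 * s n) (hb0 : ∀ n, 1 ≤ n → 0 < b n)
    (hbs : ∀ n, 1 ≤ n → b n ≤ 2 * s n)
    (hU : ∃ C, ∀ n, 1 ≤ n → Tm (1 / 2) n ≤ s n + C * b n)
    (hG : ∀ n, 1 ≤ n → b n ^ 2 ≤ A * s n ∨ ∀ ε ∈ Set.Ioo (0 : ℝ) 1,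
      b n ^ 2 * Real.log (1 / (2 * ε)) ≤ A * s n * Tm ε n)
    (ht : ∀ n, 0 < t n) (hcut : cutoffWith Tm t) :
    Tendsto (fun n => b n / s n) atTop (nhds 0) := by
  obtain ⟨C, hC⟩ := hU
  set D := 1 + 2 * |C| with hD
  have hD0 : 0 < D := by positivity
  have hs : ∀ n, 1 ≤ n → 0 < s n := fun n hn => by linarith [hb0 n hn, hbs n hn]
  have hTD : ∀ n, 1 ≤ n → Tm (1 / 2) n ≤ D * s n := fun n hn => by
    have h1 : C * b n ≤ |C| * (2 * s n) := by
      have := hb0 n hn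
      exact mul_le_mul (le_abs_self C) (hbs n hn) this.le (abs_nonneg C)
    linarith [hC n hn]
  rw [Metric.tendsto_atTop']
  intro η hη
  suffices h : ∀ᶠ n in atTop, b n ≤ η / 2 * s n by
    obtain ⟨N, hN⟩ := eventually_atTop.1 (h.and (eventually_ge_atTop 1))
    refine ⟨N, fun n hn => ?_⟩
    obtain ⟨h1, h2⟩ := hN n hn.le
    rw [Real.dist_eq, sub_zero, abs_of_pos (div_pos (hb0 n h2) (hs n h2)), div_lt_iff₀ (hs n h2)]
    nlinarith [hs n h2]
  set R := A * (4 * D) / (η / 2) ^ 2 + 1 with hR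
  have hR0 : 0 < R := by positivity
  have hε : Real.exp (-R) / 2 ∈ Set.Ioo (0 : ℝ) 1 :=
    ⟨by positivity, by linarith [Real.exp_le_one_iff.2 (neg_nonpos.2 hR0.le)]⟩
  have hlog : Real.log (1 / (2 * (Real.exp (-R) / 2))) = R := by
    rw [mul_div_cancel₀ _ (two_ne_zero), one_div, ← Real.exp_neg, neg_neg, Real.log_exp]
  filter_upwards [eventually_ge_atTop 1,
    (hcut _ hε).eventually_le_const (show (1 : ℝ) < 2 by norm_num),
    (hcut (1 / 2) (by norm_num)).eventually_const_le (show (1 / 2 : ℝ) < 1 by norm_num),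
    tendsto_natCast_atTop_atTop.eventually_ge_atTop (2 * A / (η / 2) ^ 2)] with n hn h1 h2 h3
  have hsn0 := hs n hn
  have htn := ht n
  rw [div_le_iff₀ htn] at h1
  rw [le_div_iff₀ htn] at h2
  have h4 := hTD n hn
  refine (pow_le_pow_iff_left₀ (hb0 n hn).le (by positivity) two_ne_zero).1 ?_
  rw [mul_pow]
  rcases hG n hn with h | h
  · have h5 : A ≤ (η / 2) ^ 2 * s n := by
      have := h3.trans (hsn n hn)
      rw [div_le_iff₀ (by positivity)] at this
      linarith
    nlinarith
  · have h5 := h _ hε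
    rw [hlog] at h5
    have h6 : Tm (Real.exp (-R) / 2) n ≤ 4 * D * s n := by linarith
    have h7 : A * (4 * D) ≤ R * (η / 2) ^ 2 := by
      rw [hR, add_mul, div_mul_cancel₀ _ (by positivity)]
      have : 0 ≤ (η / 2) ^ 2 := by positivity
      linarith
    have h8 : R * b n ^ 2 ≤ R * ((η / 2) ^ 2 * s n ^ 2) := by
      calc R * b n ^ 2 = b n ^ 2 * R := mul_comm _ _
        _ ≤ A * s n * (4 * D * s n) := h5.trans (by gcongr)
        _ = A * (4 * D) * s n ^ 2 := by ring
        _ ≤ R * (η / 2) ^ 2 * s n ^ 2 := by gcongr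
        _ = _ := by ring
    exact le_of_mul_le_mul_left h8 hR0

theorem cutoff_of_bounds {T Tm : ℝ → ℕ → ℝ} {s b t : ℕ → ℝ} {A : ℝ} (hA : 0 ≤ A)
    (hsn : ∀ n : ℕ, 1 ≤ n → (n : ℝ) ≤ 2 * s n) (hb0 : ∀ n, 1 ≤ n → 0 < b n)
    (hbs : ∀ n, 1 ≤ n → b n ≤ 2 * s n)
    (hTm : ∀ ε ∈ Set.Ioo (0 : ℝ) 1, ∀ n, 1 ≤ n → T ε n ≤ Tm ε n)
    (hU : ∀ ε ∈ Set.Ioo (0 : ℝ) 1, ∃ C, ∀ n, 1 ≤ n → Tm ε n ≤ s n + C * b n)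
    (hL : ∀ ε ∈ Set.Ioo (0 : ℝ) 1, ∃ C, ∀ n, 1 ≤ n → s n - C * b n ≤ T ε n)
    (hG : ∀ n, 1 ≤ n → b n ^ 2 ≤ A * s n ∨ ∀ ε ∈ Set.Ioo (0 : ℝ) 1,
      b n ^ 2 * Real.log (1 / (2 * ε)) ≤ A * s n * Tm ε n)
    (ht : ∀ n, 0 < t n) (hcut : cutoffWith Tm t) :
    cutoffWith T t ∧ cutoffWindow T s b := by
  have hs : ∀ n, 1 ≤ n → 0 < s n := fun n hn => by linarith [hb0 n hn, hbs n hn]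
  have hbs0 := tendsto_window_div_mean hA hsn hb0 hbs (hU _ (by norm_num)) hG ht hcut
  have habs : ∀ ε ∈ Set.Ioo (0 : ℝ) 1, ∃ C, ∀ n, 1 ≤ n →
      |T ε n - s n| ≤ C * b n ∧ |Tm ε n - s n| ≤ C * b n := by
    intro ε hε
    obtain ⟨C, hC⟩ := hU ε hε
    obtain ⟨C', hC'⟩ := hL ε hε
    refine ⟨max C C', fun n hn => ?_⟩
    have h1 := mul_le_mul_of_nonneg_right (le_max_left C C') (hb0 n hn).le
    have h2 := mul_le_mul_of_nonneg_right (le_max_right C C') (hb0 n hn).le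
    have h3 := hC n hn
    have h4 := hC' n hn
    have h5 := hTm ε hε n hn
    constructor <;> rw [abs_le] <;> constructor <;> linarith
  have hst : Tendsto (fun n => s n / t n) atTop (nhds 1) := by
    obtain ⟨C, hC⟩ := habs (1 / 2) (by norm_num)
    have h1 := tendsto_div_nhds_one hs (fun n hn => (hC n hn).2) hbs0
    have h2 := (hcut (1 / 2) (by norm_num)).div h1 one_ne_zero
    rw [div_one] at h2
    refine h2.congr' ?_
    filter_upwards [eventually_ge_atTop 1, h1.eventually_ne one_ne_zero] with n hn hne
    have h3 := (hs n hn).ne'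
    have h4 := (ht n).ne'
    have h5 : Tm (1 / 2) n ≠ 0 := fun h => hne (by rw [h, zero_div])
    simp only [Pi.div_apply]
    field_simp
  refine ⟨fun ε hε => ?_, ?_, ?_, hbs0, fun ε hε => ?_⟩
  · obtain ⟨C, hC⟩ := habs ε hε
    have h1 := (tendsto_div_nhds_one hs (fun n hn => (hC n hn).1) hbs0).mul hst
    rw [one_mul] at h1
    refine h1.congr' ?_
    filter_upwards [eventually_ge_atTop 1] with n hn
    exact div_mul_div_cancel₀ (hs n hn).ne'
  · filter_upwards [eventually_ge_atTop 1] with n hn using hs n hn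
  · filter_upwards [eventually_ge_atTop 1] with n hn using hb0 n hn
  · obtain ⟨C, hC⟩ := habs ε hε
    exact ⟨C, eventually_atTop.2 ⟨1, fun n hn => (hC n hn).1⟩⟩

/-- Theorem `t-tv5`(2).  If `F_c` has a maximum total variation cutoff with
cutoff time `t_n`, then the family started at the boundary states `x_n ∈ {0,n}` maximizing
`E_{x_n} τ̃_{M_n}` has a total variation cutoff with cutoff time `t_n`, and in particular a
`(E_{x_n} τ̃_{M_n}, b_n)` cutoff with `b_n² = max{Var_0 τ̃_{M_n}, Var_n τ̃_{M_n}}`; the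
same holds in discrete time when `inf_{n,i} K_n(i,i) > 0`. -/
theorem birth_death_max_cutoff_gives_boundary_cutoff
    (F : (n : ℕ) → BDChain n)
    (M : (n : ℕ) → Fin (n + 1))
    (hMlow : ∃ c > 0, ∀ n, c ≤ (F n).piLow (M n))
    (hMhigh : ∃ c > 0, ∀ n, c ≤ (F n).piHigh (M n))
    (x : (n : ℕ) → Fin (n + 1))
    (hx : ∀ n, (x n = 0 ∨ x n = Fin.last n) ∧
      max ((F n).hitMeanC (M n) 0) ((F n).hitMeanC (M n) (Fin.last n)) =
        (F n).hitMeanC (M n) (x n))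
    (b : ℕ → ℝ)
    (hb : ∀ n, b n =
      Real.sqrt (max ((F n).hitVarC (M n) 0) ((F n).hitVarC (M n) (Fin.last n))))
    (t : ℕ → ℝ) (ht : ∀ n, 0 < t n) :
    -- continuous time
    ((cutoffWith (fun ε n => mixC ((F n).dTVMaxC) ε) t →
      cutoffWith (fun ε n => mixC ((F n).dTVC (x n)) ε) t ∧
      cutoffWindow (fun ε n => mixC ((F n).dTVC (x n)) ε)
        (fun n => (F n).hitMeanC (M n) (x n)) b) ∧
    -- discrete time
    ((∃ δ > (0 : ℝ), ∀ n, ∀ i : Fin (n + 1), δ ≤ (F n).K i i) →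
      cutoffWith (fun ε n => ((mixD ((F n).dTVMax) ε : ℕ) : ℝ)) t →
      cutoffWith (fun ε n => ((mixD ((F n).dTV (x n)) ε : ℕ) : ℝ)) t ∧
      cutoffWindow (fun ε n => ((mixD ((F n).dTV (x n)) ε : ℕ) : ℝ))
        (fun n => (F n).hitMeanC (M n) (x n)) b)) := by
  obtain ⟨κ₁, hκ₁, h₁⟩ := hMlow
  obtain ⟨κ₂, hκ₂, h₂⟩ := hMhigh
  set κ := min κ₁ κ₂
  have hκ : 0 < κ := lt_min hκ₁ hκ₂
  have key : ∀ n, 1 ≤ n → ∃ (e : BDChain n) (N : ℕ),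
      e.Balanced N ((F n).hitMeanC (M n) (x n)) (b n) κ ∧ e.dTV 0 = (F n).dTV (x n) ∧
      e.dTVC 0 = (F n).dTVC (x n) ∧ e.dTVMax = (F n).dTVMax ∧ e.dTVMaxC = (F n).dTVMaxC ∧
      ∀ i, ∃ j, e.K i i = (F n).K j j := fun n hn =>
    (F n).exists_balanced hn (M n) (x n) (hx n) (hb n) ((min_le_left _ _).trans (h₁ n))
      ((min_le_right _ _).trans (h₂ n))
  have : ∀ n, Nonempty (BDChain n) := fun n => ⟨F n⟩
  choose! e N hbal hdTV hdTVC hdTVMax hdTVMaxC hK using key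
  have hA : 0 ≤ 4 / κ := by positivity
  have hsn := fun n hn => (hbal n hn).toControlled.le_two_mul_mean
  have hb0 := fun n hn => (hbal n hn).pos
  have hbs := fun n hn => (hbal n hn).le_two_mul_mean
  constructor
  · refine cutoff_of_bounds hA hsn hb0 hbs (fun ε hε n hn => ?_)
      (fun ε hε => ⟨BDChain.upperConst ε, fun n hn => ?_⟩)
      (fun ε hε => ⟨BDChain.lowerConst κ ε, fun n hn => ?_⟩)
      (fun n hn => Or.inr fun ε hε => ?_) ht
    · rw [← hdTVC n hn, ← hdTVMaxC n hn]
      exact (hbal n hn).mixC_dTVC_le hε 0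
    · rw [← hdTVMaxC n hn]
      exact (hbal n hn).mixC_dTVMaxC_le hε
    · rw [← hdTVC n hn]
      exact (hbal n hn).mean_sub_le_mixC hκ hε
    · rw [← hdTVMaxC n hn]
      exact (hbal n hn).sq_mul_log_le_mixC hn hκ hε
  · rintro ⟨δ, hδ, hδK⟩
    have hδe : ∀ n, 1 ≤ n → ∀ i, δ ≤ (e n).K i i := fun n hn i => by
      obtain ⟨j, hj⟩ := hK n hn i
      exact hj ▸ hδK n j
    have hmem : ∀ ε ∈ Set.Ioo (0 : ℝ) 1, ∀ n, 1 ≤ n →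
        (F n).dTVMax (mixD (F n).dTVMax ε) ≤ ε := fun ε hε n hn => by
      obtain ⟨C, hC⟩ := BDChain.Balanced.exists_dTVMax_le hδ hε.1
      obtain ⟨m, -, hm⟩ := hC n (e n) (N n) _ _ κ (hbal n hn) (hδe n hn)
      exact Nat.sInf_mem (s := {m : ℕ | (F n).dTVMax m ≤ ε}) ⟨m, hdTVMax n hn ▸ hm⟩
    refine cutoff_of_bounds hA hsn hb0 hbs (fun ε hε n hn => ?_) (fun ε hε => ?_)
      (fun ε hε => ⟨BDChain.lowerConst κ ε, fun n hn => ?_⟩) (fun n hn => ?_) ht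
    · exact Nat.cast_le.2 (Nat.sInf_le (((F n).le_dTVMax (x n) _).trans (hmem ε hε n hn)))
    · obtain ⟨C, hC⟩ := BDChain.Balanced.exists_dTVMax_le hδ hε.1
      refine ⟨C, fun n hn => ?_⟩
      obtain ⟨m, hm, hm'⟩ := hC n (e n) (N n) _ _ κ (hbal n hn) (hδe n hn)
      rw [hdTVMax n hn] at hm'
      exact (Nat.cast_le.2 (Nat.sInf_le hm')).trans hm
    · refine (hbal n hn).mean_sub_le_of_dTV_le hκ hε ?_
      rw [hdTV n hn]
      exact Nat.sInf_mem (s := {m : ℕ | (F n).dTV (x n) m ≤ ε})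
        ⟨_, ((F n).le_dTVMax (x n) _).trans (hmem ε hε n hn)⟩
    · refine ((hbal n hn).sq_mul_log_le_of_dTVMax hn hκ).imp_right fun h ε hε => ?_
      exact h ε _ hε.1 ((hdTVMax n hn).symm ▸ hmem ε hε n hn)

end
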